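/- arXiv:1111.4475 — 3 statements merged into one kernel-verified Lean document; each statement's English description precedes it below -/
import Mathlib

section
/- Global real-analytic eigenvalues and orthonormal eigenvectors of real-analytic curves of normal matrices: let A : ℝ → M_n(ℂ) be a map whose entries are real-analytic functions and such that A(t) is normal for every t ∈ ℝ. Then there exist real-analytic functions λ_1, …, λ_n : ℝ → ℂ and real-analytic maps v_1, …, v_n : ℝ → ℂ^n such that for every t ∈ ℝ the vectors v_1(t), …, v_n(t) form an orthonormal basis of ℂ^n and A(t) v_j(t) = λ_j(t) v_j(t) for every j. -/
open Matrix Filter Topology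

/-- Entrywise real analyticity at a point of a matrix valued function. -/
def MAn {m n : Type*} (A : ℝ → Matrix m n ℂ) (t : ℝ) : Prop :=
  ∀ i j, AnalyticAt ℝ (fun s => A s i j) t

namespace MAn
variable {m n p : Type*} {A B : ℝ → Matrix m n ℂ} {t : ℝ}

theorem conj_an {f : ℝ → ℂ} (hf : AnalyticAt ℝ f t) :
    AnalyticAt ℝ (fun s => star (f s)) t := by
  have h : AnalyticAt ℝ (fun z : ℂ => Complex.conjCLE z) (f t) :=
    Complex.conjCLE.toContinuousLinearMap.analyticAt _
  exact h.comp hf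

theorem const (M : Matrix m n ℂ) : MAn (fun _ => M) t := fun _ _ => analyticAt_const

theorem add (hA : MAn A t) (hB : MAn B t) : MAn (fun s => A s + B s) t :=
  fun i j => (hA i j).add (hB i j)

theorem sub (hA : MAn A t) (hB : MAn B t) : MAn (fun s => A s - B s) t :=
  fun i j => (hA i j).sub (hB i j)

theorem smul {f : ℝ → ℂ} (hf : AnalyticAt ℝ f t) (hA : MAn A t) :
    MAn (fun s => f s • A s) t :=
  fun i j => hf.mul (hA i j)

theorem mul [Fintype n] {C : ℝ → Matrix n p ℂ} (hA : MAn A t) (hC : MAn C t) :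
    MAn (fun s => A s * C s) t := by
  intro i j
  simp only [Matrix.mul_apply]
  exact Finset.analyticAt_fun_sum _ fun k _ => (hA i k).mul (hC k j)

theorem conjTranspose (hA : MAn A t) : MAn (fun s => (A s)ᴴ) t :=
  fun i j => conj_an (hA j i)

theorem trace [Fintype n] {A : ℝ → Matrix n n ℂ} (hA : MAn A t) :
    AnalyticAt ℝ (fun s => (A s).trace) t := by
  simp only [Matrix.trace, Matrix.diag]
  exact Finset.analyticAt_fun_sum _ fun k _ => hA k k

theorem congr (hA : MAn A t) (h : A =ᶠ[𝓝 t] B) : MAn B t :=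
  fun i j => (hA i j).congr (h.mono fun s hs => by simp only [hs])

theorem continuousAt (hA : MAn A t) : ContinuousAt A t :=
  continuousAt_pi.2 fun i => continuousAt_pi.2 fun j => (hA i j).continuousAt

theorem eventually [Finite m] [Finite n] (hA : MAn A t) : ∀ᶠ s in 𝓝 t, MAn A s := by
  simp only [MAn, eventually_all]
  exact fun i j => (hA i j).eventually_analyticAt

theorem toPi [Fintype m] [Fintype n] (hA : MAn A t) :
    AnalyticAt ℝ (F := m → n → ℂ) A t :=
  analyticAt_pi_iff.2 fun i => analyticAt_pi_iff.2 fun j => hA i j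

theorem ofPi [Fintype m] [Fintype n] {A : ℝ → (m → n → ℂ)} (hA : AnalyticAt ℝ A t) :
    MAn (fun s => Matrix.of (A s)) t :=
  fun i j => analyticAt_pi_iff.1 (analyticAt_pi_iff.1 hA i) j

end MAn

/-- Agreement on a punctured neighbourhood of analytic matrices. -/
theorem eq_of_punct {m n : Type*} {A B : ℝ → Matrix m n ℂ} {t : ℝ}
    (hA : MAn A t) (hB : MAn B t) (h : ∀ᶠ s in 𝓝[≠] t, A s = B s) :
    ∀ᶠ s in 𝓝 t, A s = B s :=
  (hA.continuousAt.eventuallyEq_nhds_iff_eventuallyEq_nhdsNE hB.continuousAt).1 h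

section LinAlg
variable {n : ℕ}

theorem trace_nat {P : Matrix (Fin n) (Fin n) ℂ} (hP : P * P = P) :
    ∃ k : ℕ, P.trace = k := by
  have h : IsIdempotentElem (Matrix.toLin' P) := by
    rw [IsIdempotentElem, Module.End.mul_eq_comp, ← Matrix.toLin'_mul, hP]
  exact ⟨_, by rw [← Matrix.trace_toLin'_eq, (LinearMap.IsIdempotentElem.isProj_range _ h).trace]⟩

open scoped ComplexOrder in
theorem eq_zero_of_trace {P : Matrix (Fin n) (Fin n) ℂ} (hH : Pᴴ = P) (hP : P * P = P)
    (h : P.trace = 0) : P = 0 := by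
  rw [← Matrix.trace_conjTranspose_mul_self_eq_zero_iff, hH, hP, h]

open scoped ComplexOrder in
theorem normal_ker {k : Type*} [Fintype k] {A : Matrix (Fin n) (Fin n) ℂ} (hA : A * Aᴴ = Aᴴ * A)
    {l : ℂ} {V : Matrix (Fin n) k ℂ} (h : A * V = l • V) : Aᴴ * V = star l • V := by
  have h1 : (A - l • 1) * V = 0 := by simp [Matrix.sub_mul, h]
  have h2 : (A - l • 1) * (A - l • 1)ᴴ = (A - l • 1)ᴴ * (A - l • 1) := by
    simp only [conjTranspose_sub, conjTranspose_smul, conjTranspose_one, Matrix.sub_mul,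
      Matrix.mul_sub, hA, smul_mul_assoc, mul_smul_comm, Matrix.one_mul, Matrix.mul_one, smul_sub]
    rw [smul_comm]; abel
  have h3 : (A - l • 1)ᴴ * V = 0 := by
    rw [← Matrix.conjTranspose_mul_self_eq_zero, conjTranspose_mul, conjTranspose_conjTranspose,
      Matrix.mul_assoc, ← Matrix.mul_assoc _ _ V, h2, Matrix.mul_assoc, h1]
    simp
  simpa [Matrix.sub_mul, sub_eq_zero] using h3

end LinAlg

/-- Frame on `s` diagonalising `A`. -/
def Diag {n : ℕ} (s : Set ℝ) (A : ℝ → Matrix (Fin n) (Fin n) ℂ) : Prop :=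
  ∃ (l : Fin n → ℝ → ℂ) (U : ℝ → Matrix (Fin n) (Fin n) ℂ),
    (∀ t ∈ s, ∀ j, AnalyticAt ℝ (l j) t) ∧ (∀ t ∈ s, MAn U t) ∧
    ∀ t ∈ s, (U t)ᴴ * U t = 1 ∧ A t * U t = U t * diagonal (fun j => l j t)

theorem Diag.mono {n : ℕ} {s s' : Set ℝ} {A : ℝ → Matrix (Fin n) (Fin n) ℂ} (h : Diag s A)
    (hs : s' ⊆ s) : Diag s' A := by
  obtain ⟨l, U, h1, h2, h3⟩ := h
  exact ⟨l, U, fun t ht => h1 t (hs ht), fun t ht => h2 t (hs ht), fun t ht => h3 t (hs ht)⟩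

theorem diag_combine {n k m : ℕ} {s : Set ℝ} {A : ℝ → Matrix (Fin n) (Fin n) ℂ}
    (hkm : n = k + m)
    {V : ℝ → Matrix (Fin n) (Fin k) ℂ} {W : ℝ → Matrix (Fin n) (Fin m) ℂ}
    (hV : ∀ t ∈ s, MAn V t) (hW : ∀ t ∈ s, MAn W t)
    (hVV : ∀ t ∈ s, (V t)ᴴ * V t = 1) (hWW : ∀ t ∈ s, (W t)ᴴ * W t = 1)
    (hVW : ∀ t ∈ s, V t * (V t)ᴴ + W t * (W t)ᴴ = 1)
    {A1 : ℝ → Matrix (Fin k) (Fin k) ℂ} {A2 : ℝ → Matrix (Fin m) (Fin m) ℂ}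
    (hA1 : ∀ t ∈ s, A t * V t = V t * A1 t) (hA2 : ∀ t ∈ s, A t * W t = W t * A2 t)
    (hD1 : Diag s A1) (hD2 : Diag s A2) : Diag s A := by
  obtain ⟨l1, U1, h1l, h1U, h1⟩ := hD1
  obtain ⟨l2, U2, h2l, h2U, h2⟩ := hD2
  let e : Fin n ≃ Fin k ⊕ Fin m := (finCongr hkm).trans finSumFinEquiv.symm
  refine ⟨fun j => Sum.elim l1 l2 (e j),
    fun t => (fromCols (V t * U1 t) (W t * U2 t)).submatrix id e, ?_, ?_, ?_⟩
  · intro t ht j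
    rcases h : e j with a | a
    · simpa [h] using h1l t ht a
    · simpa [h] using h2l t ht a
  · intro t ht i j
    rcases h : e j with a | a
    · simpa [h] using (hV t ht).mul (h1U t ht) i a
    · simpa [h] using (hW t ht).mul (h2U t ht) i a
  · intro t ht
    have hort : (V t)ᴴ * W t = 0 := by
      have := congrArg (fun M => (V t)ᴴ * M * W t) (hVW t ht)
      simp only [Matrix.mul_add, Matrix.add_mul, Matrix.mul_one] at this
      rw [← Matrix.mul_assoc, hVV t ht, Matrix.mul_assoc, Matrix.mul_assoc, Matrix.mul_assoc,
        hWW t ht] at this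
      simpa using this
    have hort' : (W t)ᴴ * V t = 0 := by
      have := congrArg conjTranspose hort
      simpa using this
    beta_reduce
    constructor
    · rw [conjTranspose_submatrix, ← submatrix_mul _ _ _ _ _ Function.bijective_id, conjTranspose_fromCols_eq_fromRows_conjTranspose, fromRows_mul_fromCols]
      have e1 : (V t * U1 t)ᴴ * (V t * U1 t) = 1 := by
        rw [conjTranspose_mul, Matrix.mul_assoc, ← Matrix.mul_assoc _ (V t), hVV t ht,
          Matrix.one_mul, (h1 t ht).1]
      have e2 : (W t * U2 t)ᴴ * (W t * U2 t) = 1 := by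
        rw [conjTranspose_mul, Matrix.mul_assoc, ← Matrix.mul_assoc _ (W t), hWW t ht,
          Matrix.one_mul, (h2 t ht).1]
      have e3 : (V t * U1 t)ᴴ * (W t * U2 t) = 0 := by
        rw [conjTranspose_mul, Matrix.mul_assoc, ← Matrix.mul_assoc _ (W t), hort]; simp
      have e4 : (W t * U2 t)ᴴ * (V t * U1 t) = 0 := by
        rw [conjTranspose_mul, Matrix.mul_assoc, ← Matrix.mul_assoc _ (V t), hort']; simp
      rw [e1, e2, e3, e4, fromBlocks_one]
      simp
    · have hd : diagonal (fun j => Sum.elim l1 l2 (e j) t) =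
          (fromBlocks (diagonal fun j => l1 j t) 0 0 (diagonal fun j => l2 j t)).submatrix e e := by
        rw [fromBlocks_diagonal, submatrix_diagonal_equiv]
        congr 1; ext j
        rcases h : e j with a | a <;> simp [h]
      rw [hd, submatrix_mul_equiv, fromCols_mul_fromBlocks]
      ext i j
      have f1 : A t * (V t * U1 t) = V t * U1 t * diagonal fun j => l1 j t := by
        rw [← Matrix.mul_assoc, hA1 t ht, Matrix.mul_assoc, (h1 t ht).2, Matrix.mul_assoc]
      have f2 : A t * (W t * U2 t) = W t * U2 t * diagonal fun j => l2 j t := by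
        rw [← Matrix.mul_assoc, hA2 t ht, Matrix.mul_assoc, (h2 t ht).2, Matrix.mul_assoc]
      rw [← f1, ← f2]
      rcases h : e j with a | a <;> simp [h, Matrix.mul_apply]
open Matrix Filter Topology

theorem generic_local {n : ℕ} {P : ℝ → Matrix (Fin n) (Fin n) ℂ} {t₀ : ℝ} (hP : MAn P t₀)
    (h0 : P t₀ ≠ 0) :
    ∃ u ∈ 𝓝 t₀, dimH {w : Fin n → ℂ | ∃ t ∈ u, P t *ᵥ w = 0} ≤ ((2 * n - 1 : ℕ) : ENNReal) := by
  obtain ⟨i, j, hij⟩ : ∃ i j, P t₀ i j ≠ 0 := by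
    by_contra! h
    exact h0 (by ext i j; simpa using h i j)
  obtain ⟨ε, hε, hball⟩ := Metric.eventually_nhds_iff_ball.1
    (hP.eventually.and ((hP i j).continuousAt.eventually_ne hij))
  refine ⟨Metric.ball t₀ ε, Metric.ball_mem_nhds _ hε, ?_⟩
  let f : ℝ × ({l : Fin n // l ≠ j} → ℂ) → (Fin n → ℂ) := fun p l =>
    if h : l ≠ j then p.2 ⟨l, h⟩ else
      -(P p.1 i j)⁻¹ * ∑ l : {l : Fin n // l ≠ j}, P p.1 i l * p.2 l
  have hsub : {w : Fin n → ℂ | ∃ t ∈ Metric.ball t₀ ε, P t *ᵥ w = 0} ⊆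
      f '' (Metric.ball t₀ ε ×ˢ Set.univ) := by
    rintro w ⟨t, ht, hw⟩
    refine ⟨(t, fun l => w l), ⟨ht, Set.mem_univ _⟩, ?_⟩
    ext l
    by_cases h : l = j
    · subst h
      have hne := (hball t ht).2
      have hi : ∑ l, P t i l * w l = 0 := by
        simpa [mulVec, dotProduct] using congrFun hw i
      rw [← Finset.add_sum_erase _ _ (Finset.mem_univ l),
        Finset.sum_subtype (p := fun x => x ≠ l) (Finset.univ.erase l) (by simp) (fun x => P t i x * w x)] at hi
      simp only [f, ne_eq, not_true_eq_false, dite_false]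
      field_simp
      linear_combination -hi
    · simp [f, h]
  have han : ContDiffOn ℝ 1 f (Metric.ball t₀ ε ×ˢ Set.univ) := by
    intro p hp
    have hp1 := hball p.1 hp.1
    have hPl : ∀ l, AnalyticAt ℝ (fun q : ℝ × ({l : Fin n // l ≠ j} → ℂ) => P q.1 i l) p :=
      fun l => (hp1.1 i l).comp (analyticAt_fst (𝕜 := ℝ) (p := p))
    have hxl : ∀ l, AnalyticAt ℝ (fun q : ℝ × ({l : Fin n // l ≠ j} → ℂ) => q.2 l) p :=
      fun l => analyticAt_pi_iff.1 (analyticAt_snd (𝕜 := ℝ) (p := p)) l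
    refine (AnalyticAt.contDiffAt ?_).contDiffWithinAt
    refine analyticAt_pi_iff.2 fun l => ?_
    by_cases h : l = j
    · simp only [f, h, ne_eq, not_true_eq_false, dite_false]
      refine ((hPl j).inv hp1.2).neg.mul ?_
      exact Finset.analyticAt_fun_sum _ fun k _ => (hPl k).mul (hxl k)
    · simpa [f, h] using hxl ⟨l, h⟩
  have hconv : Convex ℝ (Metric.ball t₀ ε ×ˢ (Set.univ : Set ({l : Fin n // l ≠ j} → ℂ))) :=
    (convex_ball _ _).prod convex_univ
  calc _ ≤ _ := dimH_mono hsub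
    _ ≤ _ := han.dimH_image_le hconv subset_rfl
    _ ≤ _ := dimH_mono (Set.subset_univ _)
    _ = _ := Real.dimH_univ_eq_finrank _
    _ ≤ _ := by
      have hc : Fintype.card {l : Fin n // l ≠ j} = n - 1 := by simp [Fintype.card_subtype_compl]
      have : Module.finrank ℝ (ℝ × ({l : Fin n // l ≠ j} → ℂ)) = 1 + (n - 1) * 2 := by
        rw [Module.finrank_prod, Module.finrank_self, Module.finrank_pi_fintype]
        simp only [Complex.finrank_real_complex, Finset.sum_const, Finset.card_univ, hc, smul_eq_mul]
      rw [this]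
      have : 0 < n := j.pos
      exact_mod_cast (by omega)

theorem generic {n : ℕ} {s : Set ℝ} {P : ℝ → Matrix (Fin n) (Fin n) ℂ}
    (hP : ∀ t ∈ s, MAn P t) (h0 : ∀ t ∈ s, P t ≠ 0) :
    ∃ w : Fin n → ℂ, ∀ t ∈ s, P t *ᵥ w ≠ 0 := by
  rcases s.eq_empty_or_nonempty with rfl | ⟨t₁, ht₁⟩
  · exact ⟨0, by simp⟩
  have hn : 0 < n := by
    rcases Nat.eq_zero_or_pos n with rfl | h
    · exact absurd (Subsingleton.elim _ _) (h0 t₁ ht₁)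
    · exact h
  have H : ∀ t, ∃ u : Set ℝ, t ∈ s → u ∈ 𝓝 t ∧
      dimH {w : Fin n → ℂ | ∃ t ∈ u, P t *ᵥ w = 0} ≤ ((2 * n - 1 : ℕ) : ENNReal) := by
    intro t
    by_cases ht : t ∈ s
    · obtain ⟨u, h1, h2⟩ := generic_local (hP t ht) (h0 t ht)
      exact ⟨u, fun _ => ⟨h1, h2⟩⟩
    · exact ⟨∅, fun h => absurd h ht⟩
  choose u hu using H
  obtain ⟨c, hcs, hcc, hcov⟩ := TopologicalSpace.countable_cover_nhdsWithin
    (fun t ht => mem_nhdsWithin_of_mem_nhds (hu t ht).1)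
  by_contra! hcon
  have huniv : (Set.univ : Set (Fin n → ℂ)) ⊆
      ⋃ t ∈ c, {w : Fin n → ℂ | ∃ t' ∈ u t, P t' *ᵥ w = 0} := by
    intro w _
    obtain ⟨t, ht, hw⟩ := hcon w
    obtain ⟨t', ht', h⟩ := Set.mem_iUnion₂.1 (hcov ht)
    exact Set.mem_iUnion₂.2 ⟨t', ht', t, h, hw⟩
  have h1 := dimH_mono huniv
  rw [dimH_bUnion hcc, Real.dimH_univ_eq_finrank, Module.finrank_pi_fintype] at h1
  have h2 := h1.trans (iSup₂_le fun t ht => (hu t (hcs ht)).2)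
  simp only [Complex.finrank_real_complex, Finset.sum_const, Finset.card_univ, Fintype.card_fin,
    smul_eq_mul] at h2
  have h3 : n * 2 ≤ 2 * n - 1 := by exact_mod_cast h2
  omega

theorem exists_unit {n : ℕ} {s : Set ℝ} {P : ℝ → Matrix (Fin n) (Fin n) ℂ}
    (hP : ∀ t ∈ s, MAn P t) (h0 : ∀ t ∈ s, P t ≠ 0) (hPP : ∀ t ∈ s, P t * P t = P t) :
    ∃ v : ℝ → Matrix (Fin n) (Fin 1) ℂ, (∀ t ∈ s, MAn v t) ∧
      ∀ t ∈ s, (v t)ᴴ * v t = 1 ∧ P t * v t = v t := by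
  obtain ⟨w, hw⟩ := generic hP h0
  let C : ℝ → Matrix (Fin n) (Fin 1) ℂ := fun t => P t * Matrix.of fun i _ => w i
  let N : ℝ → ℝ := fun t => ∑ i, ‖C t i 0‖ ^ 2
  have hC : ∀ t ∈ s, MAn C t := fun t ht => (hP t ht).mul (MAn.const _)
  have hN : ∀ t, ((C t)ᴴ * C t) 0 0 = (N t : ℂ) := by
    intro t
    simp only [Matrix.mul_apply, conjTranspose_apply, N]
    push_cast
    exact Finset.sum_congr rfl fun i _ => Complex.conj_mul' _
  have hNpos : ∀ t ∈ s, 0 < N t := by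
    intro t ht
    obtain ⟨i, hi⟩ := Function.ne_iff.1 (hw t ht)
    refine Finset.sum_pos' (fun i _ => by positivity) ⟨i, Finset.mem_univ _, ?_⟩
    have : C t i 0 ≠ 0 := by
      simpa [C, Matrix.mul_apply, mulVec, dotProduct] using hi
    positivity
  have hNan : ∀ t ∈ s, AnalyticAt ℝ N t := by
    intro t ht
    have h1 : AnalyticAt ℝ (fun t => Complex.reCLM (((C t)ᴴ * C t) 0 0)) t :=
      (Complex.reCLM.analyticAt _).comp (((hC t ht).conjTranspose.mul (hC t ht)) 0 0)
    refine h1.congr (Eventually.of_forall fun t => ?_)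
    simp [hN]
  let r : ℝ → ℝ := fun t => Real.exp (-(1/2) * Real.log (N t))
  have hr : ∀ t ∈ s, r t * r t * N t = 1 := by
    intro t ht
    have : Real.exp (Real.log (N t)) = N t := Real.exp_log (hNpos t ht)
    nth_rw 1 [← this]
    simp only [r, ← Real.exp_add]
    rw [Real.exp_eq_one_iff]; ring
  have hran : ∀ t ∈ s, AnalyticAt ℝ (fun t => (r t : ℂ)) t := by
    intro t ht
    have h1 : AnalyticAt ℝ r t :=
      (analyticAt_const.mul ((hNan t ht).log (hNpos t ht))).rexp
    exact (Complex.ofRealCLM.analyticAt _).comp h1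
  refine ⟨fun t => (r t : ℂ) • C t, fun t ht => (hC t ht).smul (hran t ht), fun t ht => ⟨?_, ?_⟩⟩
  · have h1 : (C t)ᴴ * C t = (N t : ℂ) • 1 := by
      ext i j
      rw [Subsingleton.elim i 0, Subsingleton.elim j 0, hN]; simp
    have h2 : ((r t : ℂ) * r t * N t) = 1 := by exact_mod_cast hr t ht
    simp only [conjTranspose_smul, Matrix.smul_mul, Matrix.mul_smul, h1, smul_smul]
    rw [show star (r t : ℂ) = r t from Complex.conj_ofReal _, ← mul_assoc, h2, one_smul]
  · simp only [C, Matrix.mul_smul]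
    rw [← Matrix.mul_assoc, hPP t ht]

theorem exists_frame {n : ℕ} {s : Set ℝ} (k : ℕ) : ∀ {P : ℝ → Matrix (Fin n) (Fin n) ℂ},
    (∀ t ∈ s, MAn P t) → (∀ t ∈ s, (P t)ᴴ = P t) → (∀ t ∈ s, P t * P t = P t) →
    (∀ t ∈ s, (P t).trace = k) →
    ∃ V : ℝ → Matrix (Fin n) (Fin k) ℂ, (∀ t ∈ s, MAn V t) ∧
      ∀ t ∈ s, (V t)ᴴ * V t = 1 ∧ V t * (V t)ᴴ = P t := by
  induction k with
  | zero =>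
    intro P hP hH hPP htr
    refine ⟨fun _ => 0, fun t ht => MAn.const _, fun t ht => ⟨Subsingleton.elim _ _, ?_⟩⟩
    rw [eq_zero_of_trace (hH t ht) (hPP t ht) (by simpa using htr t ht)]
    simp
  | succ k ih =>
    intro P hP hH hPP htr
    obtain ⟨v, hv, hvP⟩ := exists_unit hP (fun t ht h => by
      have := htr t ht
      rw [h, Matrix.trace_zero] at this
      exact absurd this.symm (Nat.cast_ne_zero.2 (Nat.succ_ne_zero k))) hPP
    have hvP' : ∀ t ∈ s, (v t)ᴴ * P t = (v t)ᴴ := fun t ht => by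
      have := congrArg conjTranspose (hvP t ht).2
      rwa [conjTranspose_mul, hH t ht] at this
    obtain ⟨V, hV, hVP⟩ := @ih (fun t => P t - v t * (v t)ᴴ)
      (fun t ht => (hP t ht).sub ((hv t ht).mul (hv t ht).conjTranspose))
      (fun t ht => by simp [hH t ht])
      (fun t ht => by
        have : v t * (v t)ᴴ * (v t * (v t)ᴴ) = v t * (v t)ᴴ := by
          rw [Matrix.mul_assoc, ← Matrix.mul_assoc _ (v t), (hvP t ht).1, Matrix.one_mul]
        simp only [Matrix.sub_mul, Matrix.mul_sub, hPP t ht, this]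
        rw [← Matrix.mul_assoc, (hvP t ht).2, Matrix.mul_assoc, hvP' t ht]
        abel)
      (fun t ht => by
        rw [Matrix.trace_sub, htr t ht, Matrix.trace_mul_comm, (hvP t ht).1]
        simp)
    let e : Fin (k + 1) ≃ Fin k ⊕ Fin 1 := finSumFinEquiv.symm
    refine ⟨fun t => (fromCols (V t) (v t)).submatrix id e, ?_, fun t ht => ⟨?_, ?_⟩⟩
    · intro t ht i j
      rcases h : e j with a | a
      · simpa [h] using hV t ht i a
      · simpa [h] using hv t ht i a
    · beta_reduce
      have h1 : (V t)ᴴ * v t = 0 := by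
        have : (V t)ᴴ * (V t * (V t)ᴴ) * v t = 0 := by
          rw [(hVP t ht).2, Matrix.mul_assoc, Matrix.sub_mul, (hvP t ht).2, Matrix.mul_assoc,
            (hvP t ht).1]
          simp
        rwa [← Matrix.mul_assoc, (hVP t ht).1, Matrix.one_mul] at this
      have h2 : (v t)ᴴ * V t = 0 := by
        simpa using congrArg conjTranspose h1
      rw [conjTranspose_submatrix, ← submatrix_mul _ _ _ _ _ Function.bijective_id,
        conjTranspose_fromCols_eq_fromRows_conjTranspose, fromRows_mul_fromCols, h1, h2,
        (hVP t ht).1, (hvP t ht).1, fromBlocks_one]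
      simp
    · beta_reduce
      rw [conjTranspose_submatrix, submatrix_mul_equiv,
        conjTranspose_fromCols_eq_fromRows_conjTranspose, fromCols_mul_fromRows, (hVP t ht).2]
      simp
open Matrix Filter Topology
open scoped ContDiff

section Banach
variable {𝔸 : Type*} [NormedRing 𝔸] [NormedAlgebra ℝ 𝔸]

theorem sylvester_unique {R S C : 𝔸} (hR : ‖R - 1‖ < 1 / 2) (hS : ‖S - 1‖ < 1 / 2)
    (h : R * C + C * S = 0) : C = 0 := by
  by_contra hC
  have hC' : 0 < ‖C‖ := norm_pos_iff.2 hC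
  have h1 : (2 : ℝ) • C = -((R - 1) * C + C * (S - 1)) := by
    rw [sub_mul, mul_sub, one_mul, mul_one, two_smul]
    have : R * C = - (C * S) := eq_neg_of_add_eq_zero_left h
    rw [this]; abel
  have h2 : 2 * ‖C‖ ≤ ‖R - 1‖ * ‖C‖ + ‖C‖ * ‖S - 1‖ := by
    calc 2 * ‖C‖ = ‖(2 : ℝ) • C‖ := by rw [norm_smul]; norm_num
      _ = ‖(R - 1) * C + C * (S - 1)‖ := by rw [h1, norm_neg]
      _ ≤ _ := (norm_add_le _ _).trans (add_le_add (norm_mul_le _ _) (norm_mul_le _ _))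
  nlinarith

theorem exists_sqrt [CompleteSpace 𝔸] :
    ∃ g : 𝔸 → 𝔸, AnalyticAt ℝ g 1 ∧ g 1 = 1 ∧ ∀ᶠ y in 𝓝 (1 : 𝔸), g y * g y = y := by
  let f : 𝔸 → 𝔸 := fun x => x * x
  let f' : 𝔸 ≃L[ℝ] 𝔸 := ContinuousLinearEquiv.smulLeft (Units.mk0 (2 : ℝ) two_ne_zero)
  have hf : AnalyticAt ℝ f 1 := analyticAt_id.mul analyticAt_id
  have hfd : HasStrictFDerivAt f (f' : 𝔸 →L[ℝ] 𝔸) 1 := by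
    have h := (hasStrictFDerivAt_id (𝕜 := ℝ) (1 : 𝔸)).mul' (hasStrictFDerivAt_id (1 : 𝔸))
    refine h.congr_fderiv ?_
    ext x
    simp [f', two_smul, Units.smul_def]
  have hcd : ContDiffAt ℝ ω f 1 := hf.contDiffAt
  have h1 := hcd.to_localInverse hfd.hasFDerivAt (by simp)
  have f1 : f 1 = 1 := by simp [f]
  have hs := hcd.hasStrictFDerivAt' hfd.hasFDerivAt (by simp)
  rw [f1] at h1
  refine ⟨_, h1.analyticAt, ?_, ?_⟩
  · have := hcd.localInverse_apply_image hfd.hasFDerivAt (by simp)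
    rwa [f1] at this
  · have := hs.eventually_right_inverse
    rw [f1] at this
    exact this

theorem lift_idem [CompleteSpace 𝔸] [StarRing 𝔸] [NormedStarGroup 𝔸] {E : ℝ → 𝔸} {t₀ : ℝ}
    [StarModule ℝ 𝔸]
    (hE : AnalyticAt ℝ E t₀) (h0 : E t₀ * E t₀ = E t₀) :
    ∃ P : ℝ → 𝔸, AnalyticAt ℝ P t₀ ∧ P t₀ = E t₀ ∧ ∀ᶠ t in 𝓝 t₀, P t * P t = P t ∧
      (∀ B, Commute B (E t) → Commute B (P t)) ∧ (star (E t) = E t → star (P t) = P t) := by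
  obtain ⟨g, hg, hg1, hgg⟩ := exists_sqrt (𝔸 := 𝔸)
  let F : ℝ → 𝔸 := fun t => (2 : ℝ) • E t - 1
  have hF : AnalyticAt ℝ F t₀ := (hE.const_smul (c := (2 : ℝ))).sub analyticAt_const
  let Y : ℝ → 𝔸 := fun t => F t * F t
  have hY : AnalyticAt ℝ Y t₀ := hF.mul hF
  have hY0 : Y t₀ = 1 := by
    simp only [Y, F, sub_mul, mul_sub, smul_mul_smul_comm, h0, one_mul, mul_one]
    module
  let R : ℝ → 𝔸 := fun t => g (Y t)
  have hR : AnalyticAt ℝ R t₀ := AnalyticAt.comp (by rwa [hY0]) hY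
  have hR0 : R t₀ = 1 := by simp only [R, hY0, hg1]
  have hRR : ∀ᶠ t in 𝓝 t₀, R t * R t = Y t := by
    have := hY.continuousAt.tendsto
    rw [hY0] at this
    exact this.eventually hgg
  have hRn : ∀ᶠ t in 𝓝 t₀, ‖R t - 1‖ < 1 / 2 := by
    have := hR.continuousAt.tendsto
    rw [hR0] at this
    filter_upwards [this.eventually (Metric.ball_mem_nhds (1 : 𝔸) (by norm_num : (0:ℝ) < 1 / 2))]
      with t ht
    simpa [dist_eq_norm] using ht
  have hRu : ∀ᶠ t in 𝓝 t₀, IsUnit (R t) := by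
    have := hR.continuousAt.tendsto
    rw [hR0] at this
    exact this.eventually (Units.isOpen.mem_nhds isUnit_one)
  let Q : ℝ → 𝔸 := fun t => Ring.inverse (R t)
  have hQ : AnalyticAt ℝ Q t₀ := by
    refine AnalyticAt.comp (g := Ring.inverse) ?_ hR
    rw [hR0]
    exact analyticAt_inverse (1 : 𝔸ˣ)
  have hQ0 : Q t₀ = 1 := by simp [Q, hR0]
  refine ⟨fun t => (1 / 2 : ℝ) • (1 + F t * Q t), ?_, ?_, ?_⟩
  · exact (analyticAt_const.add (hF.mul hQ)).const_smul (c := (1 / 2 : ℝ))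
  · simp only [hQ0, F, mul_one]
    module
  · filter_upwards [hRR, hRn, hRu] with t h1 h2 h3
    have hcomm : ∀ B, Commute B (E t) → Commute B (R t) := by
      intro B hB
      have hBF : Commute B (F t) := (hB.smul_right _).sub_right (Commute.one_right _)
      have hBY : Commute B (R t * R t) := by rw [h1]; exact hBF.mul_right hBF
      have : B * R t - R t * B = 0 := by
        apply sylvester_unique h2 h2
        have := hBY.eq
        simp only [mul_sub, sub_mul, ← mul_assoc] at this ⊢
        rw [this]; abel
      exact sub_eq_zero.1 this
    have hcQ : ∀ B, Commute B (R t) → Commute B (Q t) := by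
      intro B hB
      obtain ⟨u, hu⟩ := h3
      simp only [Q]
      rw [← hu] at hB ⊢
      rw [Ring.inverse_unit]
      exact hB.units_inv_right
    have hFE : ∀ B, Commute B (E t) → Commute B (F t) := fun B hB =>
      (hB.smul_right _).sub_right (Commute.one_right _)
    have hER := hcomm _ (Commute.refl (E t))
    have hFR : Commute (F t) (R t) := (hFE _ hER.symm).symm
    have hFQ : Commute (F t) (Q t) := hcQ _ hFR
    have hRQ : R t * Q t = 1 := Ring.mul_inverse_cancel _ h3
    refine ⟨?_, ?_, ?_⟩
    · have h4 : F t * Q t * (F t * Q t) = 1 := by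
        calc F t * Q t * (F t * Q t) = F t * (Q t * F t) * Q t := by noncomm_ring
          _ = (F t * F t) * Q t * Q t := by rw [← hFQ.eq]; noncomm_ring
          _ = R t * R t * Q t * Q t := by rw [h1]
          _ = R t * (R t * Q t) * Q t := by noncomm_ring
          _ = 1 := by rw [hRQ, mul_one, hRQ]
      simp only [smul_mul_smul_comm, mul_add, add_mul, one_mul, mul_one, h4]
      module
    · intro B hB
      exact ((Commute.one_right _).add_right ((hFE B hB).mul_right (hcQ _ (hcomm _ hB)))).smul_right _
    · intro hs
      have hFs : star (F t) = F t := by simp [F, hs]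
      have hRs : star (R t) = R t := by
        have h5 : star (R t) * star (R t) = R t * R t := by
          rw [← star_mul, h1]; simp [Y, hFs]
        have : star (R t) - R t = 0 := by
          apply sylvester_unique (R := star (R t)) (S := R t) _ h2
          · rw [mul_sub, sub_mul, h5]; abel
          · rwa [← norm_star, star_sub, star_star, star_one]
        exact sub_eq_zero.1 this
      have hQs : star (Q t) = Q t := by
        have h6 : star (Q t) * R t = 1 := by
          have := congrArg star hRQ
          rwa [star_mul, hRs, star_one] at this
        calc star (Q t) = star (Q t) * (R t * Q t) := by rw [hRQ, mul_one]
          _ = Q t := by rw [← mul_assoc, h6, one_mul]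
      simp only [star_smul, star_add, star_one, star_mul, hQs, hFs, hFQ.eq, star_trivial]
end Banach

section Mat
variable {n : ℕ}

open scoped Matrix.Norms.L2Operator in
theorem lift_idem_mat {E : ℝ → Matrix (Fin n) (Fin n) ℂ} {t₀ : ℝ}
    (hE : MAn E t₀) (h0 : E t₀ * E t₀ = E t₀) :
    ∃ P : ℝ → Matrix (Fin n) (Fin n) ℂ, MAn P t₀ ∧ P t₀ = E t₀ ∧ ∀ᶠ t in 𝓝 t₀, P t * P t = P t ∧
      (∀ B, Commute B (E t) → Commute B (P t)) ∧ ((E t)ᴴ = E t → (P t)ᴴ = P t) := by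
  have hE' : AnalyticAt ℝ E t₀ := by
    have : AnalyticAt ℝ (fun t => ∑ i, ∑ j, E t i j • Matrix.single i j (1 : ℂ)) t₀ :=
      Finset.analyticAt_fun_sum _ fun i _ => Finset.analyticAt_fun_sum _ fun j _ =>
        (hE i j).smul analyticAt_const
    refine this.congr (Eventually.of_forall fun t => ?_)
    conv_rhs => rw [Matrix.matrix_eq_sum_single (E t)]
    simp
  obtain ⟨P, h1, h2, h3⟩ := lift_idem hE' h0
  refine ⟨P, fun i j => ?_, h2, h3⟩
  let φ : Matrix (Fin n) (Fin n) ℂ →L[ℝ] ℂ :=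
    LinearMap.toContinuousLinearMap (Matrix.entryLinearMap ℝ ℂ i j)
  exact (φ.analyticAt _).comp h1

/-- nontrivial spectral idempotent -/
theorem exists_poly {H : Matrix (Fin n) (Fin n) ℂ} (hH : Hᴴ = H) (hs : ∀ c : ℂ, H ≠ c • 1) :
    ∃ q : Polynomial ℝ, let E := Polynomial.aeval H q
      E * E = E ∧ E ≠ 0 ∧ E ≠ 1 := by
  have hsa : IsSelfAdjoint H := hH
  have hfin := H.finite_real_spectrum
  have hne : ∃ a ∈ spectrum ℝ H, ∃ b ∈ spectrum ℝ H, a ≠ b := by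
    by_contra! hcon
    have : ∃ c : ℝ, ∀ x ∈ spectrum ℝ H, x = c := by
      rcases (spectrum ℝ H).eq_empty_or_nonempty with h | ⟨c, hc⟩
      · exact ⟨0, by simp [h]⟩
      · exact ⟨c, fun x hx => hcon x hx c hc⟩
    obtain ⟨c, hc⟩ := this
    apply hs (c : ℂ)
    calc H = cfc (id : ℝ → ℝ) H := (cfc_id ℝ H).symm
      _ = cfc (fun _ => c) H := cfc_congr hc
      _ = algebraMap ℝ _ c := cfc_const c H
      _ = _ := by
        rw [Algebra.algebraMap_eq_smul_one]
        ext i j; simp [Matrix.smul_apply]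
  obtain ⟨a, ha, b, hb, hab⟩ := hne
  let S := hfin.toFinset
  let q : Polynomial ℝ := Lagrange.basis S id a
  have hqa : q.eval a = 1 := Lagrange.eval_basis_self (Set.injOn_id _) (by simpa [S] using ha)
  have hqx : ∀ x ∈ spectrum ℝ H, x ≠ a → q.eval x = 0 := fun x hx hxa =>
    Lagrange.eval_basis_of_ne (v := id) (Ne.symm hxa) (by simpa [S] using hx)
  have hq : ∀ x ∈ spectrum ℝ H, (q * q).eval x = q.eval x := by
    intro x hx
    rw [Polynomial.eval_mul]
    by_cases h : x = a
    · rw [h, hqa, one_mul]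
    · rw [hqx x hx h, mul_zero]
  refine ⟨q, ?_, ?_, ?_⟩
  · rw [← map_mul, ← cfc_polynomial (q * q) H, ← cfc_polynomial q H]
    exact cfc_congr hq
  · intro h
    rw [← cfc_polynomial q H, ← cfc_zero ℝ H, cfc_eq_cfc_iff_eqOn] at h
    have := h ha
    simp [hqa] at this
  · intro h
    rw [← cfc_polynomial q H, ← cfc_one ℝ H, cfc_eq_cfc_iff_eqOn] at h
    have := h hb
    simp [hqx b hb hab.symm] at this

theorem MAn.aeval {H : ℝ → Matrix (Fin n) (Fin n) ℂ} {t : ℝ} (hH : MAn H t) (q : Polynomial ℝ) :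
    MAn (fun s => Polynomial.aeval (H s) q) t := by
  induction q using Polynomial.induction_on' with
  | add p q hp hq => simpa using hp.add hq
  | monomial k a =>
    simp only [Polynomial.aeval_monomial]
    refine (MAn.const _).mul ?_
    induction k with
    | zero => simpa using MAn.const 1
    | succ k ih => simpa [pow_succ] using ih.mul hH

end Mat
open Matrix Filter Topology

section Local
variable {n : ℕ}

theorem compress {s : Set ℝ} {k : ℕ} {A P : ℝ → Matrix (Fin n) (Fin n) ℂ}
    (hA : ∀ t ∈ s, MAn A t) (hN : ∀ t ∈ s, A t * (A t)ᴴ = (A t)ᴴ * A t)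
    (hP : ∀ t ∈ s, MAn P t) (hH : ∀ t ∈ s, (P t)ᴴ = P t) (hPP : ∀ t ∈ s, P t * P t = P t)
    (hc : ∀ t ∈ s, A t * P t = P t * A t) (htr : ∀ t ∈ s, (P t).trace = k) :
    ∃ (V : ℝ → Matrix (Fin n) (Fin k) ℂ) (A1 : ℝ → Matrix (Fin k) (Fin k) ℂ),
      (∀ t ∈ s, MAn V t) ∧ (∀ t ∈ s, MAn A1 t) ∧ (∀ t ∈ s, (V t)ᴴ * V t = 1) ∧
      (∀ t ∈ s, V t * (V t)ᴴ = P t) ∧ (∀ t ∈ s, A t * V t = V t * A1 t) ∧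
      (∀ t ∈ s, A1 t * (A1 t)ᴴ = (A1 t)ᴴ * A1 t) := by
  obtain ⟨V, hV, hVP⟩ := exists_frame k hP hH hPP htr
  have key : ∀ t ∈ s, ∀ M : Matrix (Fin n) (Fin n) ℂ, M * P t = P t * M →
      M * V t = V t * ((V t)ᴴ * M * V t) := by
    intro t ht M hM
    calc M * V t = M * (V t * ((V t)ᴴ * V t)) := by rw [(hVP t ht).1, Matrix.mul_one]
      _ = M * (V t * (V t)ᴴ) * V t := by simp only [Matrix.mul_assoc]
      _ = V t * (V t)ᴴ * M * V t := by rw [(hVP t ht).2, hM]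
      _ = _ := by simp only [Matrix.mul_assoc]
  refine ⟨V, fun t => (V t)ᴴ * A t * V t, hV,
    fun t ht => ((hV t ht).conjTranspose.mul (hA t ht)).mul (hV t ht),
    fun t ht => (hVP t ht).1, fun t ht => (hVP t ht).2, fun t ht => key t ht _ (hc t ht), ?_⟩
  intro t ht
  have hc' : (A t)ᴴ * P t = P t * (A t)ᴴ := by
    have := congrArg conjTranspose (hc t ht)
    rw [conjTranspose_mul, conjTranspose_mul, hH t ht] at this
    exact this.symm
  have e : ((V t)ᴴ * A t * V t)ᴴ = (V t)ᴴ * (A t)ᴴ * V t := by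
    simp [conjTranspose_mul, Matrix.mul_assoc]
  rw [e, Matrix.mul_assoc ((V t)ᴴ * A t), ← key t ht _ hc', Matrix.mul_assoc ((V t)ᴴ * (A t)ᴴ),
    ← key t ht _ (hc t ht), Matrix.mul_assoc, ← Matrix.mul_assoc (A t), hN t ht]
  simp only [Matrix.mul_assoc]

theorem commute_aeval {B H : Matrix (Fin n) (Fin n) ℂ} (h : Commute B H) (q : Polynomial ℝ) :
    Commute B (Polynomial.aeval H q) := by
  induction q using Polynomial.induction_on' with
  | add p q hp hq => simpa using hp.add_right hq
  | monomial k a =>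
    rw [Polynomial.aeval_monomial]
    exact (show Commute B _ from (Algebra.commutes a B).symm).mul_right (h.pow_right k)

theorem star_aeval {H : Matrix (Fin n) (Fin n) ℂ} (h : Hᴴ = H) (q : Polynomial ℝ) :
    (Polynomial.aeval H q)ᴴ = Polynomial.aeval H q := by
  induction q using Polynomial.induction_on' with
  | add p q hp hq => simp [hp, hq]
  | monomial k a =>
    rw [Polynomial.aeval_monomial, ← Algebra.smul_def, conjTranspose_smul, conjTranspose_pow, h]
    simp

theorem local_proj {A : ℝ → Matrix (Fin n) (Fin n) ℂ} {t₀ : ℝ} (hn : 0 < n) (hA : MAn A t₀)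
    (hN : ∀ᶠ t in 𝓝 t₀, A t * (A t)ᴴ = (A t)ᴴ * A t)
    (hs : ¬ ∀ᶠ t in 𝓝 t₀, A t = ((A t).trace / n) • 1) :
    ∃ P : ℝ → Matrix (Fin n) (Fin n) ℂ, MAn P t₀ ∧ P t₀ ≠ 0 ∧ P t₀ ≠ 1 ∧
      ∀ᶠ t in 𝓝 t₀, P t * P t = P t ∧ (P t)ᴴ = P t ∧ A t * P t = P t * A t := by
  have hn' : (n : ℂ) ≠ 0 := by exact_mod_cast hn.ne'
  let c : ℝ → ℂ := fun t => (A t).trace / n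
  let A0 : ℝ → Matrix (Fin n) (Fin n) ℂ := fun t => A t - c t • 1
  have hA0 : MAn A0 t₀ := hA.sub (MAn.smul (hA.trace.div_const) (MAn.const 1))
  have hA0s : ¬ ∀ᶠ t in 𝓝 t₀, A0 t = 0 := by
    intro h
    exact hs (h.mono fun t ht => sub_eq_zero.1 ht)
  obtain ⟨k, g, hg, hg0, hgA⟩ := (hA0.toPi).exists_eventuallyEq_pow_smul_nonzero_iff.2 hA0s
  let B : ℝ → Matrix (Fin n) (Fin n) ℂ := fun t => Matrix.of (g t)
  have hB : MAn B t₀ := MAn.ofPi hg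
  have hB0 : B t₀ ≠ 0 := hg0
  have hBA : ∀ᶠ t in 𝓝 t₀, A0 t = ((t - t₀) ^ k : ℝ) • B t := hgA
  have hne : ∀ᶠ t in 𝓝[≠] t₀, ((t - t₀) ^ k : ℝ) ≠ 0 := by
    filter_upwards [self_mem_nhdsWithin] with t ht
    exact pow_ne_zero _ (sub_ne_zero.2 ht)
  have hBN : ∀ᶠ t in 𝓝 t₀, B t * (B t)ᴴ = (B t)ᴴ * B t := by
    refine eq_of_punct (hB.mul hB.conjTranspose) (hB.conjTranspose.mul hB) ?_
    filter_upwards [hne, hBA.filter_mono nhdsWithin_le_nhds, hN.filter_mono nhdsWithin_le_nhds]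
      with t h1 h2 h3
    have h4 : A0 t * (A0 t)ᴴ = (A0 t)ᴴ * A0 t := by
      simp only [A0, conjTranspose_sub, conjTranspose_smul, conjTranspose_one, Matrix.sub_mul,
        Matrix.mul_sub, h3, Matrix.smul_mul, Matrix.mul_smul, Matrix.one_mul, Matrix.mul_one,
        smul_sub]
      rw [smul_comm]; abel
    rw [h2] at h4
    simp only [conjTranspose_smul, star_trivial, Matrix.smul_mul, Matrix.mul_smul] at h4
    exact smul_right_injective _ h1 (smul_right_injective _ h1 h4)
  have hBt : (B t₀).trace = 0 := by
    have h1 : ∀ᶠ t in 𝓝[≠] t₀, (B t).trace = 0 := by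
      filter_upwards [hne, hBA.filter_mono nhdsWithin_le_nhds] with t h1 h2
      have h3 : (A0 t).trace = 0 := by
        simp only [A0, c, Matrix.trace_sub, Matrix.trace_smul, Matrix.trace_one, Fintype.card_fin,
          smul_eq_mul]
        field_simp
        ring
      rw [h2, Matrix.trace_smul] at h3
      exact (smul_eq_zero.1 h3).resolve_left h1
    have h2 := (hB.trace.continuousAt.eventuallyEq_nhds_iff_eventuallyEq_nhdsNE
      (continuousAt_const (y := (0 : ℂ)))).1 h1
    exact h2.self_of_nhds
  have hH : ∃ H : ℝ → Matrix (Fin n) (Fin n) ℂ, MAn H t₀ ∧ (∀ t, (H t)ᴴ = H t) ∧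
      (∀ t, B t * (B t)ᴴ = (B t)ᴴ * B t → Commute (B t) (H t)) ∧ ∀ z : ℂ, H t₀ ≠ z • 1 := by
    by_contra! hcon
    obtain ⟨z1, hz1⟩ := hcon (fun t => B t + (B t)ᴴ) (hB.add hB.conjTranspose)
      (fun t => by simp [add_comm])
      (fun t ht => (Commute.refl _).add_right ht)
    obtain ⟨z2, hz2⟩ := hcon (fun t => Complex.I • (B t - (B t)ᴴ))
      (MAn.smul analyticAt_const (hB.sub hB.conjTranspose))
      (fun t => by
        simp only [conjTranspose_smul, conjTranspose_sub, conjTranspose_conjTranspose]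
        rw [show star Complex.I = -Complex.I from Complex.conj_I]
        module)
      (fun t ht => ((Commute.refl _).sub_right ht).smul_right _)
    have h1 : B t₀ = ((1 / 2) * (z1 - Complex.I * z2)) • (1 : Matrix (Fin n) (Fin n) ℂ) := by
      have : B t₀ = (1 / 2 : ℂ) • ((B t₀ + (B t₀)ᴴ) -
          Complex.I • (Complex.I • (B t₀ - (B t₀)ᴴ))) := by
        rw [smul_smul, Complex.I_mul_I]; module
      rw [this]
      rw [hz1, hz2]
      module
    have h2 := hBt
    rw [h1, Matrix.trace_smul, Matrix.trace_one, Fintype.card_fin, smul_eq_mul] at h2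
    rw [(mul_eq_zero.1 h2).resolve_right hn', zero_smul] at h1
    exact hB0 h1
  obtain ⟨H, hHan, hHs, hHc, hHns⟩ := hH
  obtain ⟨q, hq1, hq2, hq3⟩ := exists_poly (hHs t₀) hHns
  obtain ⟨P, hP, hP0, hPe⟩ := lift_idem_mat (hHan.aeval q) hq1
  refine ⟨P, hP, by rwa [hP0], by rwa [hP0], ?_⟩
  filter_upwards [hPe, hBN, hBA] with t h1 h2 h3
  refine ⟨h1.1, h1.2.2 (star_aeval (hHs t) q), ?_⟩
  have h4 : Commute (B t) (P t) := h1.2.1 _ (commute_aeval (hHc t h2) q)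
  have h5 : A t = ((t - t₀) ^ k : ℝ) • B t + c t • 1 := by
    rw [← h3]; simp [A0]
  have h6 : Commute (A t) (P t) := by
    rw [h5]
    exact (h4.smul_left _).add_left ((Commute.one_left _).smul_left _)
  exact h6

theorem local_trace {P : ℝ → Matrix (Fin n) (Fin n) ℂ} {t₀ : ℝ} (hP : MAn P t₀)
    (hPP : ∀ᶠ t in 𝓝 t₀, P t * P t = P t) :
    ∃ k : ℕ, ∀ᶠ t in 𝓝 t₀, (P t).trace = k := by
  obtain ⟨k, hk⟩ := trace_nat hPP.self_of_nhds
  refine ⟨k, ?_⟩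
  have := hP.trace.continuousAt.tendsto.eventually (Metric.ball_mem_nhds _ one_pos)
  filter_upwards [this, hPP] with t h1 h2
  obtain ⟨m, hm⟩ := trace_nat h2
  rw [hk] at h1
  replace h1 : dist (P t).trace k < 1 := h1
  rw [hm, dist_eq_norm] at h1
  rw [hm]
  have h3 : ‖(((m : ℤ) - (k : ℤ) : ℤ) : ℂ)‖ < 1 := by push_cast; exact h1
  rw [Complex.norm_intCast] at h3
  have h4 : |(m : ℤ) - k| < 1 := by exact_mod_cast h3
  have : m = k := by rw [Int.abs_lt_one_iff] at h4; omega
  rw [this]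

theorem local_diag (n : ℕ) : ∀ {A : ℝ → Matrix (Fin n) (Fin n) ℂ} {t₀ : ℝ}, MAn A t₀ →
    (∀ᶠ t in 𝓝 t₀, A t * (A t)ᴴ = (A t)ᴴ * A t) → ∃ ε > 0, Diag (Metric.ball t₀ ε) A := by
  induction n using Nat.strong_induction_on with
  | _ n ih =>
  intro A t₀ hA hN
  by_cases hs : ∀ᶠ t in 𝓝 t₀, A t = ((A t).trace / n) • 1
  · obtain ⟨ε, hε, h⟩ := Metric.eventually_nhds_iff_ball.1 (hs.and hA.eventually)
    refine ⟨ε, hε, fun _ t => (A t).trace / n, fun _ => 1, fun t ht _ =>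
      (h t ht).2.trace.div_const, fun t ht => MAn.const 1, fun t ht => ⟨by simp, ?_⟩⟩
    rw [Matrix.mul_one, Matrix.one_mul, ← Matrix.smul_one_eq_diagonal]
    exact (h t ht).1
  · have hn : 0 < n := by
      rcases Nat.eq_zero_or_pos n with rfl | h
      · exact absurd (Eventually.of_forall fun t => Subsingleton.elim _ _) hs
      · exact h
    obtain ⟨P, hP, hP0, hP1, hPe⟩ := local_proj hn hA hN hs
    obtain ⟨k, hk⟩ := local_trace hP (hPe.mono fun t h => h.1)
    have hQ : MAn (fun t => 1 - P t) t₀ := (MAn.const 1).sub hP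
    have hQe : ∀ᶠ t in 𝓝 t₀, (1 - P t) * (1 - P t) = 1 - P t ∧ (1 - P t)ᴴ = 1 - P t ∧
        A t * (1 - P t) = (1 - P t) * A t := by
      filter_upwards [hPe] with t ⟨h1, h2, h3⟩
      refine ⟨?_, by simp [h2], by simp [Matrix.mul_sub, Matrix.sub_mul, h3]⟩
      simp [Matrix.mul_sub, Matrix.sub_mul, h1]
    obtain ⟨m, hm⟩ := local_trace hQ (hQe.mono fun t h => h.1)
    have hkm : n = k + m := by
      have h1 := hk.self_of_nhds
      have h2 := hm.self_of_nhds
      rw [Matrix.trace_sub, Matrix.trace_one, Fintype.card_fin, h1] at h2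
      have : (n : ℂ) = k + m := by linear_combination h2
      exact_mod_cast this
    have hk0 : k ≠ 0 := by
      rintro rfl
      exact hP0 (eq_zero_of_trace hPe.self_of_nhds.2.1 hPe.self_of_nhds.1
        (by simpa using hk.self_of_nhds))
    have hm0 : m ≠ 0 := by
      rintro rfl
      have := eq_zero_of_trace hQe.self_of_nhds.2.1 hQe.self_of_nhds.1
        (by simpa using hm.self_of_nhds)
      exact hP1 (sub_eq_zero.1 this).symm
    obtain ⟨ε, hε, h⟩ := Metric.eventually_nhds_iff_ball.1
      (hA.eventually.and (hN.and (hP.eventually.and (hPe.and (hk.and (hQ.eventually.and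
        (hQe.and hm)))))))
    obtain ⟨V, A1, hV, hA1, hV1, hV2, hV3, hV4⟩ := compress (s := Metric.ball t₀ ε) (k := k)
      (A := A) (P := P) (fun t ht => (h t ht).1) (fun t ht => (h t ht).2.1)
      (fun t ht => (h t ht).2.2.1) (fun t ht => (h t ht).2.2.2.1.2.1)
      (fun t ht => (h t ht).2.2.2.1.1) (fun t ht => (h t ht).2.2.2.1.2.2)
      (fun t ht => (h t ht).2.2.2.2.1)
    obtain ⟨W, A2, hW, hA2, hW1, hW2, hW3, hW4⟩ := compress (s := Metric.ball t₀ ε) (k := m)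
      (A := A) (P := fun t => 1 - P t) (fun t ht => (h t ht).1) (fun t ht => (h t ht).2.1)
      (fun t ht => (h t ht).2.2.2.2.2.1) (fun t ht => (h t ht).2.2.2.2.2.2.1.2.1)
      (fun t ht => (h t ht).2.2.2.2.2.2.1.1) (fun t ht => (h t ht).2.2.2.2.2.2.1.2.2)
      (fun t ht => (h t ht).2.2.2.2.2.2.2)
    have hb := Metric.ball_mem_nhds t₀ hε
    obtain ⟨ε1, hε1, hD1⟩ := ih k (by omega) (hA1 t₀ (Metric.mem_ball_self hε))
      (Filter.mem_of_superset hb hV4)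
    obtain ⟨ε2, hε2, hD2⟩ := ih m (by omega) (hA2 t₀ (Metric.mem_ball_self hε))
      (Filter.mem_of_superset hb hW4)
    refine ⟨min ε (min ε1 ε2), by positivity, ?_⟩
    have s0 : Metric.ball t₀ (min ε (min ε1 ε2)) ⊆ Metric.ball t₀ ε :=
      Metric.ball_subset_ball (min_le_left _ _)
    have s1 : Metric.ball t₀ (min ε (min ε1 ε2)) ⊆ Metric.ball t₀ ε1 :=
      Metric.ball_subset_ball ((min_le_right _ _).trans (min_le_left _ _))
    have s2 : Metric.ball t₀ (min ε (min ε1 ε2)) ⊆ Metric.ball t₀ ε2 :=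
      Metric.ball_subset_ball ((min_le_right _ _).trans (min_le_right _ _))
    exact diag_combine hkm (fun t ht => hV t (s0 ht)) (fun t ht => hW t (s0 ht))
      (fun t ht => hV1 t (s0 ht)) (fun t ht => hW1 t (s0 ht))
      (fun t ht => by rw [hV2 t (s0 ht), hW2 t (s0 ht)]; simp)
      (fun t ht => hV3 t (s0 ht)) (fun t ht => hW3 t (s0 ht)) (hD1.mono s1) (hD2.mono s2)

end Local
open Matrix Filter Topology

/-- Admissible germ at `t`. -/
def Adm {E : Type*} [NormedAddCommGroup E] [NormedSpace ℝ E] (Q : ℝ → E → Prop) (f : ℝ → E)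
    (t : ℝ) : Prop :=
  AnalyticAt ℝ f t ∧ ∀ᶠ s in 𝓝[≠] t, Q s (f s)

section Cont
variable {E : Type*} [NormedAddCommGroup E] [NormedSpace ℝ E] {Q : ℝ → E → Prop}

theorem Adm.congr {f g : ℝ → E} {t : ℝ} (hf : Adm Q f t) (h : f =ᶠ[𝓝 t] g) : Adm Q g t := by
  refine ⟨hf.1.congr h, ?_⟩
  filter_upwards [hf.2, h.filter_mono nhdsWithin_le_nhds] with s h1 h2
  rwa [← h2]

theorem continuation
    (H : ∀ t₀ : ℝ, ∃ ε > 0, ∀ t₁ ∈ Metric.ball t₀ ε, ∀ f, Adm Q f t₁ →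
      ∃ g, (∀ t ∈ Metric.ball t₀ ε, Adm Q g t) ∧ g =ᶠ[𝓝 t₁] f)
    {f₀ : ℝ → E} (h₀ : Adm Q f₀ 0) : ∃ F, ∀ t, Adm Q F t := by
  let S : ℝ → Prop := fun b => ∃ f, (∀ t ∈ Set.Icc (-b) b, Adm Q f t) ∧ f =ᶠ[𝓝 0] f₀
  have hS0 : S 0 := ⟨f₀, fun t ht => by
    have : t = 0 := by simpa using ht
    rwa [this], EventuallyEq.rfl⟩
  have hmono : ∀ b b', b ≤ b' → S b' → S b := by
    rintro b b' hb ⟨f, h1, h2⟩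
    exact ⟨f, fun t ht => h1 t ⟨by linarith [ht.1], by linarith [ht.2]⟩, h2⟩
  have hall : ∀ b, S b := by
    by_contra! hcon
    obtain ⟨b₁, hb₁⟩ := hcon
    let T : Set ℝ := {b | 0 ≤ b ∧ S b}
    have hT0 : (0 : ℝ) ∈ T := ⟨le_rfl, hS0⟩
    have hTb : BddAbove T := ⟨b₁, fun b hb => by
      by_contra! h
      exact hb₁ (hmono _ _ h.le hb.2)⟩
    set B := sSup T with hB
    have hB0 : 0 ≤ B := le_csSup hTb hT0
    obtain ⟨ε1, hε1, H1⟩ := H B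
    obtain ⟨ε2, hε2, H2⟩ := H (-B)
    let ε := min ε1 ε2
    have hε : 0 < ε := lt_min hε1 hε2
    have hεa : ε ≤ ε1 := min_le_left _ _
    have hεb : ε ≤ ε2 := min_le_right _ _
    obtain ⟨b, hbT, hb⟩ := exists_lt_of_lt_csSup ⟨0, hT0⟩ (show B - ε < sSup T by linarith)
    have hbB : b ≤ B := le_csSup hTb hbT
    obtain ⟨hb0, f, hf, hf0⟩ := hbT
    obtain ⟨g1, hg1, hg1f⟩ := H1 b (by rw [Metric.mem_ball, Real.dist_eq, abs_lt]; constructor <;> linarith)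
      f (hf b ⟨by linarith, le_rfl⟩)
    obtain ⟨g2, hg2, hg2f⟩ := H2 (-b) (by rw [Metric.mem_ball, Real.dist_eq, abs_lt]; constructor <;> linarith)
      f (hf (-b) ⟨le_rfl, by linarith⟩)
    let h : ℝ → E := fun t => if b < t then g1 t else if t < -b then g2 t else f t
    have hhf : ∀ t ∈ Set.Icc (-b) b, f =ᶠ[𝓝 t] h := by
      intro t ht
      have e1 : ∀ᶠ s in 𝓝 t, b < s → g1 s = f s := by
        rcases ht.2.lt_or_eq with h | h
        · filter_upwards [eventually_lt_nhds h] with s hs hs'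
          exact absurd hs' (not_lt.2 hs.le)
        · rw [h]
          filter_upwards [hg1f] with s hs _ using hs
      have e2 : ∀ᶠ s in 𝓝 t, s < -b → g2 s = f s := by
        rcases ht.1.lt_or_eq with h | h
        · filter_upwards [eventually_gt_nhds h] with s hs hs'
          exact absurd hs' (not_lt.2 hs.le)
        · rw [← h]
          filter_upwards [hg2f] with s hs _ using hs
      filter_upwards [e1, e2] with s h1 h2
      simp only [h]
      split_ifs with c1 c2
      · exact (h1 c1).symm
      · exact (h2 c2).symm
      · rfl
    have hSn : S (B + ε / 2) := by
      refine ⟨h, fun t ht => ?_, ((hhf 0 ⟨by linarith, hb0⟩).symm).trans hf0⟩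
      by_cases c1 : b < t
      · refine (hg1 t ?_).congr ?_
        · rw [Metric.mem_ball, Real.dist_eq, abs_lt]; constructor <;> linarith [ht.2]
        · filter_upwards [eventually_gt_nhds c1] with s hs
          simp [h, hs]
      by_cases c2 : t < -b
      · refine (hg2 t ?_).congr ?_
        · rw [Metric.mem_ball, Real.dist_eq, abs_lt]; constructor <;> linarith [ht.1]
        · filter_upwards [eventually_lt_nhds c2] with s hs
          have : ¬ b < s := by linarith
          simp [h, hs, this]
      · exact (hf t ⟨not_lt.1 c2, not_lt.1 c1⟩).congr (hhf t ⟨not_lt.1 c2, not_lt.1 c1⟩)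
    have : B + ε / 2 ≤ B := le_csSup hTb ⟨by linarith, hSn⟩
    linarith
  choose f hf hf0 using fun N : ℕ => hall N
  have hagree : ∀ M N : ℕ, N ≤ M → Set.EqOn (f N) (f M) (Set.Icc (-(N : ℝ)) N) := by
    intro M N hNM
    have hc : (N : ℝ) ≤ M := by exact_mod_cast hNM
    refine AnalyticOnNhd.eqOn_of_preconnected_of_eventuallyEq (𝕜 := ℝ) (z₀ := 0)
      (fun t ht => (hf N t ht).1)
      (fun t ht => (hf M t ⟨by linarith [ht.1], by linarith [ht.2]⟩).1) isPreconnected_Icc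
      ⟨by simp, by simp⟩ ((hf0 N).trans (hf0 M).symm)
  refine ⟨fun t => f ⌈|t|⌉₊ t, fun t => ?_⟩
  have hle : |t| ≤ ((⌈|t|⌉₊ + 1 : ℕ) : ℝ) := by
    push_cast; linarith [Nat.le_ceil |t|]
  refine (hf (⌈|t|⌉₊ + 1) t (abs_le.1 hle)).congr ?_
  have : ∀ᶠ s in 𝓝 t, |s| < |t| + 1 :=
    continuous_abs.continuousAt.eventually_lt_const (by linarith)
  filter_upwards [this] with s hs
  refine (hagree _ _ ?_ (abs_le.1 (Nat.le_ceil |s|))).symm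
  rw [Nat.ceil_le]
  push_cast
  linarith [Nat.le_ceil |t|]

end Cont

section Global
variable {n : ℕ}

/-- `p` is the full spectral projection of `A s` for the eigenvalue. -/
def Spec (A : ℝ → Matrix (Fin n) (Fin n) ℂ) (s : ℝ) (x : ℂ × (Fin n → Fin n → ℂ)) : Prop :=
  A s * Matrix.of x.2 = x.1 • Matrix.of x.2 ∧ (Matrix.of x.2)ᴴ = Matrix.of x.2 ∧
  Matrix.of x.2 * Matrix.of x.2 = Matrix.of x.2 ∧ 1 ≤ (Matrix.of x.2).trace.re ∧
  ∀ M : Matrix (Fin n) (Fin n) ℂ, A s * M = x.1 • M → Matrix.of x.2 * M = M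

theorem Spec.unique {A : ℝ → Matrix (Fin n) (Fin n) ℂ} {s : ℝ} {x y : ℂ × (Fin n → Fin n → ℂ)}
    (hx : Spec A s x) (hy : Spec A s y) (h : x.1 = y.1) : Matrix.of x.2 = Matrix.of y.2 := by
  have h1 := hx.2.2.2.2 (Matrix.of y.2) (by rw [h]; exact hy.1)
  have h2 := hy.2.2.2.2 (Matrix.of x.2) (by rw [← h]; exact hx.1)
  have h3 := congrArg conjTranspose h1
  rw [conjTranspose_mul, hx.2.1, hy.2.1, h2] at h3
  exact h3

theorem eig_coord {A U : Matrix (Fin n) (Fin n) ℂ} {l : Fin n → ℂ} (hU : Uᴴ * U = 1)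
    (hA : A * U = U * diagonal l) {M : Matrix (Fin n) (Fin n) ℂ} {z : ℂ} (hM : A * M = z • M)
    (i j : Fin n) : l i * (Uᴴ * M) i j = z * (Uᴴ * M) i j := by
  have hU' : U * Uᴴ = 1 := mul_eq_one_comm.1 hU
  have h1 : diagonal l * (Uᴴ * M) = z • (Uᴴ * M) := by
    calc diagonal l * (Uᴴ * M) = (Uᴴ * U) * diagonal l * (Uᴴ * M) := by rw [hU, Matrix.one_mul]
      _ = Uᴴ * (U * diagonal l) * (Uᴴ * M) := by simp only [Matrix.mul_assoc]
      _ = Uᴴ * A * (U * Uᴴ) * M := by rw [← hA]; simp only [Matrix.mul_assoc]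
      _ = Uᴴ * (A * M) := by rw [hU', Matrix.mul_one, Matrix.mul_assoc]
      _ = _ := by rw [hM, Matrix.mul_smul]
  have := congrFun (congrFun h1 i) j
  rwa [diagonal_mul, Matrix.smul_apply, smul_eq_mul] at this

theorem germ_of_index {A : ℝ → Matrix (Fin n) (Fin n) ℂ} {I : Set ℝ} (hI : IsOpen I)
    (hIc : IsPreconnected I) {l : Fin n → ℝ → ℂ} {U : ℝ → Matrix (Fin n) (Fin n) ℂ}
    (hl : ∀ t ∈ I, ∀ j, AnalyticAt ℝ (l j) t) (hU : ∀ t ∈ I, MAn U t)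
    (hA : ∀ t ∈ I, (U t)ᴴ * U t = 1 ∧ A t * U t = U t * diagonal (fun j => l j t)) (j : Fin n) :
    ∃ g : ℝ → ℂ × (Fin n → Fin n → ℂ), (∀ t ∈ I, Adm (Spec A) g t) ∧ ∀ t, (g t).1 = l j t := by
  classical
  let d : Fin n → ℂ := fun i => if Set.EqOn (l i) (l j) I then 1 else 0
  let P : ℝ → Matrix (Fin n) (Fin n) ℂ := fun t => U t * diagonal d * (U t)ᴴ
  have hP : ∀ t ∈ I, MAn P t := fun t ht =>
    ((hU t ht).mul (MAn.const _)).mul (hU t ht).conjTranspose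
  refine ⟨fun t => (l j t, P t), fun t ht => ⟨(hl t ht j).prod (hP t ht).toPi, ?_⟩, fun t => rfl⟩
  have hev : ∀ᶠ s in 𝓝[≠] t, ∀ i, ¬ Set.EqOn (l i) (l j) I → l i s ≠ l j s := by
    rw [eventually_all]
    intro i
    by_cases hi : Set.EqOn (l i) (l j) I
    · exact Eventually.of_forall fun s h => absurd hi h
    · have : ¬ ∃ᶠ s in 𝓝[≠] t, l i s = l j s := by
        intro hfr
        have h1 := ((hl t ht i).frequently_eq_iff_eventually_eq (hl t ht j)).1 hfr
        exact hi (AnalyticOnNhd.eqOn_of_preconnected_of_eventuallyEq (𝕜 := ℝ)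
          (fun t ht => hl t ht i) (fun t ht => hl t ht j) hIc ht h1)
      rw [not_frequently] at this
      exact this.mono fun s hs _ => hs
  filter_upwards [hev, mem_nhdsWithin_of_mem_nhds (hI.mem_nhds ht)] with s h1 hs
  obtain ⟨hUs, hAs⟩ := hA s hs
  have hdd : diagonal d * diagonal d = diagonal d := by
    rw [diagonal_mul_diagonal]; congr 1; ext i; simp [d]
  have hld : diagonal (fun i => l i s) * diagonal d = l j s • diagonal d := by
    rw [diagonal_mul_diagonal, ← diagonal_smul]
    congr 1; ext i
    by_cases hi : Set.EqOn (l i) (l j) I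
    · simp [d, hi, hi hs]
    · simp [d, hi]
  have hds : (diagonal d)ᴴ = diagonal d := by
    rw [diagonal_conjTranspose]; congr 1; ext i
    by_cases hi : Set.EqOn (l i) (l j) I <;> simp [d, hi]
  change A s * P s = l j s • P s ∧ (P s)ᴴ = P s ∧ P s * P s = P s ∧ 1 ≤ (P s).trace.re ∧
    ∀ M : Matrix (Fin n) (Fin n) ℂ, A s * M = l j s • M → P s * M = M
  refine ⟨?_, ?_, ?_, ?_, ?_⟩
  · calc A s * P s = A s * U s * diagonal d * (U s)ᴴ := by simp only [P, Matrix.mul_assoc]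
      _ = U s * (diagonal (fun i => l i s) * diagonal d) * (U s)ᴴ := by
        rw [hAs]; simp only [Matrix.mul_assoc]
      _ = _ := by rw [hld]; simp [P]
  · simp only [P, conjTranspose_mul, conjTranspose_conjTranspose, hds, Matrix.mul_assoc]
  · calc P s * P s = U s * diagonal d * ((U s)ᴴ * U s) * diagonal d * (U s)ᴴ := by
          simp only [P, Matrix.mul_assoc]
      _ = U s * (diagonal d * diagonal d) * (U s)ᴴ := by
        rw [hUs, Matrix.mul_one]; simp only [Matrix.mul_assoc]
      _ = _ := by rw [hdd]
  · have : (P s).trace = ∑ i, d i := by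
      simp only [P]
      rw [Matrix.trace_mul_comm, ← Matrix.mul_assoc, hUs, Matrix.one_mul, Matrix.trace_diagonal]
    rw [this, Complex.re_sum]
    have hj : (d j).re = 1 := by simp [d, Set.eqOn_refl]
    rw [← hj]
    refine Finset.single_le_sum (f := fun i => (d i).re) (fun i _ => ?_) (Finset.mem_univ j)
    by_cases hi : Set.EqOn (l i) (l j) I <;> simp [d, hi]
  · intro M hM
    have hN := eig_coord hUs hAs hM
    have hdN : diagonal d * ((U s)ᴴ * M) = (U s)ᴴ * M := by
      ext i k
      rw [diagonal_mul]
      by_cases hi : Set.EqOn (l i) (l j) I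
      · simp [d, hi]
      · have : ((U s)ᴴ * M) i k = 0 := by
          by_contra hne
          exact h1 i hi (mul_right_cancel₀ hne (hN i k))
        rw [this, mul_zero]
    calc P s * M = U s * (diagonal d * ((U s)ᴴ * M)) := by simp only [P, Matrix.mul_assoc]
      _ = U s * (U s)ᴴ * M := by rw [hdN, Matrix.mul_assoc]
      _ = M := by rw [mul_eq_one_comm.1 hUs, Matrix.one_mul]

theorem global_germ {A : ℝ → Matrix (Fin n) (Fin n) ℂ} (hn : 0 < n) (hA : ∀ t, MAn A t)
    (hN : ∀ t, A t * (A t)ᴴ = (A t)ᴴ * A t) :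
    ∃ F : ℝ → ℂ × (Fin n → Fin n → ℂ), ∀ t, Adm (Spec A) F t := by
  have hloc : ∀ t₀, ∃ ε > 0, Diag (Metric.ball t₀ ε) A := fun t₀ =>
    local_diag n (hA t₀) (Eventually.of_forall hN)
  have hcon : ∀ (t₀ ε : ℝ), IsPreconnected (Metric.ball t₀ ε) := fun t₀ ε =>
    (convex_ball t₀ ε).isPreconnected
  obtain ⟨ε, hε, l, U, hl, hU, hD⟩ := hloc 0
  obtain ⟨g, hg, -⟩ := germ_of_index Metric.isOpen_ball (hcon _ _) hl hU hD ⟨0, hn⟩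
  refine continuation ?_ (hg 0 (Metric.mem_ball_self hε))
  clear hg g hD hU hl U l hε ε
  intro t₀
  obtain ⟨ε, hε, l, U, hl, hU, hD⟩ := hloc t₀
  refine ⟨ε, hε, fun t₁ ht₁ f hf => ?_⟩
  have hf1 : AnalyticAt ℝ (fun s => (f s).1) t₁ := analyticAt_fst.comp hf.1
  have hf2 : MAn (fun s => Matrix.of (f s).2) t₁ := MAn.ofPi (analyticAt_snd.comp hf.1)
  have hex : ∀ᶠ s in 𝓝[≠] t₁, ∃ i, (f s).1 = l i s := by
    filter_upwards [hf.2, mem_nhdsWithin_of_mem_nhds (Metric.isOpen_ball.mem_nhds ht₁)]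
      with s hs hsI
    obtain ⟨hUs, hAs⟩ := hD s hsI
    have hco := eig_coord hUs hAs hs.1
    by_contra! hne
    have h0 : (U s)ᴴ * Matrix.of (f s).2 = 0 := by
      ext i k
      by_contra h
      exact hne i (mul_right_cancel₀ h (hco i k)).symm
    have h1 : Matrix.of (f s).2 = 0 := by
      have := congrArg (U s * ·) h0
      simpa only [← Matrix.mul_assoc, mul_eq_one_comm.1 hUs, Matrix.one_mul, Matrix.mul_zero]
        using this
    have h2 := hs.2.2.2.1
    rw [h1] at h2
    norm_num at h2
  obtain ⟨j, hj⟩ : ∃ j, ∃ᶠ s in 𝓝[≠] t₁, (f s).1 = l j s := by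
    by_contra! h
    obtain ⟨s, ⟨i, hi⟩, hs⟩ := (hex.and (eventually_all.2 h)).exists
    exact hs i hi
  have hj' := (hf1.frequently_eq_iff_eventually_eq (hl t₁ ht₁ j)).1 hj
  obtain ⟨g, hg, hgl⟩ := germ_of_index Metric.isOpen_ball (hcon _ _) hl hU hD j
  refine ⟨g, hg, ?_⟩
  have hg1 := hg t₁ ht₁
  have hg2 : MAn (fun s => Matrix.of (g s).2) t₁ := MAn.ofPi (analyticAt_snd.comp hg1.1)
  have heq : ∀ᶠ s in 𝓝 t₁, Matrix.of (g s).2 = Matrix.of (f s).2 := by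
    refine eq_of_punct hg2 hf2 ?_
    filter_upwards [hg1.2, hf.2, hj'.filter_mono nhdsWithin_le_nhds] with s h1 h2 h3
    exact h1.unique h2 (by rw [hgl, h3])
  filter_upwards [heq, hj'] with s h1 h2
  exact Prod.ext (by rw [hgl, h2]) (Matrix.of.injective h1)

theorem global_diag (n : ℕ) : ∀ {A : ℝ → Matrix (Fin n) (Fin n) ℂ}, (∀ t, MAn A t) →
    (∀ t, A t * (A t)ᴴ = (A t)ᴴ * A t) → Diag Set.univ A := by
  induction n using Nat.strong_induction_on with
  | _ n ih =>
  intro A hA hN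
  rcases Nat.eq_zero_or_pos n with rfl | hn
  · exact ⟨fun _ _ => 0, fun _ => 1, fun t _ j => j.elim0, fun t _ => MAn.const 1,
      fun t _ => ⟨Subsingleton.elim _ _, Subsingleton.elim _ _⟩⟩
  obtain ⟨F, hF⟩ := global_germ hn hA hN
  let z : ℝ → ℂ := fun t => (F t).1
  let P : ℝ → Matrix (Fin n) (Fin n) ℂ := fun t => Matrix.of (F t).2
  have hz : ∀ t, AnalyticAt ℝ z t := fun t => analyticAt_fst.comp (hF t).1
  have hP : ∀ t, MAn P t := fun t => MAn.ofPi (analyticAt_snd.comp (hF t).1)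
  have hAP : ∀ t, A t * P t = z t • P t := fun t =>
    (eq_of_punct ((hA t).mul (hP t)) ((hP t).smul (hz t))
      ((hF t).2.mono fun s hs => hs.1)).self_of_nhds
  have hPH : ∀ t, (P t)ᴴ = P t := fun t =>
    (eq_of_punct (hP t).conjTranspose (hP t) ((hF t).2.mono fun s hs => hs.2.1)).self_of_nhds
  have hPP : ∀ t, P t * P t = P t := fun t =>
    (eq_of_punct ((hP t).mul (hP t)) (hP t) ((hF t).2.mono fun s hs => hs.2.2.1)).self_of_nhds
  have htr1 : ∀ t, 1 ≤ (P t).trace.re := fun t => by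
    have h1 : ContinuousAt (fun s => (P s).trace.re) t :=
      Complex.continuous_re.continuousAt.comp (hP t).trace.continuousAt
    exact ge_of_tendsto (h1.tendsto.mono_left nhdsWithin_le_nhds)
      ((hF t).2.mono fun s hs => hs.2.2.2.1)
  have hPA : ∀ t, P t * A t = z t • P t := fun t => by
    have := congrArg conjTranspose (normal_ker (hN t) (hAP t))
    simpa [conjTranspose_mul, hPH t] using this
  have hc : ∀ t, A t * P t = P t * A t := fun t => by rw [hAP, hPA]
  have hlc : IsLocallyConstant fun t => (P t).trace := by
    rw [IsLocallyConstant.iff_eventually_eq]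
    intro t
    obtain ⟨k, hk⟩ := local_trace (hP t) (Eventually.of_forall hPP)
    filter_upwards [hk] with s hs
    rw [hs, hk.self_of_nhds]
  obtain ⟨k, hk0⟩ := trace_nat (hPP 0)
  have hk : ∀ t, (P t).trace = k := fun t => by
    rw [← hk0]; exact hlc.apply_eq_of_preconnectedSpace t 0
  have hQQ : ∀ t, (1 - P t) * (1 - P t) = 1 - P t := fun t => by
    simp [Matrix.mul_sub, Matrix.sub_mul, hPP]
  obtain ⟨m, hm0⟩ := trace_nat (hQQ 0)
  have hkm : n = k + m := by
    rw [Matrix.trace_sub, Matrix.trace_one, Fintype.card_fin, hk0] at hm0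
    have : (n : ℂ) = k + m := by linear_combination hm0
    exact_mod_cast this
  have hm : ∀ t, (1 - P t).trace = m := fun t => by
    rw [Matrix.trace_sub, Matrix.trace_one, Fintype.card_fin, hk, hkm]
    push_cast; ring
  have hkpos : 0 < k := by
    rcases Nat.eq_zero_or_pos k with rfl | h
    · have := htr1 0
      rw [hk] at this
      norm_num at this
    · exact h
  obtain ⟨V, A1, hV, hA1, hV1, hV2, hV3, hV4⟩ := compress (s := Set.univ) (k := k)
    (A := A) (P := P) (fun t _ => hA t) (fun t _ => hN t) (fun t _ => hP t) (fun t _ => hPH t)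
    (fun t _ => hPP t) (fun t _ => hc t) (fun t _ => hk t)
  obtain ⟨W, A2, hW, hA2, hW1, hW2, hW3, hW4⟩ := compress (s := Set.univ) (k := m)
    (A := A) (P := fun t => 1 - P t) (fun t _ => hA t) (fun t _ => hN t)
    (fun t _ => (MAn.const 1).sub (hP t)) (fun t _ => by simp [hPH t])
    (fun t _ => hQQ t) (fun t _ => by simp [Matrix.mul_sub, Matrix.sub_mul, hc])
    (fun t _ => hm t)
  have hA1z : ∀ t, A1 t = z t • 1 := fun t => by
    have hPV : P t * V t = V t := by
      rw [← hV2 t trivial, Matrix.mul_assoc, hV1 t trivial, Matrix.mul_one]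
    have hAV : A t * V t = z t • V t := by
      rw [← hPV, ← Matrix.mul_assoc, hAP, Matrix.smul_mul]
    have : (V t)ᴴ * (V t * A1 t) = (V t)ᴴ * (z t • V t) := by rw [← hV3 t trivial, hAV]
    rwa [← Matrix.mul_assoc, hV1 t trivial, Matrix.one_mul, Matrix.mul_smul, hV1 t trivial] at this
  have hD1 : Diag Set.univ A1 := by
    refine ⟨fun _ => z, fun _ => 1, fun t _ _ => hz t, fun t _ => MAn.const 1,
      fun t _ => ⟨by simp, ?_⟩⟩
    rw [Matrix.mul_one, Matrix.one_mul, ← Matrix.smul_one_eq_diagonal, hA1z]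
  have hD2 : Diag Set.univ A2 := ih m (by omega) (fun t => hA2 t trivial) (fun t => hW4 t trivial)
  exact diag_combine hkm hV hW hV1 hW1
    (fun t ht => by rw [hV2 t ht, hW2 t ht]; simp) hV3 hW3 hD1 hD2

end Global

theorem analytic_eigenvectors_of_analytic_normal_curve (n : ℕ)
    (A : ℝ → Matrix (Fin n) (Fin n) ℂ)
    (hA : ∀ i j : Fin n, ∀ t : ℝ, AnalyticAt ℝ (fun s => A s i j) t)
    (hnormal : ∀ t : ℝ, A t * (A t)ᴴ = (A t)ᴴ * A t) :
    ∃ (l : Fin n → ℝ → ℂ) (v : Fin n → ℝ → (Fin n → ℂ)),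
      (∀ j, ∀ t : ℝ, AnalyticAt ℝ (l j) t) ∧
      (∀ j k : Fin n, ∀ t : ℝ, AnalyticAt ℝ (fun s => v j s k) t) ∧
      (∀ t : ℝ, ∀ i j : Fin n,
        ∑ k : Fin n, (starRingEnd ℂ) (v i t k) * v j t k = if i = j then 1 else 0) ∧
      (∀ t : ℝ, ∀ j : Fin n, (A t) *ᵥ (v j t) = l j t • v j t) := by
  obtain ⟨l, U, hl, hU, hD⟩ := global_diag n (fun t i j => hA i j t) hnormal
  refine ⟨l, fun j t k => U t k j, fun j t => hl t trivial j, fun j k t => hU t trivial k j,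
    fun t i j => ?_, fun t j => ?_⟩
  · have := congrFun (congrFun (hD t trivial).1 i) j
    rw [Matrix.mul_apply, Matrix.one_apply] at this
    exact this
  · ext i
    have := congrFun (congrFun (hD t trivial).2 i) j
    rw [Matrix.mul_diagonal, mul_comm] at this
    exact this
end

section
/- C¹ eigenvalues of C¹ curves of normal matrices: let A : ℝ → M_n(ℂ) be a map whose entries are C¹ functions and such that A(t) is normal for every t ∈ ℝ. Then there exist C¹ functions λ_1, …, λ_n : ℝ → ℂ such that for every t ∈ ℝ the multiset {λ_1(t), …, λ_n(t)} equals the multiset of roots, counted with multiplicity, of the characteristic polynomial of A(t). -/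
open Matrix
open Filter Topology

theorem normal_diag {n : ℕ} (A : Matrix (Fin n) (Fin n) ℂ) (h : A * Aᴴ = Aᴴ * A) :
    ∃ (V : Matrix (Fin n) (Fin n) ℂ) (l : Fin n → ℂ), Vᴴ * V = 1 ∧ A * V = V * diagonal l := by
  classical
  set X := A + Aᴴ with hX
  set Y := Complex.I • (A - Aᴴ) with hY
  have hXs : (toEuclideanLin X).IsSymmetric := by
    rw [isSymmetric_toEuclideanLin_iff, IsHermitian, hX]
    simp [add_comm]
  have hYs : (toEuclideanLin Y).IsSymmetric := by
    rw [isSymmetric_toEuclideanLin_iff, IsHermitian, hY]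
    simp [conjTranspose_smul]
    rw [← smul_neg, neg_sub]
  have hc : Commute (toEuclideanLin X) (toEuclideanLin Y) := by
    have : X * Y = Y * X := by
      rw [hX, hY]
      simp only [mul_smul_comm, smul_mul_assoc]
      congr 1
      simp only [mul_sub, add_mul, sub_mul, mul_add, h]
      abel
    show toEuclideanLin X * toEuclideanLin Y = toEuclideanLin Y * toEuclideanLin X
    have h1 := toLpLin_mul_same 2 X Y
    have h2 := toLpLin_mul_same 2 Y X
    rw [this] at h1
    exact h1.symm.trans h2
  have hint := LinearMap.IsSymmetric.directSum_isInternal_of_commute hXs hYs hc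
  have hort := LinearMap.IsSymmetric.orthogonalFamily_eigenspace_inf_eigenspace hXs hYs
  have hint' := DirectSum.isInternal_ne_bot_iff.mpr hint
  have hfin := WellFoundedGT.finite_ne_bot_of_iSupIndep hint.submodule_iSupIndep
  have hF := hfin.to_subtype
  have : Fintype {i // (Module.End.eigenspace (toEuclideanLin X) (i : ℂ × ℂ).2 ⊓
      Module.End.eigenspace (toEuclideanLin Y) i.1) ≠ ⊥} := @Fintype.ofFinite _ hF
  have hort' := hort.comp (γ := {i // (Module.End.eigenspace (toEuclideanLin X) (i : ℂ × ℂ).2 ⊓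
      Module.End.eigenspace (toEuclideanLin Y) i.1) ≠ ⊥}) Subtype.val_injective
  have hn : Module.finrank ℂ (EuclideanSpace ℂ (Fin n)) = n := by simp
  let b := hint'.subordinateOrthonormalBasis hn hort'
  have hb := fun a => hint'.subordinateOrthonormalBasis_subordinate hn a hort'
  let idx := fun a => (hint'.subordinateOrthonormalBasisIndex hn a hort').1
  refine ⟨of fun i j => b j i, fun j => ((idx j).2 - Complex.I * (idx j).1) / 2, ?_, ?_⟩
  · ext i j
    have := b.inner_eq_ite i j
    rw [PiLp.inner_apply] at this
    rw [mul_apply, one_apply, ← this]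
    simp [mul_comm]
  · ext i j
    have h1 := (hb j).1
    have h2 := (hb j).2
    have h1' : toEuclideanLin X (b j) = (idx j).2 • b j := Module.End.mem_eigenspace_iff.1 h1
    have h2' : toEuclideanLin Y (b j) = (idx j).1 • b j := Module.End.mem_eigenspace_iff.1 h2
    have e1 := congrArg (fun v => v.ofLp i) h1'
    have e2 := congrArg (fun v => v.ofLp i) h2'
    simp only [ofLp_toLpLin, toLin'_apply, mulVec, dotProduct, PiLp.smul_apply, smul_eq_mul] at e1 e2
    rw [mul_diagonal, mul_apply]
    simp only [of_apply]
    have : A = (2⁻¹ : ℂ) • (X - Complex.I • Y) := by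
      rw [hX, hY, smul_smul, Complex.I_mul_I]
      ext a b
      simp
      ring
    have e3 : ∀ k, A i k * b j k = 2⁻¹ * (X i k * b j k) - 2⁻¹ * Complex.I * (Y i k * b j k) := by
      intro k
      rw [this]
      simp only [Matrix.smul_apply, Matrix.sub_apply, smul_eq_mul]
      generalize X i k = p
      generalize Y i k = q
      ring
    simp only [e3, Finset.sum_sub_distrib, ← Finset.mul_sum]
    rw [e1, e2]
    ring

theorem roots_of_diag {n : ℕ} (A V : Matrix (Fin n) (Fin n) ℂ) (l : Fin n → ℂ)
    (hV : Vᴴ * V = 1) (h : A * V = V * diagonal l) :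
    A.charpoly.roots = Finset.univ.val.map l := by
  have hV' := mul_eq_one_comm.1 hV
  have : A = V * diagonal l * Vᴴ := by rw [← h, mul_assoc, hV', mul_one]
  have h2 := charpoly_units_conj (⟨V, Vᴴ, hV', hV⟩ : (Matrix (Fin n) (Fin n) ℂ)ˣ) (diagonal l)
  rw [this]
  have h3 : (V * diagonal l * Vᴴ).charpoly = (diagonal l).charpoly := by
    rw [← h2, ← Matrix.coe_units_inv]
    rfl
  rw [h3, charpoly_diagonal]
  have h4 := Polynomial.roots_multiset_prod_X_sub_C (Finset.univ.val.map l)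
  rw [Multiset.map_map] at h4
  exact h4

def Frame {n : ℕ} (A D V : Matrix (Fin n) (Fin n) ℂ) (x : Fin n → ℂ × ℂ) : Prop :=
  Vᴴ * V = 1 ∧ A * V = V * diagonal (fun i => (x i).1) ∧
    ∀ i j, (x i).1 = (x j).1 → (Vᴴ * D * V) i j = if i = j then (x i).2 else 0

theorem Frame.perm_unique {n : ℕ} {A D V W : Matrix (Fin n) (Fin n) ℂ} {x y : Fin n → ℂ × ℂ}
    (hx : Frame A D V x) (hy : Frame A D W y) : ∃ σ : Equiv.Perm (Fin n), y ∘ σ = x := by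
  obtain ⟨hV, hVA, hVD⟩ := hx
  obtain ⟨hW, hWA, hWD⟩ := hy
  have hV' := mul_eq_one_comm.1 hV
  have hW' := mul_eq_one_comm.1 hW
  set U := Wᴴ * V with hU
  have hUdet : U.det ≠ 0 := by
    intro h0
    have : (Uᴴ * U).det = 1 := by
      have : Uᴴ * U = 1 := by
        rw [hU, conjTranspose_mul, conjTranspose_conjTranspose]
        calc Vᴴ * W * (Wᴴ * V) = Vᴴ * (W * Wᴴ) * V := by simp only [mul_assoc]
          _ = 1 := by rw [hW', mul_one, hV]
      rw [this, det_one]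
    rw [det_mul, h0, mul_zero] at this
    exact zero_ne_one this
  have e1 : diagonal (fun i => (y i).1) * U = U * diagonal (fun i => (x i).1) := by
    calc diagonal (fun i => (y i).1) * U = Wᴴ * W * diagonal (fun i => (y i).1) * Wᴴ * V := by
          rw [hW, one_mul, hU, mul_assoc]
      _ = Wᴴ * (W * diagonal (fun i => (y i).1)) * Wᴴ * V := by simp only [mul_assoc]
      _ = Wᴴ * A * (W * Wᴴ) * V := by rw [← hWA]; simp only [mul_assoc]
      _ = Wᴴ * (A * V) := by rw [hW', mul_one, mul_assoc]
      _ = _ := by rw [hVA, hU, mul_assoc]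
  have e2 : (Wᴴ * D * W) * U = U * (Vᴴ * D * V) := by
    calc (Wᴴ * D * W) * U = Wᴴ * D * (W * Wᴴ) * V := by rw [hU]; simp only [mul_assoc]
      _ = Wᴴ * (V * Vᴴ) * D * V := by rw [hW', hV', mul_one, mul_one]
      _ = _ := by rw [hU]; simp only [mul_assoc]
  have k1 : ∀ j i, U j i ≠ 0 → (y j).1 = (x i).1 := by
    intro j i hne
    have := congrFun (congrFun e1 j) i
    rw [diagonal_mul, mul_diagonal, mul_comm] at this
    exact mul_left_cancel₀ hne this
  have k2 : ∀ j i, U j i ≠ 0 → (y j).2 = (x i).2 := by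
    intro j i hne
    have h1 := k1 j i hne
    have := congrFun (congrFun e2 j) i
    rw [Matrix.mul_apply, Matrix.mul_apply (M := U)] at this
    rw [Finset.sum_eq_single j, Finset.sum_eq_single i, hWD j j rfl, hVD i i rfl, if_pos rfl,
      if_pos rfl, mul_comm] at this
    · exact mul_left_cancel₀ hne this
    · intro k _ hk
      by_cases h0 : U j k = 0
      · rw [h0, zero_mul]
      · rw [hVD k i ((k1 j k h0).symm.trans h1), if_neg hk, mul_zero]
    · simp
    · intro k _ hk
      by_cases h0 : U k i = 0
      · rw [h0, mul_zero]
      · rw [hWD j k (h1.trans (k1 k i h0).symm), if_neg (Ne.symm hk), zero_mul]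
    · simp
  rw [det_apply] at hUdet
  obtain ⟨σ, -, hσ⟩ := Finset.exists_ne_zero_of_sum_ne_zero hUdet
  have hp : ∀ i, U (σ i) i ≠ 0 := by
    have : ∏ i, U (σ i) i ≠ 0 := fun h => hσ (by rw [h, smul_zero])
    intro i
    exact Finset.prod_ne_zero_iff.1 this i (Finset.mem_univ _)
  exact ⟨σ, funext fun i => Prod.ext (k1 _ _ (hp i)) (k2 _ _ (hp i))⟩

theorem Frame.comp_perm {n : ℕ} {A D V : Matrix (Fin n) (Fin n) ℂ} {x : Fin n → ℂ × ℂ}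
    (hx : Frame A D V x) (σ : Equiv.Perm (Fin n)) :
    Frame A D (V.submatrix id σ) (x ∘ σ) := by
  obtain ⟨hV, hVA, hVD⟩ := hx
  refine ⟨?_, ?_, ?_⟩
  · ext i j
    have := congrFun (congrFun hV (σ i)) (σ j)
    simpa [mul_apply, one_apply] using this
  · ext i j
    have := congrFun (congrFun hVA i) (σ j)
    rw [mul_diagonal] at this ⊢
    simpa [mul_apply] using this
  · intro i j h
    have := hVD (σ i) (σ j) h
    simpa [mul_apply] using this

theorem unitary_ultra_limit {n : ℕ} {ι : Type} (𝒰 : Ultrafilter ι)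
    (V : ι → Matrix (Fin n) (Fin n) ℂ) (hV : ∀ k, (V k)ᴴ * V k = 1) :
    ∃ W : Matrix (Fin n) (Fin n) ℂ, Wᴴ * W = 1 ∧ Tendsto V 𝒰 (𝓝 W) := by
  have hK : IsCompact (Set.pi Set.univ fun _ : Fin n => Set.pi Set.univ fun _ : Fin n =>
      Metric.closedBall (0 : ℂ) 1) :=
    isCompact_univ_pi fun _ => isCompact_univ_pi fun _ => isCompact_closedBall _ _
  have hmem : ∀ k, (V k : Fin n → Fin n → ℂ) ∈ (Set.pi Set.univ fun _ : Fin n =>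
      Set.pi Set.univ fun _ : Fin n => Metric.closedBall (0 : ℂ) 1) := by
    intro k i _ j _
    rw [mem_closedBall_zero_iff]
    exact entry_norm_bound_of_unitary (mem_unitaryGroup_iff'.2 (hV k)) i j
  obtain ⟨W0, -, hW⟩ := hK.ultrafilter_le_nhds' (𝒰.map V)
    (Filter.mem_map.2 (Filter.Eventually.of_forall hmem))
  let W : Matrix (Fin n) (Fin n) ℂ := W0
  have hW' : Tendsto V 𝒰 (𝓝 W) := hW
  refine ⟨W, ?_, hW'⟩
  have h1 : Tendsto (fun k => (V k)ᴴ * V k) 𝒰 (𝓝 (Wᴴ * W)) := by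
    have hc : Continuous fun M : Matrix (Fin n) (Fin n) ℂ => Mᴴ * M := by fun_prop
    exact (hc.tendsto _).comp hW'
  simp only [hV] at h1
  exact tendsto_nhds_unique h1 tendsto_const_nhds

theorem entry_tendsto {n : ℕ} {ι : Type} {F : Filter ι} {V : ι → Matrix (Fin n) (Fin n) ℂ}
    {W : Matrix (Fin n) (Fin n) ℂ} (h : Tendsto V F (𝓝 W)) (i j : Fin n) :
    Tendsto (fun k => V k i j) F (𝓝 (W i j)) := by
  have hc : Continuous fun M : Matrix (Fin n) (Fin n) ℂ => M i j := by fun_prop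
  exact (hc.tendsto _).comp h

theorem frame_limit {n : ℕ} {ι : Type} (𝒰 : Ultrafilter ι)
    (A D : ℝ → Matrix (Fin n) (Fin n) ℂ) (hcA : Continuous A) (hcD : Continuous D)
    (hAD : ∀ t i j, HasDerivAt (fun t => A t i j) (D t i j) t)
    (t : ℝ) (s : ι → ℝ) (hs : Tendsto s 𝒰 (𝓝 t)) (hne : ∀ᶠ k in 𝒰, s k ≠ t)
    (V : ι → Matrix (Fin n) (Fin n) ℂ) (l : ι → Fin n → ℂ)
    (hV : ∀ k, (V k)ᴴ * V k = 1) (hl : ∀ k, A (s k) * V k = V k * diagonal (l k)) :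
    ∃ (W : Matrix (Fin n) (Fin n) ℂ) (x : Fin n → ℂ × ℂ), Frame (A t) (D t) W x ∧
      ∀ i, Tendsto (fun k => l k i) 𝒰 (𝓝 (x i).1) ∧
        Tendsto (fun k => ((s k - t : ℝ) : ℂ)⁻¹ * (l k i - (x i).1)) 𝒰 (𝓝 (x i).2) ∧
        Tendsto (fun k => ((V k)ᴴ * D (s k) * V k) i i) 𝒰 (𝓝 (x i).2) := by
  obtain ⟨W, hW, hVW⟩ := unitary_ultra_limit 𝒰 V hV
  have hAs : Tendsto (fun k => A (s k)) 𝒰 (𝓝 (A t)) := (hcA.tendsto t).comp hs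
  have hDs : Tendsto (fun k => D (s k)) 𝒰 (𝓝 (D t)) := (hcD.tendsto t).comp hs
  have hVH : Tendsto (fun k => (V k)ᴴ) 𝒰 (𝓝 Wᴴ) := by
    have hc : Continuous fun M : Matrix (Fin n) (Fin n) ℂ => Mᴴ := by fun_prop
    exact (hc.tendsto _).comp hVW
  have hW' := mul_eq_one_comm.1 hW
  -- eigenvalue limits
  have hdiag : ∀ k, (V k)ᴴ * A (s k) * V k = diagonal (l k) := by
    intro k
    rw [mul_assoc, hl, ← mul_assoc, hV, one_mul]
  have hdlim : Tendsto (fun k => diagonal (l k)) 𝒰 (𝓝 (Wᴴ * A t * W)) := by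
    simp only [← hdiag]
    exact (hVH.mul hAs).mul hVW
  set a : Fin n → ℂ := fun i => (Wᴴ * A t * W) i i with ha
  set M := Wᴴ * D t * W with hM
  have hla : ∀ i, Tendsto (fun k => l k i) 𝒰 (𝓝 (a i)) := by
    intro i
    have := entry_tendsto hdlim i i
    simpa using this
  have hda : Wᴴ * A t * W = diagonal a := by
    ext i j
    by_cases hij : i = j
    · subst hij; simp [ha]
    · have := entry_tendsto hdlim i j
      simp only [diagonal_apply_ne _ hij] at this
      rw [diagonal_apply_ne _ hij]
      exact tendsto_nhds_unique this tendsto_const_nhds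
  have hAW : A t * W = W * diagonal a := by
    rw [← hda, ← mul_assoc, ← mul_assoc, hW', one_mul]
  have hWA : Wᴴ * A t = diagonal a * Wᴴ := by
    rw [← hda, mul_assoc _ W, hW', mul_one]
  -- slopes
  have hsl : Tendsto (fun k => ((s k - t : ℝ) : ℂ)⁻¹ • (A (s k) - A t)) 𝒰 (𝓝 (D t)) := by
    refine tendsto_pi_nhds.2 fun i => tendsto_pi_nhds.2 fun j => ?_
    have h1 := (hAD t i j).tendsto_slope
    have h2 : Tendsto s 𝒰 (𝓝[≠] t) := tendsto_nhdsWithin_iff.2 ⟨hs, hne⟩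
    refine (h1.comp h2).congr fun k => ?_
    simp [slope_def_module, Complex.real_smul]
  have hmain : Tendsto (fun k => Wᴴ * (((s k - t : ℝ) : ℂ)⁻¹ • (A (s k) - A t)) * V k) 𝒰 (𝓝 M) :=
    (tendsto_const_nhds.mul hsl).mul hVW
  have hent : ∀ k i j, (Wᴴ * (((s k - t : ℝ) : ℂ)⁻¹ • (A (s k) - A t)) * V k) i j
      = (Wᴴ * V k) i j * (((s k - t : ℝ) : ℂ)⁻¹ * (l k j - a i)) := by
    intro k i j
    have : Wᴴ * (((s k - t : ℝ) : ℂ)⁻¹ • (A (s k) - A t)) * V k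
        = ((s k - t : ℝ) : ℂ)⁻¹ • ((Wᴴ * V k) * diagonal (l k) - diagonal a * (Wᴴ * V k)) := by
      rw [mul_smul_comm, smul_mul_assoc, mul_sub, sub_mul, hWA, mul_assoc Wᴴ (A (s k)), hl,
        mul_assoc, mul_assoc]
    rw [this, Matrix.smul_apply, Matrix.sub_apply, mul_diagonal, diagonal_mul, smul_eq_mul]
    ring
  have hWV : Tendsto (fun k => Wᴴ * V k) 𝒰 (𝓝 1) := by
    rw [← hW]
    exact tendsto_const_nhds.mul hVW
  have hslope : ∀ j, Tendsto (fun k => ((s k - t : ℝ) : ℂ)⁻¹ * (l k j - a j)) 𝒰 (𝓝 (M j j)) := by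
    intro j
    have h1 := entry_tendsto hmain j j
    have h2 := entry_tendsto hWV j j
    rw [one_apply_eq] at h2
    have h3 := h1.div h2 one_ne_zero
    rw [div_one] at h3
    refine h3.congr' ?_
    filter_upwards [h2.eventually_ne one_ne_zero] with k hk
    simp only [Pi.div_apply]
    rw [hent, mul_div_cancel_left₀ _ hk]
  refine ⟨W, fun i => (a i, M i i), ⟨hW, hAW, ?_⟩, fun i => ⟨hla i, hslope i, ?_⟩⟩
  · intro i j hij
    split_ifs with h
    · subst h; rfl
    · simp only at hij
      have h1 := entry_tendsto hmain i j
      have h2 := entry_tendsto hWV i j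
      rw [one_apply_ne h] at h2
      have h3 := h2.mul (hslope j)
      rw [zero_mul] at h3
      refine tendsto_nhds_unique (h1.congr fun k => ?_) h3
      rw [hent, hij]
  · exact entry_tendsto ((hVH.mul hDs).mul hVW) i i

section Selection

variable {n : ℕ} {E : Type} [MetricSpace E] (S : ℝ → Set (Fin n → E))

theorem sel_near
    (horb : ∀ t, ∀ x ∈ S t, ∀ y ∈ S t, ∃ σ : Equiv.Perm (Fin n), y ∘ σ = x)
    (hlim : ∀ (ι : Type) (𝒰 : Ultrafilter ι) (s : ι → ℝ) (t : ℝ) (x : ι → Fin n → E),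
      Tendsto s 𝒰 (𝓝 t) → (∀ k, x k ∈ S (s k)) → ∃ y ∈ S t, Tendsto x 𝒰 (𝓝 y))
    (t0 : ℝ) (x : Fin n → E) (hx : x ∈ S t0) (ε : ℝ) (hε : 0 < ε) :
    ∃ δ > 0, ∀ t, dist t t0 < δ → ∀ y ∈ S t, ∃ σ : Equiv.Perm (Fin n), dist (y ∘ σ) x < ε := by
  by_contra! hcon
  choose s hs y hy hyS using fun k : ℕ => hcon (1 / ((k : ℝ) + 1)) (by positivity)
  have hst : Tendsto s (hyperfilter ℕ) (𝓝 t0) := by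
    have : Tendsto s atTop (𝓝 t0) := by
      rw [tendsto_iff_dist_tendsto_zero]
      exact squeeze_zero (fun _ => dist_nonneg) (fun k => (hs k).le)
        tendsto_one_div_add_atTop_nhds_zero_nat
    exact this.mono_left (Nat.hyperfilter_le_atTop)
  obtain ⟨z, hz, hyz⟩ := hlim ℕ (hyperfilter ℕ) s t0 y hst hy
  obtain ⟨σ, hσ⟩ := horb t0 x hx z hz
  have h1 : Tendsto (fun k => y k ∘ σ) (hyperfilter ℕ) (𝓝 x) := by
    rw [← hσ]
    have hc : Continuous fun w : Fin n → E => w ∘ σ := by fun_prop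
    exact (hc.tendsto _).comp hyz
  obtain ⟨k, hk⟩ := (h1.eventually (Metric.ball_mem_nhds x hε)).exists
  exact absurd hk (not_lt.2 (hyS k σ))

theorem sel_sep (x : Fin n → E) (ε : ℝ) (hε : 0 < ε) :
    ∃ e > 0, 2 * e < ε ∧ ∀ a b, dist (x a) (x b) < 4 * e → x a = x b := by
  have h1 : ∀ᶠ e : ℝ in 𝓝[>] 0, ∀ a b, dist (x a) (x b) < 4 * e → x a = x b := by
    refine eventually_all.2 fun a => eventually_all.2 fun b => ?_
    by_cases h : x a = x b
    · exact Eventually.of_forall fun _ _ => h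
    · have hd : 0 < dist (x a) (x b) / 4 := by have := dist_pos.2 h; positivity
      filter_upwards [Ioo_mem_nhdsGT hd] with e he hlt
      have := he.2
      linarith
  have h2 : ∀ᶠ e : ℝ in 𝓝[>] 0, e ∈ Set.Ioo 0 (ε / 2) := Ioo_mem_nhdsGT (by positivity)
  obtain ⟨e, he, he2⟩ := (h1.and h2).exists
  exact ⟨e, he2.1, by linarith [he2.2], he⟩

theorem selection
    (hne : ∀ t, (S t).Nonempty)
    (horb : ∀ t, ∀ x ∈ S t, ∀ y ∈ S t, ∃ σ : Equiv.Perm (Fin n), y ∘ σ = x)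
    (hperm : ∀ t, ∀ x ∈ S t, ∀ σ : Equiv.Perm (Fin n), x ∘ σ ∈ S t)
    (hlim : ∀ (ι : Type) (𝒰 : Ultrafilter ι) (s : ι → ℝ) (t : ℝ) (x : ι → Fin n → E),
      Tendsto s 𝒰 (𝓝 t) → (∀ k, x k ∈ S (s k)) → ∃ y ∈ S t, Tendsto x 𝒰 (𝓝 y)) :
    ∃ X : ℝ → Fin n → E, Continuous X ∧ ∀ t, X t ∈ S t := by
  have hfin : ∀ t, (S t).Finite := by
    intro t
    obtain ⟨y, hy⟩ := hne t
    refine (Set.finite_range fun σ : Equiv.Perm (Fin n) => y ∘ σ).subset fun x hx => ?_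
    obtain ⟨σ, hσ⟩ := horb t x hx y hy
    exact ⟨σ, hσ⟩
  choose nxt hnS hnmin using fun (t : ℝ) (x : Fin n → E) =>
    Set.exists_min_image (S t) (fun y => dist x y) (hfin t) (hne t)
  choose x0 hx0 using hne
  let p : ℕ → ℕ → ℝ := fun k m => -(k : ℝ) + m / ((k : ℝ) + 1)
  let f : ℕ → ℕ → Fin n → E := fun k m =>
    Nat.rec (x0 (p k 0)) (fun m x => nxt (p k (m + 1)) x) m
  have hf1 : ∀ k m, f k (m + 1) = nxt (p k (m + 1)) (f k m) := fun k m => rfl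
  have hfS : ∀ k m, f k m ∈ S (p k m) := by
    intro k m
    cases m with
    | zero => exact hx0 _
    | succ m => rw [hf1]; exact hnS _ _
  have hpm : ∀ k, Monotone (p k) := by
    intro k a b hab
    have : (a : ℝ) ≤ b := by exact_mod_cast hab
    simp only [p]
    gcongr
  let q : ℕ → ℝ → ℕ := fun k t => ⌊(t + k) * ((k : ℝ) + 1)⌋₊
  have hq : ∀ t, Tendsto (fun k => p k (q k t)) (hyperfilter ℕ) (𝓝 t) := by
    intro t
    have : Tendsto (fun k => p k (q k t)) atTop (𝓝 t) := by
      rw [tendsto_iff_dist_tendsto_zero]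
      refine squeeze_zero' (Eventually.of_forall fun _ => dist_nonneg) ?_
        tendsto_one_div_add_atTop_nhds_zero_nat
      filter_upwards [eventually_ge_atTop ⌈-t⌉₊] with k hk
      have h0 : 0 ≤ t + k := by
        have := Nat.ceil_le.1 hk
        linarith
      have hk1 : (0 : ℝ) < (k : ℝ) + 1 := by positivity
      have h1 := Nat.floor_le (mul_nonneg h0 hk1.le)
      have h2 := Nat.lt_floor_add_one ((t + k) * ((k : ℝ) + 1))
      have h3 : ((q k t : ℕ) : ℝ) / ((k : ℝ) + 1) ≤ t + k := by
        rw [div_le_iff₀ hk1]; exact h1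
      have h4 : t + k ≤ ((q k t : ℕ) : ℝ) / ((k : ℝ) + 1) + 1 / ((k : ℝ) + 1) := by
        rw [← add_div, le_div_iff₀ hk1]; exact h2.le
      simp only [p]
      rw [Real.dist_eq, abs_le]
      constructor <;> linarith
    exact this.mono_left Nat.hyperfilter_le_atTop
  choose X hXS hX using fun t => hlim ℕ (hyperfilter ℕ) (fun k => p k (q k t)) t
    (fun k => f k (q k t)) (hq t) (fun k => hfS _ _)
  refine ⟨X, ?_, hXS⟩
  rw [Metric.continuous_iff]
  intro t0 ε hε
  set x := x0 t0
  obtain ⟨e, he, heε, hsep⟩ := sel_sep x ε hε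
  obtain ⟨δ, hδ, hnear⟩ := sel_near S horb hlim t0 x (hx0 t0) e he
  -- one step
  have hkey : ∀ k m, dist (p k m) t0 < δ → ∀ m', m ≤ m' → dist (p k m') t0 < δ →
      ∀ i a, dist (f k m i) (x a) < e → dist (f k m' i) (x a) < e := by
    intro k m hm m' hmm'
    induction m', hmm' using Nat.le_induction with
    | base => exact fun _ i a h => h
    | succ m' hmm' ih =>
      intro hm' i a hia
      have hb : dist (p k m') t0 < δ := by
        rw [Real.dist_eq, abs_lt] at hm hm' ⊢
        have h1 := hpm k hmm'
        have h2 := hpm k (Nat.le_succ m')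
        simp only [Nat.succ_eq_add_one] at h2
        constructor <;> linarith [hm.1, hm'.2]
      have ih' := ih hb i a hia
      obtain ⟨σ, hσ⟩ := hnear _ hb _ (hfS k m')
      obtain ⟨τ, hτ⟩ := hnear _ hm' _ (hfS k (m' + 1))
      have hmin := hnmin (p k (m' + 1)) (f k m') ((f k (m' + 1) ∘ τ) ∘ σ.symm)
        (hperm _ _ (hperm _ _ (hfS _ _) _) _)
      rw [← hf1] at hmin
      have h2 : dist (f k m') ((f k (m' + 1) ∘ τ) ∘ σ.symm) < 2 * e := by
        rw [dist_pi_lt_iff (by positivity)]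
        intro b
        have h3 := (dist_le_pi_dist (f k m' ∘ σ) x (σ.symm b)).trans_lt hσ
        have h4 := (dist_le_pi_dist (f k (m' + 1) ∘ τ) x (σ.symm b)).trans_lt hτ
        simp only [Function.comp_apply, Equiv.apply_symm_apply] at h3 h4 ⊢
        have := dist_triangle_right (f k m' b) (f k (m' + 1) (τ (σ.symm b))) (x (σ.symm b))
        linarith
      have h5 := (dist_le_pi_dist (f k m') (f k (m' + 1)) i).trans_lt (hmin.trans_lt h2)
      have h6 := (dist_le_pi_dist (f k (m' + 1) ∘ τ) x (τ.symm i)).trans_lt hτ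
      simp only [Function.comp_apply, Equiv.apply_symm_apply] at h6
      have h7 : x a = x (τ.symm i) := by
        apply hsep
        have t1 := dist_triangle4 (x a) (f k m' i) (f k (m' + 1) i) (x (τ.symm i))
        rw [dist_comm (x a) (f k m' i)] at t1
        linarith
      rw [h7]
      exact h6
  have hkey2 : ∀ k m m', dist (p k m) t0 < δ → m ≤ m' → dist (p k m') t0 < δ →
      dist (f k m) (f k m') ≤ 2 * e := by
    intro k m m' hm hmm' hm'
    rw [dist_pi_le_iff (by positivity)]
    intro i
    obtain ⟨σ, hσ⟩ := hnear _ hm _ (hfS k m)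
    have h6 := (dist_le_pi_dist (f k m ∘ σ) x (σ.symm i)).trans_lt hσ
    simp only [Function.comp_apply, Equiv.apply_symm_apply] at h6
    have h7 := hkey k m hm m' hmm' hm' i _ h6
    have := dist_triangle_right (f k m i) (f k m' i) (x (σ.symm i))
    linarith
  refine ⟨δ, hδ, fun t ht => ?_⟩
  refine lt_of_le_of_lt ?_ heε
  refine le_of_tendsto ((hX t).dist (hX t0)) ?_
  have e1 := (hq t).eventually (Metric.isOpen_ball.mem_nhds (Metric.mem_ball.2 ht))
  have e2 := (hq t0).eventually (Metric.ball_mem_nhds t0 hδ)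
  filter_upwards [e1, e2] with k h1 h2
  rcases le_total (q k t) (q k t0) with h | h
  · exact hkey2 k _ _ h1 h h2
  · rw [dist_comm]
    exact hkey2 k _ _ h2 h h1

end Selection

theorem frame_exists {n : ℕ}
    (A D : ℝ → Matrix (Fin n) (Fin n) ℂ) (hcA : Continuous A) (hcD : Continuous D)
    (hAD : ∀ t i j, HasDerivAt (fun t => A t i j) (D t i j) t)
    (hnormal : ∀ t : ℝ, A t * (A t)ᴴ = (A t)ᴴ * A t) (t : ℝ) :
    ∃ x V, Frame (A t) (D t) V x := by
  obtain ⟨𝒰, h𝒰⟩ := Ultrafilter.exists_le (𝓝[≠] t)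
  choose V l hV hl using fun s => normal_diag (A s) (hnormal s)
  obtain ⟨W, x, hx, -⟩ := frame_limit 𝒰 A D hcA hcD hAD t id
    (h𝒰.trans nhdsWithin_le_nhds) (h𝒰 self_mem_nhdsWithin) V l hV hl
  exact ⟨x, W, hx⟩

theorem frame_closed {n : ℕ}
    (A D : ℝ → Matrix (Fin n) (Fin n) ℂ) (hcA : Continuous A) (hcD : Continuous D)
    (hAD : ∀ t i j, HasDerivAt (fun t => A t i j) (D t i j) t)
    (hnormal : ∀ t : ℝ, A t * (A t)ᴴ = (A t)ᴴ * A t)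
    (ι : Type) (𝒰 : Ultrafilter ι) (s : ι → ℝ) (t : ℝ) (x : ι → Fin n → ℂ × ℂ)
    (hs : Tendsto s 𝒰 (𝓝 t)) (hx : ∀ k, ∃ V, Frame (A (s k)) (D (s k)) V (x k)) :
    ∃ y, (∃ V, Frame (A t) (D t) V y) ∧ Tendsto x 𝒰 (𝓝 y) := by
  by_cases hst : ∀ᶠ k in 𝒰, s k = t
  · obtain ⟨z, V, hz⟩ := frame_exists A D hcA hcD hAD hnormal t
    have : ∀ k, ∃ σ : Equiv.Perm (Fin n), s k = t → z ∘ σ = x k := by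
      intro k
      by_cases h : s k = t
      · obtain ⟨W, hW⟩ := hx k
        rw [h] at hW
        obtain ⟨σ, hσ⟩ := hW.perm_unique hz
        exact ⟨σ, fun _ => hσ⟩
      · exact ⟨1, fun h' => absurd h' h⟩
    choose σ hσ using this
    obtain ⟨τ, hτ⟩ := Ultrafilter.eq_pure_of_finite (𝒰.map σ)
    have hτ' : ∀ᶠ k in 𝒰, σ k = τ := by
      have : ({τ} : Set (Equiv.Perm (Fin n))) ∈ 𝒰.map σ := by
        rw [hτ]
        exact Ultrafilter.mem_pure.2 rfl
      exact this
    refine ⟨z ∘ τ, ⟨_, hz.comp_perm τ⟩, tendsto_const_nhds.congr' ?_⟩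
    filter_upwards [hst, hτ'] with k h1 h2
    rw [← hσ k h1, h2]
  · rw [← Ultrafilter.eventually_not] at hst
    choose V hV using hx
    obtain ⟨W, y, hy, hlim⟩ := frame_limit 𝒰 A D hcA hcD hAD t s hs hst V
      (fun k i => (x k i).1) (fun k => (hV k).1) (fun k => (hV k).2.1)
    refine ⟨y, ⟨W, hy⟩, tendsto_pi_nhds.2 fun i => ?_⟩
    have h1 := (hlim i).1
    have h2 := (hlim i).2.2
    refine (h1.prodMk_nhds h2).congr fun k => ?_
    rw [(hV k).2.2 i i rfl, if_pos rfl]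

/-- C¹ eigenvalues of C¹ curves of normal matrices: if `A : ℝ → M_n(ℂ)` has `C¹` entries and
`A t` is normal for every `t`, then the eigenvalues of `A` admit a `C¹` parameterization. -/
theorem C1_eigenvalues_of_C1_normal_curve (n : ℕ)
    (A : ℝ → Matrix (Fin n) (Fin n) ℂ)
    (hA : ∀ i j : Fin n, ContDiff ℝ 1 (fun t => A t i j))
    (hnormal : ∀ t : ℝ, A t * (A t)ᴴ = (A t)ᴴ * A t) :
    ∃ l : Fin n → ℝ → ℂ, (∀ j, ContDiff ℝ 1 (l j)) ∧
      ∀ t : ℝ, ((A t).charpoly).roots = Finset.univ.val.map (fun j => l j t) := by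
  let D : ℝ → Matrix (Fin n) (Fin n) ℂ := fun t => of fun i j => deriv (fun t => A t i j) t
  have hcA : Continuous A := continuous_pi fun i => continuous_pi fun j => (hA i j).continuous
  have hcD : Continuous D := continuous_pi fun i => continuous_pi fun j =>
    (hA i j).continuous_deriv le_rfl
  have hAD : ∀ t i j, HasDerivAt (fun t => A t i j) (D t i j) t := fun t i j =>
    (((hA i j).differentiable one_ne_zero) t).hasDerivAt
  obtain ⟨X, hXc, hXS⟩ := selection (fun t => {x | ∃ V, Frame (A t) (D t) V x})
    (frame_exists A D hcA hcD hAD hnormal)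
    (fun t x ⟨V, hx⟩ y ⟨W, hy⟩ => hx.perm_unique hy)
    (fun t x ⟨V, hx⟩ σ => ⟨_, hx.comp_perm σ⟩)
    (frame_closed A D hcA hcD hAD hnormal)
  choose V hV using hXS
  have hc : ∀ i, Continuous fun t => X t i := fun i => (continuous_apply i).comp hXc
  have hder : ∀ i t, HasDerivAt (fun t => (X t i).1) (X t i).2 t := by
    intro i t
    rw [hasDerivAt_iff_tendsto_slope, tendsto_iff_ultrafilter]
    intro 𝒰 h𝒰
    have hid : Tendsto id (𝒰 : Filter ℝ) (𝓝 t) := h𝒰.trans nhdsWithin_le_nhds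
    obtain ⟨W, y, hy, hlim⟩ := frame_limit 𝒰 A D hcA hcD hAD t id
      hid (h𝒰 self_mem_nhdsWithin) V
      (fun k i => (X k i).1) (fun k => (hV k).1) (fun k => (hV k).2.1)
    obtain ⟨h1, h2, h3⟩ := hlim i
    have hXt : Tendsto (fun s => X s i) 𝒰 (𝓝 (X t i)) := ((hc i).tendsto t).comp hid
    have e1 : (y i).1 = (X t i).1 := tendsto_nhds_unique h1 ((continuous_fst.tendsto _).comp hXt)
    have e2 : (y i).2 = (X t i).2 := by
      refine tendsto_nhds_unique h3 (((continuous_snd.tendsto _).comp hXt).congr fun s => ?_)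
      simp only [id]
      rw [(hV s).2.2 i i rfl, if_pos rfl]
      rfl
    rw [← e2]
    refine h2.congr fun s => ?_
    rw [e1]
    simp [slope_def_module, Complex.real_smul]
  refine ⟨fun i t => (X t i).1, fun i => ?_, fun t => ?_⟩
  · rw [contDiff_one_iff_deriv]
    refine ⟨fun t => (hder i t).differentiableAt, ?_⟩
    have : deriv (fun t => (X t i).1) = fun t => (X t i).2 := funext fun t => (hder i t).deriv
    rw [this]
    exact continuous_snd.comp (hc i)
  · exact roots_of_diag (A t) (V t) _ (hV t).1 (hV t).2.1
end

section
/- Twice differentiable eigenvalues of C² curves of normal matrices: let A : ℝ → M_n(ℂ) be a map whose entries are C² functions and such that A(t) is normal for every t ∈ ℝ. Then there exist functions λ_1, …, λ_n : ℝ → ℂ, each of which is twice differentiable at every point of ℝ, such that for every t ∈ ℝ the multiset {λ_1(t), …, λ_n(t)} equals the multiset of roots, counted with multiplicity, of the characteristic polynomial of A(t). -/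
section
open Filter Topology Asymptotics

namespace EigTD

variable {E F : Type*} [NormedAddCommGroup E] [NormedSpace ℝ E]
  [NormedAddCommGroup F] [NormedSpace ℝ F]

/-- twice differentiable at a point -/
def TD (f : ℝ → E) (t : ℝ) : Prop :=
  (∀ᶠ s in 𝓝 t, DifferentiableAt ℝ f s) ∧ DifferentiableAt ℝ (deriv f) t

theorem TD.of_hasDerivAt {f g : ℝ → E} {t : ℝ} (h : ∀ᶠ s in 𝓝 t, HasDerivAt f (g s) s)
    (hg : DifferentiableAt ℝ g t) : TD f t := by
  refine ⟨h.mono fun s hs => hs.differentiableAt, ?_⟩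
  refine hg.congr_of_eventuallyEq ?_
  exact h.mono fun s hs => hs.deriv

theorem TD.congr {f g : ℝ → E} {t : ℝ} (h : TD f t) (hfg : f =ᶠ[𝓝 t] g) : TD g t := by
  refine TD.of_hasDerivAt (g := deriv f) ?_ h.2
  filter_upwards [h.1, hfg.eventuallyEq_nhds] with s hs hs'
  exact hs.hasDerivAt.congr_of_eventuallyEq hs'.symm

theorem TD.differentiableAt {f : ℝ → E} {t : ℝ} (h : TD f t) : DifferentiableAt ℝ f t :=
  h.1.self_of_nhds

theorem TD.add {f g : ℝ → E} {t : ℝ} (hf : TD f t) (hg : TD g t) :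
    TD (fun s => f s + g s) t := by
  refine TD.of_hasDerivAt (g := fun s => deriv f s + deriv g s) ?_ (hf.2.add hg.2)
  filter_upwards [hf.1, hg.1] with s h1 h2 using h1.hasDerivAt.add h2.hasDerivAt

theorem TD.sub {f g : ℝ → E} {t : ℝ} (hf : TD f t) (hg : TD g t) :
    TD (fun s => f s - g s) t := by
  refine TD.of_hasDerivAt (g := fun s => deriv f s - deriv g s) ?_ (hf.2.sub hg.2)
  filter_upwards [hf.1, hg.1] with s h1 h2 using h1.hasDerivAt.sub h2.hasDerivAt

theorem TD.smul {c : ℝ → ℝ} {g : ℝ → E} {t : ℝ} (hf : TD c t) (hg : TD g t) :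
    TD (fun s => c s • g s) t := by
  refine TD.of_hasDerivAt (g := fun s => c s • deriv g s + deriv c s • g s) ?_ ?_
  · filter_upwards [hf.1, hg.1] with s h1 h2 using h1.hasDerivAt.smul h2.hasDerivAt
  · exact (hf.differentiableAt.smul hg.2).add (hf.2.smul hg.differentiableAt)

theorem TD.comp {f : ℝ → E} {φ : E → F} {t : ℝ} (hφ : ContDiffAt ℝ 2 φ (f t)) (hf : TD f t) :
    TD (fun s => φ (f s)) t := by
  refine TD.of_hasDerivAt (g := fun s => fderiv ℝ φ (f s) (deriv f s)) ?_ ?_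
  · have h1 := hf.differentiableAt.continuousAt.eventually (hφ.eventually (by decide))
    filter_upwards [hf.1, h1] with s h2 h3
    exact (h3.differentiableAt (by decide)).hasFDerivAt.comp_hasDerivAt s h2.hasDerivAt
  · have h3 : DifferentiableAt ℝ (fderiv ℝ φ) (f t) :=
      (hφ.fderiv_right (m := 1) (by norm_num)).differentiableAt (by decide)
    exact (DifferentiableAt.comp t h3 hf.differentiableAt).clm_apply hf.2

theorem TD.clm {f : ℝ → E} {t : ℝ} (φ : E →L[ℝ] F) (hf : TD f t) :
    TD (fun s => φ (f s)) t := hf.comp φ.contDiff.contDiffAt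

theorem TD.of_contDiffAt {f : ℝ → E} {t : ℝ} (hf : ContDiffAt ℝ 2 f t) : TD f t := by
  have : TD (fun s : ℝ => s) t :=
    TD.of_hasDerivAt (g := fun _ => 1) (Eventually.of_forall fun s => hasDerivAt_id s)
      (differentiableAt_const _)
  exact this.comp hf

theorem isLittleO_sq {h h' : ℝ → E} {t : ℝ} (h0 : h t = 0)
    (hd : ∀ᶠ s in 𝓝 t, HasDerivAt h (h' s) s) (ho : h' =o[𝓝 t] fun s => s - t) :
    h =o[𝓝 t] fun s => (s - t) ^ 2 := by
  rw [isLittleO_iff]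
  intro c hc
  obtain ⟨δ, hδ, H⟩ := Metric.eventually_nhds_iff_ball.1 (hd.and (isLittleO_iff.1 ho hc))
  refine Metric.eventually_nhds_iff_ball.2 ⟨δ, hδ, fun s hs => ?_⟩
  have hs' : |s - t| < δ := by simpa [Real.dist_eq] using hs
  have := (convex_closedBall t |s - t|).norm_image_sub_le_of_norm_hasDerivWithin_le
    (f := h) (f' := h') (C := c * |s - t|) (x := t) (y := s) (fun x hx => ?_) (fun x hx => ?_) ?_ ?_
  · rw [h0, sub_zero] at this
    refine this.trans (le_of_eq ?_)
    rw [Real.norm_eq_abs, Real.norm_eq_abs, abs_pow]; ring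
  · have hx' : |x - t| ≤ |s - t| := by simpa [Real.dist_eq] using hx
    exact (H x (by simp [Real.dist_eq]; linarith)).1.hasDerivWithinAt
  · have hx' : |x - t| ≤ |s - t| := by simpa [Real.dist_eq] using hx
    refine (H x (by simp [Real.dist_eq]; linarith)).2.trans ?_
    rw [Real.norm_eq_abs]; gcongr
  · simp
  · simp [Real.dist_eq]

theorem TD.peano {f : ℝ → E} {t : ℝ} (hf : TD f t) :
    (fun s => f s - f t - (s - t) • deriv f t - ((s - t) ^ 2 / 2) • deriv (deriv f) t)
      =o[𝓝 t] fun s => (s - t) ^ 2 := by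
  refine isLittleO_sq (h' := fun s => deriv f s - deriv f t - (s - t) • deriv (deriv f) t)
    (by simp) ?_ ?_
  · filter_upwards [hf.1] with s hs
    have h1 : HasDerivAt (fun s : ℝ => s - t) 1 s := (hasDerivAt_id s).sub_const t
    have h2 : HasDerivAt (fun s : ℝ => (s - t) ^ 2 / 2) (s - t) s := by
      have := (h1.pow 2).div_const 2
      refine HasDerivAt.congr_deriv this ?_
      norm_num
    have := ((hs.hasDerivAt.sub_const (f t)).sub (h1.smul_const (deriv f t))).sub
      (h2.smul_const (deriv (deriv f) t))
    rw [one_smul] at this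
    exact this
  · simpa using hf.2.hasDerivAt.isLittleO

/-- If all Taylor data vanish then `f = o((s-t)^2)`. -/
theorem TD.isLittleO_of_zero {f : ℝ → E} {t : ℝ} (hf : TD f t) (h0 : f t = 0)
    (h1 : deriv f t = 0) (h2 : deriv (deriv f) t = 0) : f =o[𝓝 t] fun s => (s - t) ^ 2 := by
  simpa [h0, h1, h2] using hf.peano

/-- a function vanishing frequently has zero jet -/
theorem TD.jet_zero {f : ℝ → E} {t : ℝ} (hf : TD f t) (h : ∃ᶠ s in 𝓝[≠] t, f s = 0) :
    f t = 0 ∧ deriv f t = 0 ∧ deriv (deriv f) t = 0 := by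
  have hcl : ∀ (g : ℝ → E) (y : E), Tendsto g (𝓝[≠] t) (𝓝 y) → (∃ᶠ s in 𝓝[≠] t, g s = 0) →
      y = 0 := by
    intro g y hg hfr
    by_contra hy
    exact hfr ((hg.eventually_ne hy).mono fun s hs => hs)
  have e0 : f t = 0 := hcl f _ (hf.differentiableAt.continuousAt.tendsto.mono_left
    nhdsWithin_le_nhds) h
  have e1 : deriv f t = 0 := by
    refine hcl (slope f t) _ (hasDerivAt_iff_tendsto_slope.1 hf.differentiableAt.hasDerivAt)
      (h.mono fun s hs => ?_)
    simp [slope, hs, e0]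
  refine ⟨e0, e1, ?_⟩
  have hp := hf.peano
  simp only [e0, e1, sub_zero, smul_zero] at hp
  have hp' := hp.mono (nhdsWithin_le_nhds (s := {t}ᶜ))
  by_contra hne
  have hpos : 0 < ‖deriv (deriv f) t‖ := norm_pos_iff.2 hne
  have := isLittleO_iff.1 hp' (show (0:ℝ) < ‖deriv (deriv f) t‖ / 4 by positivity)
  refine h ((this.and self_mem_nhdsWithin).mono ?_)
  rintro s ⟨hs, hst⟩ hfs
  have hst' : 0 < (s - t) ^ 2 := by
    have : s - t ≠ 0 := sub_ne_zero.2 hst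
    positivity
  rw [hfs, zero_sub, norm_neg, norm_smul] at hs
  rw [Real.norm_of_nonneg (by positivity), Real.norm_of_nonneg (by positivity)] at hs
  nlinarith [mul_pos hpos hst']

/-- gluing two functions with the same 2-jet -/
theorem TD.glue {f g : ℝ → E} {t : ℝ} (hf : TD f t) (hg : TD g t) (h0 : f t = g t)
    (h1 : deriv f t = deriv g t) (h2 : deriv (deriv f) t = deriv (deriv g) t) :
    TD (fun s => if s ≤ t then f s else g s) t := by
  have key : ∀ (u v : ℝ → E) (d : E), u t = v t → HasDerivAt u d t → HasDerivAt v d t →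
      HasDerivAt (fun s => if s ≤ t then u s else v s) d t := by
    intro u v d huv hu hv
    have hl : HasDerivWithinAt (fun s => if s ≤ t then u s else v s) d (Set.Iic t) t :=
      hu.hasDerivWithinAt.congr (fun s hs => by simp [Set.mem_Iic.1 hs]) (by simp)
    have hr : HasDerivWithinAt (fun s => if s ≤ t then u s else v s) d (Set.Ici t) t := by
      refine hv.hasDerivWithinAt.congr (fun s hs => ?_) (by simp [huv])
      rcases (Set.mem_Ici.1 hs).eq_or_lt with rfl | hlt
      · simp [huv]
      · simp [not_le.2 hlt]
    simpa using (hl.union hr)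
  refine TD.of_hasDerivAt (g := fun s => if s ≤ t then deriv f s else deriv g s) ?_ ?_
  · filter_upwards [hf.1, hg.1] with s h3 h4
    rcases lt_trichotomy s t with hlt | rfl | hlt
    · simp only [hlt.le, if_true]
      refine h3.hasDerivAt.congr_of_eventuallyEq ?_
      filter_upwards [eventually_lt_nhds hlt] with x hx
      simp [hx.le]
    · simp only [le_refl, if_true]
      exact key f g _ h0 h3.hasDerivAt (h1 ▸ h4.hasDerivAt)
    · simp only [not_le.2 hlt, if_false]
      refine h4.hasDerivAt.congr_of_eventuallyEq ?_
      filter_upwards [eventually_gt_nhds hlt] with x hx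
      simp [not_le.2 hx]
  · exact (key _ _ _ h1 hf.2.hasDerivAt (h2 ▸ hg.2.hasDerivAt)).differentiableAt

end EigTD

end

section
open Filter Topology Asymptotics

namespace EigTD

theorem exists_perm_of_map_eq {ι : Type*} [Fintype ι] {α : Type*} {f g : ι → α}
    (h : Finset.univ.val.map f = Finset.univ.val.map g) :
    ∃ σ : Equiv.Perm ι, ∀ i, f i = g (σ i) := by
  classical
  have hc : ∀ c, Nonempty ({i // f i = c} ≃ {i // g i = c}) := by
    intro c
    refine ⟨Fintype.equivOfCardEq ?_⟩
    have := congrArg (Multiset.count c) h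
    rw [Multiset.count_map, Multiset.count_map] at this
    rw [Fintype.card_subtype, Fintype.card_subtype]
    simpa [Finset.card_def, Finset.filter_val, eq_comm] using this
  refine ⟨Equiv.ofFiberEquiv fun c => (hc c).some, fun i => ?_⟩
  exact (Equiv.ofFiberEquiv_map _ i).symm

variable {ι : Type*} [Fintype ι]

/-- `l` parameterizes the multisets `M` near `t` and is twice differentiable at `t` -/
def Good (M : ℝ → Multiset ℂ) (l : ι → ℝ → ℂ) (t : ℝ) : Prop :=
  (∀ᶠ s in 𝓝 t, M s = Finset.univ.val.map fun j => l j s) ∧ ∀ j, TD (l j) t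

theorem Good.congr {M : ℝ → Multiset ℂ} {l m : ι → ℝ → ℂ} {t : ℝ} (h : Good M l t)
    (hlm : ∀ᶠ s in 𝓝 t, ∀ j, l j s = m j s) : Good M m t := by
  refine ⟨?_, fun j => (h.2 j).congr (hlm.mono fun s hs => hs j)⟩
  filter_upwards [h.1, hlm] with s h1 h2
  rw [h1]; congr 1; ext j; exact h2 j

theorem Good.perm {M : ℝ → Multiset ℂ} {l : ι → ℝ → ℂ} {t : ℝ} (h : Good M l t)
    (σ : Equiv.Perm ι) : Good M (fun j => l (σ j)) t := by
  refine ⟨?_, fun j => h.2 _⟩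
  filter_upwards [h.1] with s h1
  rw [h1]
  conv_lhs => rw [← Multiset.map_univ_val_equiv σ, Multiset.map_map]
  rfl

theorem Good.glue {M : ℝ → Multiset ℂ} {l m : ι → ℝ → ℂ} {t : ℝ} (hl : Good M l t)
    (hm : Good M m t) : ∃ σ : Equiv.Perm ι, (∀ j, l j t = m (σ j) t) ∧
      Good M (fun j s => if s ≤ t then l j s else m (σ j) s) t := by
  have h1 : ∀ᶠ s in 𝓝[≠] t, ∃ σ : Equiv.Perm ι, ∀ j, l j s = m (σ j) s := by
    refine (Filter.Eventually.filter_mono nhdsWithin_le_nhds (hl.1.and hm.1)).mono ?_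
    rintro s ⟨a, b⟩
    exact exists_perm_of_map_eq (a.symm.trans b)
  have h2 : ∃ σ : Equiv.Perm ι, ∃ᶠ s in 𝓝[≠] t, ∀ j, l j s = m (σ j) s := by
    by_contra hcon
    push Not at hcon
    have : ∀ᶠ s in 𝓝[≠] t, ∀ σ : Equiv.Perm ι, ¬ ∀ j, l j s = m (σ j) s := by
      rw [eventually_all]
      intro σ
      simpa [Filter.not_frequently] using hcon σ
    obtain ⟨s, hs1, σ, hs2⟩ := (this.and h1).exists
    exact hs1 σ hs2
  obtain ⟨σ, hσ⟩ := h2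
  have hj : ∀ j, l j t = m (σ j) t ∧ deriv (l j) t = deriv (m (σ j)) t ∧
      deriv (deriv (l j)) t = deriv (deriv (m (σ j))) t := by
    intro j
    have h3 := ((hl.2 j).sub (hm.2 (σ j))).jet_zero (hσ.mono fun s hs => sub_eq_zero.2 (hs j))
    have e1 : deriv (fun s => l j s - m (σ j) s) =ᶠ[𝓝 t] fun s => deriv (l j) s - deriv (m (σ j)) s := by
      filter_upwards [(hl.2 j).1, (hm.2 (σ j)).1] with s a b
      exact deriv_fun_sub a b
    have e2 := h3.2.2
    rw [e1.deriv_eq, deriv_fun_sub (hl.2 j).2 (hm.2 (σ j)).2] at e2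
    have e3 := h3.2.1
    rw [e1.self_of_nhds] at e3
    exact ⟨sub_eq_zero.1 h3.1, sub_eq_zero.1 e3, sub_eq_zero.1 e2⟩
  refine ⟨σ, fun j => (hj j).1, ?_, fun j => (hl.2 j).glue (hm.2 _) (hj j).1 (hj j).2.1 (hj j).2.2⟩
  filter_upwards [hl.1, (hm.perm σ).1] with s a b
  by_cases hst : s ≤ t
  · simpa [hst] using a
  · simpa [hst] using b

/-- Gluing at a point, with control elsewhere. -/
theorem Good.glue' {M : ℝ → Multiset ℂ} {l m : ι → ℝ → ℂ} {t : ℝ} (hl : Good M l t)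
    (hm : Good M m t) : ∃ p : ι → ℝ → ℂ, (∀ s ≤ t, ∀ j, p j s = l j s) ∧
      (∀ s ≤ t, Good M l s → Good M p s) ∧ (∀ s, t ≤ s → Good M m s → Good M p s) := by
  obtain ⟨σ, h0, hσ⟩ := hl.glue hm
  refine ⟨fun j s => if s ≤ t then l j s else m (σ j) s, fun s hs j => if_pos hs, fun s hs h => ?_, fun s hs h => ?_⟩
  · rcases hs.eq_or_lt with rfl | hlt
    · exact hσ
    · refine h.congr ?_
      filter_upwards [eventually_lt_nhds hlt] with x hx j
      simp [hx.le]
  · rcases hs.eq_or_lt with rfl | hlt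
    · exact hσ
    · refine (h.perm σ).congr ?_
      filter_upwards [eventually_gt_nhds hlt] with x hx j
      simp [not_le.2 hx]

/-- Gluing at a point, keeping the right part. -/
theorem Good.glue_right {M : ℝ → Multiset ℂ} {l m : ι → ℝ → ℂ} {t : ℝ} (hl : Good M l t)
    (hm : Good M m t) : ∃ p : ι → ℝ → ℂ, (∀ s, t ≤ s → ∀ j, p j s = m j s) ∧
      (∀ s ≤ t, Good M l s → Good M p s) ∧ (∀ s, t ≤ s → Good M m s → Good M p s) := by
  obtain ⟨σ, h0, hσ⟩ := hl.glue hm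
  have hσ' := hσ.perm σ⁻¹
  have hi : ∀ j, σ (σ⁻¹ j) = j := fun j => σ.apply_symm_apply j
  simp only [hi] at hσ'
  refine ⟨fun j s => if s ≤ t then l (σ⁻¹ j) s else m j s, fun s hs j => ?_, fun s hs h => ?_,
    fun s hs h => ?_⟩
  · rcases hs.eq_or_lt with rfl | hlt
    · simp only [le_refl, if_true, h0, hi]
    · simp [not_le.2 hlt]
  · rcases hs.eq_or_lt with rfl | hlt
    · exact hσ'
    · refine (h.perm σ⁻¹).congr ?_
      filter_upwards [eventually_lt_nhds hlt] with x hx j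
      simp [hx.le]
  · rcases hs.eq_or_lt with rfl | hlt
    · exact hσ'
    · refine h.congr ?_
      filter_upwards [eventually_gt_nhds hlt] with x hx j
      simp [not_le.2 hx]

theorem good_Icc {M : ℝ → Multiset ℂ} {x y : ℝ} (hxy : x ≤ y)
    (h : ∀ t ∈ Set.Icc x y, ∃ l : ι → ℝ → ℂ, ∀ᶠ s in 𝓝 t, Good M l s) :
    ∃ l : ι → ℝ → ℂ, ∀ t ∈ Set.Icc x y, Good M l t := by
  have hc : ∀ l : ι → ℝ → ℂ, IsOpen {t : Set.Icc x y | ∀ᶠ s in 𝓝 (t : ℝ), Good M l s} := by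
    intro l
    exact (isOpen_setOfPred_eventually_nhds (p := fun s => Good M l s)).preimage continuous_subtype_val
  obtain ⟨t, t0, tm, ⟨m, hm⟩, ht⟩ := exists_monotone_Icc_subset_open_cover_Icc hxy hc (by
    intro t _
    obtain ⟨l, hl⟩ := h t t.2
    exact Set.mem_iUnion.2 ⟨l, hl⟩)
  have key : ∀ n, ∃ l : ι → ℝ → ℂ, ∀ s ∈ Set.Icc x (t n : ℝ), Good M l s := by
    intro n
    induction n with
    | zero =>
      obtain ⟨l, hl⟩ := h x ⟨le_rfl, hxy⟩
      refine ⟨l, fun s hs => ?_⟩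
      rw [t0] at hs
      have : s = x := le_antisymm hs.2 hs.1
      exact this ▸ hl.self_of_nhds
    | succ n ih =>
      obtain ⟨l, hl⟩ := ih
      obtain ⟨m, hm⟩ := ht n
      have hm' : ∀ s ∈ Set.Icc (t n : ℝ) (t (n+1) : ℝ), Good M m s := by
        intro s hs
        have : (⟨s, (t n).2.1.trans hs.1, hs.2.trans (t (n+1)).2.2⟩ : Set.Icc x y) ∈
          Set.Icc (t n) (t (n+1)) := ⟨hs.1, hs.2⟩
        exact (hm this).self_of_nhds
      obtain ⟨p, _, hp1, hp2⟩ := (hl (t n) ⟨(t n).2.1, le_rfl⟩).glue'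
        (hm' (t n) ⟨le_rfl, tm (Nat.le_succ n)⟩)
      refine ⟨p, fun s hs => ?_⟩
      rcases le_total s (t n) with h1 | h1
      · exact hp1 s h1 (hl s ⟨hs.1, h1⟩)
      · exact hp2 s h1 (hm' s ⟨h1, hs.2⟩)
  obtain ⟨l, hl⟩ := key m
  rw [hm m le_rfl] at hl
  exact ⟨l, hl⟩

theorem good_extend {M : ℝ → Multiset ℂ} {O : Set ℝ}
    (h : ∀ t ∈ O, ∃ l : ι → ℝ → ℂ, ∀ᶠ s in 𝓝 t, Good M l s)
    {x y x' y' : ℝ} (hxy : x ≤ y) (hx : x' ≤ x) (hy : y ≤ y') (hO : Set.Icc x' y' ⊆ O)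
    {l : ι → ℝ → ℂ} (hl : ∀ t ∈ Set.Icc x y, Good M l t) :
    ∃ p : ι → ℝ → ℂ, (∀ t ∈ Set.Icc x' y', Good M p t) ∧
      ∀ t ∈ Set.Icc x y, ∀ j, p j t = l j t := by
  obtain ⟨m, hm⟩ := good_Icc (hx.trans (hxy.trans hy)) fun t ht => h t (hO ht)
  obtain ⟨p, p0, p1, p2⟩ := (hl y ⟨hxy, le_rfl⟩).glue' (hm y ⟨hx.trans hxy, hy⟩)
  have hp : ∀ t ∈ Set.Icc x y', Good M p t := by
    intro t ht
    rcases le_total t y with h1 | h1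
    · exact p1 t h1 (hl t ⟨ht.1, h1⟩)
    · exact p2 t h1 (hm t ⟨hx.trans ht.1, ht.2⟩)
  obtain ⟨q, q0, q1, q2⟩ := (hm x ⟨hx, hxy.trans hy⟩).glue_right (hp x ⟨le_rfl, hxy.trans hy⟩)
  refine ⟨q, fun t ht => ?_, fun t ht j => ?_⟩
  · rcases le_total t x with h1 | h1
    · exact q1 t h1 (hm t ht)
    · exact q2 t h1 (hp t ⟨h1, ht.2⟩)
  · rw [q0 t ht.1, p0 t ht.2]

/-- exhaustion of an open interval -/
theorem exists_exhaustion {C : Set ℝ} (hC : IsOpen C) (hCc : C.OrdConnected) (hne : C.Nonempty) :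
    ∃ x y : ℕ → ℝ, Antitone x ∧ Monotone y ∧ (∀ k, x k ≤ y k) ∧ (∀ k, Set.Icc (x k) (y k) ⊆ C) ∧
      ∀ t ∈ C, ∃ k, x k < t ∧ t < y k := by
  obtain ⟨c, hc⟩ := hne
  have : Nonempty C := ⟨⟨c, hc⟩⟩
  let d : ℕ → ℝ := fun k => (TopologicalSpace.denseSeq C k : ℝ)
  have hd : ∀ k, d k ∈ C := fun k => (TopologicalSpace.denseSeq C k).2
  have hdense : ∀ U : Set ℝ, IsOpen U → (U ∩ C).Nonempty → ∃ k, d k ∈ U := by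
    rintro U hU ⟨u, hu, huC⟩
    obtain ⟨k, hk⟩ := (TopologicalSpace.denseRange_denseSeq C).exists_mem_open
      (hU.preimage continuous_subtype_val) ⟨⟨u, huC⟩, hu⟩
    exact ⟨k, hk⟩
  have hx : ∀ k, ∃ i ≤ k, (partialSups d) k = d i := by
    intro k
    induction k with
    | zero => exact ⟨0, le_rfl, by simp⟩
    | succ k ih =>
      obtain ⟨i, hi, e⟩ := ih
      rw [partialSups_add_one, e]
      rcases le_total (d i) (d (k+1)) with h | h
      · exact ⟨k+1, le_rfl, sup_eq_right.2 h⟩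
      · exact ⟨i, hi.trans (Nat.le_succ k), sup_eq_left.2 h⟩
  have hx' : ∀ k, ∃ i ≤ k, (partialSups (fun k => - d k)) k = - d i := by
    intro k
    induction k with
    | zero => exact ⟨0, le_rfl, by simp⟩
    | succ k ih =>
      obtain ⟨i, hi, e⟩ := ih
      rw [partialSups_add_one, e]
      rcases le_total (- d i) (- d (k+1)) with h | h
      · exact ⟨k+1, le_rfl, sup_eq_right.2 h⟩
      · exact ⟨i, hi.trans (Nat.le_succ k), sup_eq_left.2 h⟩
  refine ⟨fun k => - partialSups (fun k => - d k) k, fun k => partialSups d k, ?_, ?_, ?_, ?_, ?_⟩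
  · intro a b hab
    exact neg_le_neg ((partialSups (fun k => - d k)).monotone hab)
  · exact (partialSups d).monotone
  · intro k
    have h1 := le_partialSups_of_le d (Nat.zero_le k)
    have h2 := le_partialSups_of_le (fun k => - d k) (Nat.zero_le k)
    simp only at h2 ⊢
    linarith
  · intro k
    obtain ⟨i, _, hi⟩ := hx k
    obtain ⟨i', _, hi'⟩ := hx' k
    simp only [hi, hi', neg_neg]
    exact hCc.out (hd _) (hd _)
  · intro t ht
    obtain ⟨ε, hε, hb⟩ := Metric.isOpen_iff.1 hC t ht
    obtain ⟨k1, hk1⟩ := hdense (Set.Ioi t) isOpen_Ioi ⟨t + ε/2, by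
      simp [hε], hb (by simp [abs_of_pos hε]; linarith)⟩
    obtain ⟨k2, hk2⟩ := hdense (Set.Iio t) isOpen_Iio ⟨t - ε/2, by
      simp [hε], hb (by simp [abs_of_pos hε]; linarith)⟩
    refine ⟨max k1 k2, ?_, ?_⟩
    · have := le_partialSups_of_le (fun k => - d k) (le_max_right k1 k2)
      simp only [Set.mem_Iio] at this hk2 ⊢
      linarith
    · have := le_partialSups_of_le d (le_max_left k1 k2)
      simp only [Set.mem_Ioi] at this hk1 ⊢
      linarith

theorem good_interval {M : ℝ → Multiset ℂ} {C : Set ℝ} (hC : IsOpen C) (hCc : C.OrdConnected)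
    (h : ∀ t ∈ C, ∃ l : ι → ℝ → ℂ, ∀ᶠ s in 𝓝 t, Good M l s) :
    ∃ l : ι → ℝ → ℂ, ∀ t ∈ C, Good M l t := by
  classical
  rcases C.eq_empty_or_nonempty with rfl | hne
  · exact ⟨fun _ _ => 0, by simp⟩
  obtain ⟨x, y, hx, hy, hxy, hO, hex⟩ := exists_exhaustion hC hCc hne
  obtain ⟨l0, hl0⟩ := good_Icc (hxy 0) fun t ht => h t (hO 0 ht)
  have step : ∀ k (l : {l : ι → ℝ → ℂ // ∀ t ∈ Set.Icc (x k) (y k), Good M l t}),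
      ∃ p : {l : ι → ℝ → ℂ // ∀ t ∈ Set.Icc (x (k+1)) (y (k+1)), Good M l t},
        ∀ t ∈ Set.Icc (x k) (y k), ∀ j, p.1 j t = l.1 j t := by
    intro k l
    obtain ⟨p, hp, hp'⟩ := good_extend h (hxy k) (hx (Nat.le_succ k)) (hy (Nat.le_succ k))
      (hO (k+1)) l.2
    exact ⟨⟨p, hp⟩, hp'⟩
  choose next hnext using step
  let L : ∀ k, {l : ι → ℝ → ℂ // ∀ t ∈ Set.Icc (x k) (y k), Good M l t} :=
    fun k => Nat.rec ⟨l0, hl0⟩ next k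
  have hL : ∀ k, ∀ t ∈ Set.Icc (x k) (y k), ∀ j, (L (k+1)).1 j t = (L k).1 j t :=
    fun k => hnext k (L k)
  have hL' : ∀ k d, ∀ t ∈ Set.Icc (x k) (y k), ∀ j, (L (k+d)).1 j t = (L k).1 j t := by
    intro k d t ht j
    induction d with
    | zero => rfl
    | succ d ih =>
      rw [← ih, ← add_assoc]
      exact hL (k+d) t ⟨(hx (Nat.le_add_right k d)).trans ht.1,
        ht.2.trans (hy (Nat.le_add_right k d))⟩ j
  have hLL : ∀ a b t, t ∈ Set.Icc (x a) (y a) → t ∈ Set.Icc (x b) (y b) → ∀ j,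
      (L a).1 j t = (L b).1 j t := by
    intro a b t ha hb j
    rcases le_total a b with hab | hab
    · obtain ⟨d, rfl⟩ := Nat.exists_eq_add_of_le hab
      exact (hL' a d t ha j).symm
    · obtain ⟨d, rfl⟩ := Nat.exists_eq_add_of_le hab
      exact hL' b d t hb j
  let l : ι → ℝ → ℂ := fun j t =>
    if ht : ∃ k, x k < t ∧ t < y k then (L ht.choose).1 j t else 0
  refine ⟨l, fun t ht => ?_⟩
  obtain ⟨k, hk1, hk2⟩ := hex t ht
  refine ((L k).2 t ⟨hk1.le, hk2.le⟩).congr ?_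
  filter_upwards [eventually_gt_nhds hk1, eventually_lt_nhds hk2] with s h1 h2 j
  have hs : ∃ k, x k < s ∧ s < y k := ⟨k, h1, h2⟩
  simp only [l, hs, dif_pos]
  exact hLL _ _ _ ⟨h1.le, h2.le⟩ ⟨hs.choose_spec.1.le, hs.choose_spec.2.le⟩ j

theorem good_open {M : ℝ → Multiset ℂ} {O : Set ℝ} (hO : IsOpen O)
    (h : ∀ t ∈ O, ∃ l : ι → ℝ → ℂ, ∀ᶠ s in 𝓝 t, Good M l s) :
    ∃ l : ι → ℝ → ℂ, ∀ t ∈ O, Good M l t := by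
  have hC : ∀ t, IsOpen (O.ordConnectedComponent t) := by
    intro t
    rw [isOpen_iff_mem_nhds]
    intro s hs
    have hsO : s ∈ O := Set.ordConnectedComponent_subset hs
    rw [Set.ordConnectedComponent_eq (x := t) (y := s) hs]
    rwa [Set.ordConnectedComponent_mem_nhds, ← mem_interior_iff_mem_nhds, hO.interior_eq]
  have hex : ∀ C : Set ℝ, ∃ l : ι → ℝ → ℂ, (∃ t, C = O.ordConnectedComponent t) →
      ∀ t ∈ C, Good M l t := by
    intro C
    by_cases hCt : ∃ t, C = O.ordConnectedComponent t
    · obtain ⟨t, rfl⟩ := hCt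
      obtain ⟨l, hl⟩ := good_interval (hC t) inferInstance
        fun s hs => h s (Set.ordConnectedComponent_subset hs)
      exact ⟨l, fun _ => hl⟩
    · exact ⟨fun _ _ => 0, fun h => absurd h hCt⟩
  choose L hL using hex
  refine ⟨fun j t => L (O.ordConnectedComponent t) j t, fun t ht => ?_⟩
  have htt : t ∈ O.ordConnectedComponent t := Set.self_mem_ordConnectedComponent.2 ht
  refine (hL _ ⟨t, rfl⟩ t htt).congr ?_
  filter_upwards [(hC t).mem_nhds htt] with s hs j
  rw [Set.ordConnectedComponent_eq (x := t) (y := s) hs]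

end EigTD

end

section
open Filter Topology Asymptotics Matrix
open scoped Matrix.Norms.Operator

namespace EigTD

set_option linter.unusedSectionVars false

variable {ι κ : Type} [Fintype ι] [DecidableEq ι] [Fintype κ] [DecidableEq κ]

/-- uniform diagonalizability -/
def R (N : ℕ) (K : ℝ) (A : Matrix ι ι ℂ) : Prop :=
  ∀ v : ι → ℂ, ∃ (c : Fin N → ℂ) (u : Fin N → ι → ℂ), v = ∑ i, u i ∧
    (∀ i, A *ᵥ u i = c i • u i) ∧ ∀ i, ‖u i‖ ≤ K * ‖v‖

theorem R.sub_scalar {N : ℕ} {K : ℝ} {A : Matrix ι ι ℂ} (h : R N K A) (μ : ℂ) :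
    R N K (A - μ • (1 : Matrix ι ι ℂ)) := by
  intro v
  obtain ⟨c, u, h1, h2, h3⟩ := h v
  refine ⟨fun i => c i - μ, u, h1, fun i => ?_, h3⟩
  rw [sub_mulVec, smul_mulVec, one_mulVec, h2, sub_smul]

theorem R.smul {N : ℕ} {K : ℝ} {A : Matrix ι ι ℂ} (h : R N K A) (r : ℝ) :
    R N K (r • A) := by
  intro v
  obtain ⟨c, u, h1, h2, h3⟩ := h v
  refine ⟨fun i => r • c i, u, h1, fun i => ?_, h3⟩
  rw [smul_mulVec, h2, smul_assoc]

theorem R.conj {k₁ k₂ : Type} [Fintype k₁] [Fintype k₂] [DecidableEq k₁] [DecidableEq k₂]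
    {N : ℕ} {K q q' : ℝ} (hK : 0 ≤ K) {A : Matrix ι ι ℂ}
    {F₁ : Matrix k₁ k₁ ℂ} {F₂ : Matrix k₂ k₂ ℂ} {Q : Matrix (k₁ ⊕ k₂) ι ℂ}
    {Q' : Matrix ι (k₁ ⊕ k₂) ℂ} (hQ : Q * Q' = 1)
    (hA : A = Q' * fromBlocks F₁ 0 0 F₂ * Q) (hq : ‖Q‖ ≤ q) (hq' : ‖Q'‖ ≤ q')
    (h : R N K A) : R N (q * (K * q')) F₁ ∧ R N (q * (K * q')) F₂ := by
  have hq0 : 0 ≤ q := (norm_nonneg _).trans hq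
  have hq0' : 0 ≤ q' := (norm_nonneg _).trans hq'
  have hQA : Q * A = fromBlocks F₁ 0 0 F₂ * Q := by
    rw [hA, Matrix.mul_assoc Q', ← Matrix.mul_assoc Q, hQ, Matrix.one_mul]
  have key : ∀ w : k₁ ⊕ k₂ → ℂ, ∃ (c : Fin N → ℂ) (u : Fin N → k₁ ⊕ k₂ → ℂ), w = ∑ i, u i ∧
      (∀ i, fromBlocks F₁ 0 0 F₂ *ᵥ u i = c i • u i) ∧ ∀ i, ‖u i‖ ≤ q * (K * q') * ‖w‖ := by
    intro w
    obtain ⟨c, u, h1, h2, h3⟩ := h (Q' *ᵥ w)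
    refine ⟨c, fun i => Q *ᵥ u i, ?_, fun i => ?_, fun i => ?_⟩
    · rw [← mulVec_sum, ← h1, mulVec_mulVec, hQ, one_mulVec]
    · rw [mulVec_mulVec, ← hQA, ← mulVec_mulVec, h2, mulVec_smul]
    · calc ‖Q *ᵥ u i‖ ≤ ‖Q‖ * ‖u i‖ := linfty_opNorm_mulVec _ _
        _ ≤ q * (K * (q' * ‖w‖)) := by
            gcongr
            refine (h3 i).trans ?_
            gcongr
            refine (linfty_opNorm_mulVec _ _).trans ?_
            gcongr
        _ = _ := by ring
  have hc0 : 0 ≤ q * (K * q') := by positivity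
  constructor
  · intro v
    obtain ⟨c, u, h1, h2, h3⟩ := key (Sum.elim v 0)
    refine ⟨c, fun i => u i ∘ Sum.inl, ?_, fun i => ?_, fun i => ?_⟩
    · ext j
      have := congrFun h1 (Sum.inl j)
      simpa using this
    · have := congrArg (fun w => w ∘ Sum.inl) (h2 i)
      simp [fromBlocks_mulVec] at this
      exact this
    · rw [pi_norm_le_iff_of_nonneg (by positivity)]
      intro j
      refine (norm_le_pi_norm (u i) (Sum.inl j)).trans ((h3 i).trans ?_)
      gcongr
      rw [pi_norm_le_iff_of_nonneg (by positivity)]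
      rintro (j | j)
      · simpa using norm_le_pi_norm v j
      · simp
  · intro v
    obtain ⟨c, u, h1, h2, h3⟩ := key (Sum.elim 0 v)
    refine ⟨c, fun i => u i ∘ Sum.inr, ?_, fun i => ?_, fun i => ?_⟩
    · ext j
      have := congrFun h1 (Sum.inr j)
      simpa using this
    · have := congrArg (fun w => w ∘ Sum.inr) (h2 i)
      simp [fromBlocks_mulVec] at this
      exact this
    · rw [pi_norm_le_iff_of_nonneg (by positivity)]
      intro j
      refine (norm_le_pi_norm (u i) (Sum.inr j)).trans ((h3 i).trans ?_)
      gcongr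
      rw [pi_norm_le_iff_of_nonneg (by positivity)]
      rintro (j | j)
      · simp
      · simpa using norm_le_pi_norm v j

theorem norm_eig_le {A : Matrix ι ι ℂ} {c : ℂ} {u : ι → ℂ} (hu : u ≠ 0) (h : A *ᵥ u = c • u) :
    ‖c‖ ≤ ‖A‖ := by
  have h1 := linfty_opNorm_mulVec A u
  rw [h, norm_smul] at h1
  exact le_of_mul_le_mul_right h1 (norm_pos_iff.2 hu)

theorem tendsto_mulVec {α : Type} {B : α → Matrix ι κ ℂ} {B₀ : Matrix ι κ ℂ} {u : α → κ → ℂ}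
    {u₀ : κ → ℂ} {l : Filter α} (h : Tendsto B l (𝓝 B₀)) (hu : Tendsto u l (𝓝 u₀)) :
    Tendsto (fun s => B s *ᵥ u s) l (𝓝 (B₀ *ᵥ u₀)) := by
  rw [tendsto_pi_nhds]
  intro i
  simp only [mulVec, dotProduct]
  refine tendsto_finsetSum _ fun j _ => Tendsto.mul ?_ ?_
  · exact ((continuous_id.matrix_elem i j).tendsto B₀).comp h
  · exact ((continuous_apply j).tendsto u₀).comp hu

theorem R.limit {N : ℕ} {K : ℝ} {B : ℝ → Matrix ι ι ℂ} {B₀ : Matrix ι ι ℂ} {l : Filter ℝ} [l.NeBot]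
    (hB : Tendsto B l (𝓝 B₀)) (h : ∀ᶠ s in l, R N K (B s)) : R N K B₀ := by
  intro v
  have hbd : ∀ᶠ s in l, ‖B s‖ ≤ ‖B₀‖ + 1 :=
    (hB.norm.eventually (eventually_lt_nhds (lt_add_one ‖B₀‖))).mono fun s hs => hs.le
  have hex : ∀ s, ∃ p : (Fin N → ℂ) × (Fin N → ι → ℂ), R N K (B s) → ‖B s‖ ≤ ‖B₀‖ + 1 →
      (v = ∑ i, p.2 i ∧ (∀ i, B s *ᵥ p.2 i = p.1 i • p.2 i) ∧ (∀ i, ‖p.2 i‖ ≤ K * ‖v‖) ∧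
        ∀ i, ‖p.1 i‖ ≤ ‖B₀‖ + 1) := by
    intro s
    by_cases hs : R N K (B s)
    · obtain ⟨c, u, h1, h2, h3⟩ := hs v
      refine ⟨⟨fun i => if u i = 0 then 0 else c i, u⟩, fun _ hn => ⟨h1, fun i => ?_, h3, fun i => ?_⟩⟩
      · by_cases hu : u i = 0
        · simp [hu]
        · simp [hu, h2]
      · by_cases hu : u i = 0
        · simp only [hu, if_true, norm_zero]; positivity
        · simp only [hu, if_false]
          exact (norm_eig_le hu (h2 i)).trans hn
    · exact ⟨0, fun h => absurd h hs⟩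
  choose p hp using hex
  let S : Set ((Fin N → ℂ) × (Fin N → ι → ℂ)) :=
    (Set.univ.pi fun _ => Metric.closedBall 0 (‖B₀‖ + 1)) ×ˢ
      (Set.univ.pi fun _ => Metric.closedBall 0 (K * ‖v‖))
  have hS : IsCompact S := by
    refine IsCompact.prod ?_ ?_
    · exact isCompact_univ_pi fun _ => isCompact_closedBall _ _
    · exact isCompact_univ_pi fun _ => isCompact_closedBall _ _
  have hall := h.and hbd
  let U : Ultrafilter ℝ := Ultrafilter.of l
  have hUl : (U : Filter ℝ) ≤ l := Ultrafilter.of_le l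
  have hpS : ∀ᶠ s in (U : Filter ℝ), p s ∈ S := by
    refine Filter.Eventually.filter_mono hUl (hall.mono ?_)
    rintro s ⟨h1, h2⟩
    obtain ⟨_, _, h3, h4⟩ := hp s h1 h2
    refine ⟨fun i _ => ?_, fun i _ => ?_⟩
    · simpa using h4 i
    · simpa using h3 i
  obtain ⟨a, haS, ha⟩ := hS.ultrafilter_le_nhds (U.map p) (by
    rw [Ultrafilter.coe_map, le_principal_iff]; exact hpS)
  have ha' : Tendsto p U (𝓝 a) := ha
  have hBU : Tendsto B U (𝓝 B₀) := hB.mono_left hUl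
  have hallU := Filter.Eventually.filter_mono hUl hall
  have t1 : ∀ i, Tendsto (fun s => (p s).1 i) U (𝓝 (a.1 i)) := fun i =>
    (((continuous_apply i).comp continuous_fst).tendsto a).comp ha'
  have t2 : ∀ i, Tendsto (fun s => (p s).2 i) U (𝓝 (a.2 i)) := fun i =>
    (((continuous_apply i).comp continuous_snd).tendsto a).comp ha'
  refine ⟨a.1, a.2, ?_, fun i => ?_, fun i => ?_⟩
  · refine tendsto_nhds_unique (f := fun _ => v) tendsto_const_nhds
      ((tendsto_finsetSum Finset.univ fun i _ => t2 i).congr' ?_)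
    exact hallU.mono fun s hs => (hp s hs.1 hs.2).1.symm
  · refine tendsto_nhds_unique (f := fun s => B s *ᵥ (p s).2 i) (l := (U : Filter ℝ)) ?_
      (((t1 i).smul (t2 i)).congr' ?_)
    · exact tendsto_mulVec hBU (t2 i)
    · exact hallU.mono fun s hs => ((hp s hs.1 hs.2).2.1 i).symm
  · refine le_of_tendsto (t2 i).norm ?_
    exact hallU.mono fun s hs => (hp s hs.1 hs.2).2.2.1 i

theorem R.codisjoint {N : ℕ} {K : ℝ} {B : Matrix ι ι ℂ} (h : R N K B) (a : ℂ) (v : ι → ℂ) :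
    ∃ u w, v = u + (B - a • (1 : Matrix ι ι ℂ)) *ᵥ w ∧ B *ᵥ u = a • u := by
  classical
  obtain ⟨c, u, h1, h2, -⟩ := h v
  refine ⟨∑ i, (if c i = a then u i else 0),
    ∑ i, (if c i = a then 0 else (c i - a)⁻¹ • u i), ?_, ?_⟩
  · rw [mulVec_sum, ← Finset.sum_add_distrib, h1]
    refine Finset.sum_congr rfl fun i _ => ?_
    by_cases hc : c i = a
    · simp [hc]
    · have : c i - a ≠ 0 := sub_ne_zero.2 hc
      simp only [hc, if_false, zero_add]
      rw [mulVec_smul, sub_mulVec, smul_mulVec, one_mulVec, h2, ← sub_smul, smul_smul,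
        inv_mul_cancel₀ this, one_smul]
  · rw [mulVec_sum, Finset.smul_sum]
    refine Finset.sum_congr rfl fun i _ => ?_
    by_cases hc : c i = a
    · simp [hc, h2]
    · simp [hc]

theorem mem_roots_charpoly {A : Matrix ι ι ℂ} {c : ℂ} :
    c ∈ A.charpoly.roots ↔ ∃ v, v ≠ 0 ∧ A *ᵥ v = c • v := by
  rw [Polynomial.mem_roots (charpoly_monic A).ne_zero, Polynomial.IsRoot, eval_charpoly,
    ← exists_mulVec_eq_zero_iff]
  refine exists_congr fun v => and_congr_right fun _ => ?_
  rw [sub_mulVec, sub_eq_zero, eq_comm]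
  simp

theorem R.lip {N : ℕ} {K : ℝ} (hK : 0 ≤ K) {A : Matrix ι ι ℂ} (h : R N K A) (B : Matrix ι ι ℂ)
    {c : ℂ} (hc : c ∈ B.charpoly.roots) :
    ∃ μ ∈ A.charpoly.roots, ‖c - μ‖ ≤ N * K * ‖B - A‖ := by
  by_cases hcA : c ∈ A.charpoly.roots
  · exact ⟨c, hcA, by simp; positivity⟩
  obtain ⟨v, hv, hBv⟩ := mem_roots_charpoly.1 hc
  obtain ⟨d, x, h1, h2, h3⟩ := h ((A - B) *ᵥ v)
  have hinj : ∀ w, A *ᵥ w = c • w → w = 0 := by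
    intro w hw
    by_contra hne
    exact hcA (mem_roots_charpoly.2 ⟨w, hne, hw⟩)
  have hd : ∀ i, x i ≠ 0 → d i ∈ A.charpoly.roots := fun i hi =>
    mem_roots_charpoly.2 ⟨x i, hi, h2 i⟩
  have hvy : v = ∑ i, (d i - c)⁻¹ • x i := by
    rw [← sub_eq_zero]
    apply hinj
    rw [mulVec_sub, smul_sub, sub_eq_sub_iff_sub_eq_sub, ← hBv, ← sub_mulVec, h1, mulVec_sum,
      Finset.smul_sum, ← Finset.sum_sub_distrib]
    refine Finset.sum_congr rfl fun i _ => ?_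
    by_cases hx : x i = 0
    · simp [hx]
    · have : d i - c ≠ 0 := by
        intro h0
        exact hcA (sub_eq_zero.1 h0 ▸ hd i hx)
      rw [mulVec_smul, h2, smul_comm c, ← smul_sub, ← sub_smul, smul_smul, inv_mul_cancel₀ this,
        one_smul]
  obtain ⟨i0, hi0⟩ : ∃ i, x i ≠ 0 := by
    by_contra hcon
    push Not at hcon
    apply hv
    rw [hvy]; simp [hcon]
  obtain ⟨μ, hμ, hmin⟩ := A.charpoly.roots.toFinset.exists_min_image (fun μ => ‖c - μ‖)
    ⟨d i0, by rw [Multiset.mem_toFinset]; exact hd i0 hi0⟩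
  rw [Multiset.mem_toFinset] at hμ
  refine ⟨μ, hμ, ?_⟩
  have hpos : 0 < ‖c - μ‖ := by
    rw [norm_pos_iff, sub_ne_zero]
    rintro rfl
    exact hcA hμ
  have hterm : ∀ i, ‖(d i - c)⁻¹ • x i‖ ≤ ‖c - μ‖⁻¹ * (K * (‖B - A‖ * ‖v‖)) := by
    intro i
    by_cases hx : x i = 0
    · rw [hx, smul_zero, norm_zero]; positivity
    · rw [norm_smul, norm_inv, norm_sub_rev]
      gcongr
      · exact hmin _ (by rw [Multiset.mem_toFinset]; exact hd i hx)
      · refine (h3 i).trans ?_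
        gcongr
        rw [norm_sub_rev]
        exact linfty_opNorm_mulVec _ _
  have hsum : ‖v‖ ≤ N * (‖c - μ‖⁻¹ * (K * (‖B - A‖ * ‖v‖))) := by
    calc ‖v‖ = ‖∑ i, (d i - c)⁻¹ • x i‖ := by rw [← hvy]
      _ ≤ ∑ i : Fin N, ‖c - μ‖⁻¹ * (K * (‖B - A‖ * ‖v‖)) := norm_sum_le_of_le _ fun i _ => hterm i
      _ = _ := by simp
  have hv' : 0 < ‖v‖ := norm_pos_iff.2 hv
  have : ‖c - μ‖ * ‖v‖ ≤ (N * K * ‖B - A‖) * ‖v‖ := by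
    calc ‖c - μ‖ * ‖v‖ ≤ ‖c - μ‖ * (N * (‖c - μ‖⁻¹ * (K * (‖B - A‖ * ‖v‖)))) := by gcongr
      _ = _ := by field_simp
  exact le_of_mul_le_mul_right this hv'

end EigTD

end

section
open Filter Topology Asymptotics Matrix
open scoped Matrix.Norms.Operator

namespace EigTD

theorem exists_onb {n : ℕ} (A : Matrix (Fin n) (Fin n) ℂ) (hA : A * Aᴴ = Aᴴ * A) :
    ∃ (b : OrthonormalBasis (Fin n) ℂ (EuclideanSpace ℂ (Fin n))) (c : Fin n → ℂ),
      ∀ i, A *ᵥ (b i).ofLp = c i • (b i).ofLp := by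
  classical
  set H₁ := A + Aᴴ with h₁
  set H₂ := Complex.I • (A - Aᴴ) with h₂
  have hH₁ : H₁.IsHermitian := by
    rw [Matrix.IsHermitian, h₁, conjTranspose_add, conjTranspose_conjTranspose, add_comm]
  have hH₂ : H₂.IsHermitian := by
    rw [Matrix.IsHermitian, h₂, conjTranspose_smul, conjTranspose_sub, conjTranspose_conjTranspose]
    simp only [Complex.star_def, Complex.conj_I, neg_smul, ← smul_neg, neg_sub]
  have hc : H₁ * H₂ = H₂ * H₁ := by
    simp only [h₁, h₂, Matrix.mul_smul, Matrix.smul_mul, Matrix.mul_sub, Matrix.add_mul,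
      Matrix.mul_add, Matrix.sub_mul, hA, smul_sub, smul_add]
    abel
  have hAeq : A = (2⁻¹ : ℂ) • (H₁ - Complex.I • H₂) := by
    rw [h₁, h₂, smul_smul, Complex.I_mul_I]
    ext i j
    simp
    ring
  have s₁ := isSymmetric_toEuclideanLin_iff.mpr hH₁
  have s₂ := isSymmetric_toEuclideanLin_iff.mpr hH₂
  have hcom : Commute (toEuclideanLin H₁) (toEuclideanLin H₂) := by
    show _ ∘ₗ _ = _ ∘ₗ _
    rw [← toLpLin_mul_same, hc, toLpLin_mul_same]
  have hinternal := s₁.directSum_isInternal_of_commute s₂ hcom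
  have hort := s₁.orthogonalFamily_eigenspace_inf_eigenspace s₂
  have hinternal' := DirectSum.isInternal_ne_bot_iff.mpr hinternal
  have hort' := hort.comp (γ := {i : ℂ × ℂ // Module.End.eigenspace (toEuclideanLin H₁) i.2 ⊓
    Module.End.eigenspace (toEuclideanLin H₂) i.1 ≠ ⊥}) Subtype.val_injective
  have := hinternal.submodule_iSupIndep.fintypeNeBotOfFiniteDimensional
  have hn : Module.finrank ℂ (EuclideanSpace ℂ (Fin n)) = n := finrank_euclideanSpace_fin
  let b := hinternal'.subordinateOrthonormalBasis hn hort'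
  let c := fun a => (hinternal'.subordinateOrthonormalBasisIndex hn a hort').1
  refine ⟨b, fun i => 2⁻¹ * ((c i).2 - Complex.I * (c i).1), fun i => ?_⟩
  have hm := hinternal'.subordinateOrthonormalBasis_subordinate hn i hort'
  change b i ∈ Module.End.eigenspace _ (c i).2 ⊓ Module.End.eigenspace _ (c i).1 at hm
  have e₁ := Module.End.mem_eigenspace_iff.mp hm.1
  have e₂ := Module.End.mem_eigenspace_iff.mp hm.2
  have e₁' := congrArg WithLp.ofLp e₁
  have e₂' := congrArg WithLp.ofLp e₂
  simp only [toLpLin_apply, WithLp.ofLp_smul] at e₁' e₂'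
  rw [hAeq, smul_mulVec, sub_mulVec, smul_mulVec, e₁', e₂', smul_smul, ← sub_smul, smul_smul]

theorem R_of_normal {n : ℕ} (A : Matrix (Fin n) (Fin n) ℂ) (hA : A * Aᴴ = Aᴴ * A) :
    R n (Real.sqrt n) A := by
  obtain ⟨b, c, hb⟩ := exists_onb A hA
  intro v
  refine ⟨c, fun i => (b.repr (WithLp.toLp 2 v)).ofLp i • (b i).ofLp, ?_, ?_, ?_⟩
  · have := congrArg WithLp.ofLp (b.sum_repr (WithLp.toLp 2 v))
    simpa using this.symm
  · intro i
    rw [mulVec_smul, hb, smul_comm]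
  · intro i
    have h1 : ‖(b.repr (WithLp.toLp 2 v)).ofLp i‖ ≤ ‖(WithLp.toLp 2 v : EuclideanSpace ℂ (Fin n))‖ := by
      rw [← b.repr.norm_map]
      exact PiLp.norm_apply_le _ i
    have h2 : ‖(b i).ofLp‖ ≤ 1 := by
      rw [pi_norm_le_iff_of_nonneg zero_le_one]
      intro j
      rw [← b.orthonormal.1 i]
      exact PiLp.norm_apply_le _ j
    have h3 : ‖(WithLp.toLp 2 v : EuclideanSpace ℂ (Fin n))‖ ≤ Real.sqrt n * ‖v‖ := by
      rw [EuclideanSpace.norm_eq]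
      apply Real.sqrt_le_iff.mpr ⟨by positivity, ?_⟩
      rw [mul_pow, Real.sq_sqrt (by positivity)]
      calc _ ≤ ∑ i : Fin n, ‖v‖ ^ 2 := by
            apply Finset.sum_le_sum
            intro j _
            exact pow_le_pow_left₀ (norm_nonneg _) (norm_le_pi_norm v j) 2
        _ = _ := by simp
    rw [norm_smul]
    calc _ ≤ ‖(WithLp.toLp 2 v : EuclideanSpace ℂ (Fin n))‖ * 1 := by gcongr
      _ ≤ _ := by rw [mul_one]; exact h3

end EigTD

end

section
open Filter Topology Asymptotics Matrix

namespace EigTD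

variable {E : Type*} [NormedAddCommGroup E] [NormedSpace ℝ E]

theorem hasDerivAt_sub_smul {W : ℝ → E} {t : ℝ} (hW : ContinuousAt W t) :
    HasDerivAt (fun s => (s - t) • W s) (W t) t := by
  rw [hasDerivAt_iff_tendsto_slope]
  refine (hW.tendsto.mono_left nhdsWithin_le_nhds).congr' ?_
  filter_upwards [self_mem_nhdsWithin] with s hs
  have : s - t ≠ 0 := sub_ne_zero.2 hs
  simp [slope, smul_smul, this]

theorem case_aux {F : Type*} [NormedAddCommGroup F] [NormedSpace ℝ F]
    {A B : ℝ → E} {t : ℝ} {k : ℕ} (hA : ∀ᶠ s in 𝓝 t, TD A s) (hB : ContinuousAt B t)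
    (hAB : ∀ s, A s = (s - t) ^ k • B s) {φ : E → F} (hφ : ContDiffAt ℝ 2 φ (B t))
    (G : ℝ → F)
    (hG : ∀ s, G s = (k * (s - t) ^ (k - 1)) • (φ (B s) - fderiv ℝ φ (B s) (B s))
      + fderiv ℝ φ (B s) (deriv A s))
    (h1 : HasDerivAt (fun s => (s - t) ^ k • φ (B s)) (G t) t)
    (h2 : DifferentiableAt ℝ G t) :
    ∀ᶠ s in 𝓝 t, TD (fun s => (s - t) ^ k • φ (B s)) s := by
  have hφe := hB.eventually (hφ.eventually (by decide))
  have hp : ∀ s, HasDerivAt (fun s : ℝ => (s - t) ^ k) (k * (s - t) ^ (k - 1)) s := by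
    intro s
    exact (((hasDerivAt_id s).sub_const t).pow k).congr_deriv (by simp)
  have hBT : ∀ s, s ≠ t → TD A s → TD B s := by
    intro s hs hAs
    have hst : s - t ≠ 0 := sub_ne_zero.2 hs
    have hc : TD (fun s : ℝ => ((s - t) ^ k)⁻¹) s := by
      refine TD.of_contDiffAt (ContDiffAt.inv ?_ (pow_ne_zero _ hst))
      fun_prop
    refine (hc.smul hAs).congr ?_
    filter_upwards [eventually_ne_nhds hs] with r hr
    have hrt : r - t ≠ 0 := sub_ne_zero.2 hr
    rw [hAB r, inv_smul_smul₀ (pow_ne_zero _ hrt)]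
  filter_upwards [hA, hφe] with s hAs hφs
  by_cases hs : s = t
  · subst hs
    refine TD.of_hasDerivAt (g := G) ?_ h2
    filter_upwards [hA, hφe] with r hAr hφr
    by_cases hr : r = s
    · subst hr; exact h1
    have hBr := (hBT r hr hAr).differentiableAt.hasDerivAt
    have d1 := (hp r).smul ((hφr.differentiableAt (by decide)).hasFDerivAt.comp_hasDerivAt r hBr)
    have d2 : deriv A r = (r - s) ^ k • deriv B r + (k * (r - s) ^ (k - 1)) • B r := by
      have : A = fun s' => (s' - s) ^ k • B s' := funext hAB
      rw [this]
      exact ((hp r).smul hBr).deriv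
    convert! d1 using 1
    rw [hG, d2, map_add, map_smul, map_smul, smul_sub, Function.comp]
    abel
  · refine (TD.of_contDiffAt (ContDiffAt.pow ?_ k)).smul ((hBT s hs hAs).comp hφs)
    fun_prop

theorem case_lemma {A : ℝ → E} {t : ℝ} (hA : ∀ᶠ s in 𝓝 t, TD A s)
    (hne : ¬ (A t = 0 ∧ deriv A t = 0 ∧ deriv (deriv A) t = 0)) :
    ∃ (k : ℕ) (B : ℝ → E), ContinuousAt B t ∧ B t ≠ 0 ∧ (∀ s, A s = (s - t) ^ k • B s) ∧
      ∀ (F : Type) [NormedAddCommGroup F] [NormedSpace ℝ F] (φ : E → F),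
        ContDiffAt ℝ 2 φ (B t) → ∀ᶠ s in 𝓝 t, TD (fun s => (s - t) ^ k • φ (B s)) s := by
  have hAt := hA.self_of_nhds
  by_cases h0 : A t = 0
  swap
  · refine ⟨0, A, hAt.differentiableAt.continuousAt, h0, by simp, ?_⟩
    intro F _ _ φ hφ
    filter_upwards [hA, hAt.differentiableAt.continuousAt.eventually (hφ.eventually (by decide))]
      with s h1 h2
    simpa using h1.comp h2
  by_cases h1 : deriv A t = 0
  swap
  · skip
    let B : ℝ → E := fun s => if s = t then deriv A t else (s - t)⁻¹ • A s
    have hBt : B t = deriv A t := by simp [B]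
    have hAB : ∀ s, A s = (s - t) • B s := by
      intro s
      by_cases hs : s = t
      · simp [hs, h0]
      · simp [B, hs, smul_smul, sub_ne_zero.2 hs]
    have hBd : HasDerivAt B ((2⁻¹ : ℝ) • deriv (deriv A) t) t := by
      rw [hasDerivAt_iff_isLittleO]
      have hp := hAt.peano
      have hq := (isBigO_refl (fun s : ℝ => (s - t)⁻¹) (𝓝 t)).smul_isLittleO hp
      refine (hq.congr' ?_ ?_)
      · refine Eventually.of_forall fun s => ?_
        by_cases hs : s = t
        · simp [hs]
        · have hst := sub_ne_zero.2 hs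
          simp only [h0, hBt, B, hs, if_false, smul_sub, smul_smul, sub_zero]
          congr 2
          · field_simp
            simp
          · field_simp
      · refine Eventually.of_forall fun s => ?_
        by_cases hs : s = t
        · simp [hs]
        · have hst := sub_ne_zero.2 hs
          simp only [smul_eq_mul]
          field_simp
    refine ⟨1, B, hBd.continuousAt, hBt ▸ h1, by simpa using hAB, ?_⟩
    intro F _ _ φ hφ
    have hφB : DifferentiableAt ℝ (fun s => φ (B s)) t :=
      (hφ.differentiableAt (by decide)).comp t hBd.differentiableAt
    have hφ'B : DifferentiableAt ℝ (fun s => fderiv ℝ φ (B s)) t :=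
      ((hφ.fderiv_right (m := 1) (by norm_num)).differentiableAt (by decide)).comp t
        hBd.differentiableAt
    refine case_aux hA hBd.continuousAt (by simpa using hAB) hφ
      (fun s => (φ (B s) - fderiv ℝ φ (B s) (B s)) + fderiv ℝ φ (B s) (deriv A s)) (by simp) ?_ ?_
    · have := hasDerivAt_sub_smul hφB.continuousAt
      simpa [hBt] using this
    · exact (hφB.sub (hφ'B.clm_apply hBd.differentiableAt)).add (hφ'B.clm_apply hAt.2)
  · skip
    have h2 : deriv (deriv A) t ≠ 0 := fun h => hne ⟨h0, h1, h⟩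
    let B : ℝ → E := fun s => if s = t then (2⁻¹ : ℝ) • deriv (deriv A) t else ((s - t) ^ 2)⁻¹ • A s
    have hBt : B t = (2⁻¹ : ℝ) • deriv (deriv A) t := by simp [B]
    have hAB : ∀ s, A s = (s - t) ^ 2 • B s := by
      intro s
      by_cases hs : s = t
      · simp [hs, h0]
      · simp [B, hs, smul_smul, sub_ne_zero.2 hs]
    have hBc : ContinuousAt B t := by
      have hp := hAt.peano
      have hq := (isBigO_refl (fun s : ℝ => ((s - t) ^ 2)⁻¹) (𝓝 t)).smul_isLittleO hp
      have hr : (fun s => B s - B t) =o[𝓝 t] fun _ => (1 : ℝ) := by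
        refine IsLittleO.trans_isBigO (hq.congr_left ?_) (g := fun s : ℝ => ((s - t) ^ 2)⁻¹ • (s - t) ^ 2) ?_
        · intro s
          by_cases hs : s = t
          · simp [hs]
          · have hst := sub_ne_zero.2 hs
            simp only [h0, h1, hBt, B, hs, if_false, smul_sub, smul_smul, sub_zero, smul_zero]
            congr 2
            field_simp
        · refine IsBigO.of_bound 1 (Eventually.of_forall fun s => ?_)
          by_cases hs : s = t
          · simp [hs]
          · have hst := sub_ne_zero.2 hs
            simp [hst]
      have := (isLittleO_one_iff ℝ).1 hr
      exact tendsto_sub_nhds_zero_iff.1 this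
    refine ⟨2, B, hBc, ?_, hAB, ?_⟩
    · rw [hBt]; exact smul_ne_zero (by norm_num) h2
    intro F _ _ φ hφ
    have hφB : ContinuousAt (fun s => φ (B s)) t :=
      ContinuousAt.comp (g := φ) hφ.continuousAt hBc
    have hφ'B : ContinuousAt (fun s => fderiv ℝ φ (B s)) t :=
      ContinuousAt.comp (g := fderiv ℝ φ) (hφ.fderiv_right (m := 1) (by norm_num)).continuousAt hBc
    let C : ℝ → E := dslope (deriv A) t
    have hC : ContinuousAt C t := continuousAt_dslope_same.2 hAt.2
    have hCA : ∀ s, deriv A s = (s - t) • C s := by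
      intro s
      have := sub_smul_dslope (deriv A) t s
      rw [h1, sub_zero] at this
      exact this.symm
    let W : ℝ → F := fun s => (2 : ℝ) • (φ (B s) - fderiv ℝ φ (B s) (B s)) + fderiv ℝ φ (B s) (C s)
    have hW : ContinuousAt W t :=
      ((hφB.sub (hφ'B.clm_apply hBc)).const_smul _).add (hφ'B.clm_apply hC)
    refine case_aux hA hBc hAB hφ (fun s => (s - t) • W s) ?_ ?_ ?_
    · intro s
      simp only [W, hCA, map_smul, smul_add, smul_smul]
      congr 2
      push_cast
      ring
    · have hc : ContinuousAt (fun s => (s - t) • φ (B s)) t :=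
        (continuousAt_id.sub continuousAt_const).smul hφB
      have := hasDerivAt_sub_smul hc
      simpa [smul_smul, pow_two] using this
    · exact (hasDerivAt_sub_smul hW).differentiableAt

end EigTD

end

section
open Filter Topology Asymptotics Matrix

namespace EigTD

theorem split_abs {𝔸 : Type*} [NormedRing 𝔸] [NormedAlgebra ℝ 𝔸] [FiniteDimensional ℝ 𝔸]
    (dg : 𝔸 →ₗ[ℝ] 𝔸) (D₀ : 𝔸) (h0 : dg D₀ = D₀)
    (hinj : ∀ H, dg H + ((H - dg H) * D₀ - D₀ * (H - dg H)) = 0 → H = 0) :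
    ∃ (X P P' : 𝔸 → 𝔸) (q q' δ : ℝ), ContDiffAt ℝ 2 X D₀ ∧ 0 < δ ∧
      ∀ B, ‖B - D₀‖ < δ → P B * P' B = 1 ∧ P' B * P B = 1 ∧ B = P' B * dg (X B) * P B ∧
        ‖P B‖ ≤ q ∧ ‖P' B‖ ≤ q' := by
  have : CompleteSpace 𝔸 := FiniteDimensional.complete ℝ 𝔸
  let dgc : 𝔸 →L[ℝ] 𝔸 := LinearMap.toContinuousLinearMap dg
  let off : 𝔸 →L[ℝ] 𝔸 := ContinuousLinearMap.id ℝ 𝔸 - dgc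
  have hoff : ∀ H, off H = H - dg H := fun H => rfl
  have hdgc : ∀ H, dgc H = dg H := fun H => rfl
  have hoff0 : off D₀ = 0 := by rw [hoff, h0, sub_self]
  let u : 𝔸 → 𝔸 := fun X => 1 + off X
  have hu0 : u D₀ = 1 := by simp [u, hoff0]
  have hu0' : u D₀ = ((1 : 𝔸ˣ) : 𝔸) := by rw [hu0]; rfl
  have huc : ContDiff ℝ 2 u := contDiff_const.add off.contDiff
  have hud : HasFDerivAt u off D₀ := by
    simpa [u] using off.hasFDerivAt.const_add (1 : 𝔸) (x := D₀)
  let v : 𝔸 → 𝔸 := fun X => Ring.inverse (u X)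
  have hv0 : v D₀ = 1 := by simp [v, hu0]
  have hvc : ContDiffAt ℝ 2 v D₀ := by
    have h1 : ContDiffAt ℝ 2 Ring.inverse (u D₀) := by
      rw [hu0']; exact contDiffAt_ringInverse ℝ (1 : 𝔸ˣ)
    exact h1.comp D₀ huc.contDiffAt
  have hvd : HasFDerivAt v (-off) D₀ := by
    have h1 : HasFDerivAt Ring.inverse (-ContinuousLinearMap.mulLeftRight ℝ 𝔸 1 1) (u D₀) := by
      rw [hu0']; simpa using hasFDerivAt_ringInverse (𝕜 := ℝ) (1 : 𝔸ˣ)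
    have h2 := h1.comp D₀ hud
    refine h2.congr_fderiv ?_
    ext H
    simp
  let Ψ : 𝔸 → 𝔸 := fun X => u X * dgc X * v X
  have hΨ0 : Ψ D₀ = D₀ := by simp [Ψ, hu0, hv0, hdgc, h0]
  have hΨc : ContDiffAt ℝ 2 Ψ D₀ := (huc.contDiffAt.mul dgc.contDiff.contDiffAt).mul hvc
  let L : 𝔸 →ₗ[ℝ] 𝔸 :=
    dg + (LinearMap.mulRight ℝ D₀ - LinearMap.mulLeft ℝ D₀) ∘ₗ (off : 𝔸 →ₗ[ℝ] 𝔸)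
  have hL : ∀ H, L H = dg H + ((H - dg H) * D₀ - D₀ * (H - dg H)) := fun H => rfl
  have hLinj : Function.Injective L := by
    rw [injective_iff_map_eq_zero]
    intro H hH
    exact hinj H (by rw [← hL, hH])
  let e : 𝔸 ≃L[ℝ] 𝔸 := (LinearEquiv.ofInjectiveEndo L hLinj).toContinuousLinearEquiv
  have he : ∀ H, e H = L H := fun H => rfl
  have hΨd : HasFDerivAt Ψ (e : 𝔸 →L[ℝ] 𝔸) D₀ := by
    have h1 := (hud.mul' (dgc.hasFDerivAt (x := D₀))).mul' hvd
    refine h1.congr_fderiv ?_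
    ext H
    simp [hu0, hv0, hdgc, h0, he, hL, hoff]
    noncomm_ring
  have hstr := hΨc.hasStrictFDerivAt' hΨd (by decide)
  let g := hΨc.localInverse hΨd (by decide)
  have hgc : ContDiffAt ℝ 2 g D₀ := by
    have := hΨc.to_localInverse hΨd (by decide)
    rwa [hΨ0] at this
  have hg0 : g D₀ = D₀ := by
    have := hΨc.localInverse_apply_image hΨd (by decide)
    rwa [hΨ0] at this
  have hgr : ∀ᶠ B in 𝓝 D₀, Ψ (g B) = B := by
    have := hstr.eventually_right_inverse
    rwa [hΨ0] at this
  have hunit : ∀ᶠ B in 𝓝 D₀, IsUnit (u (g B)) := by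
    have hc : ContinuousAt (fun B => u (g B)) D₀ :=
      ContinuousAt.comp (g := u) huc.continuous.continuousAt hgc.continuousAt
    have : {x : 𝔸 | IsUnit x} ∈ 𝓝 (u (g D₀)) := by
      rw [hg0, hu0']; exact Units.nhds 1
    exact hc this
  have hb1 : ∀ᶠ B in 𝓝 D₀, ‖v (g B)‖ ≤ ‖v (g D₀)‖ + 1 := by
    have hc : ContinuousAt (fun B => v (g B)) D₀ :=
      ContinuousAt.comp (g := v) (by rw [hg0]; exact hvc.continuousAt) hgc.continuousAt
    exact hc.norm.eventually (Iic_mem_nhds (by linarith))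
  have hb2 : ∀ᶠ B in 𝓝 D₀, ‖u (g B)‖ ≤ ‖u (g D₀)‖ + 1 := by
    have hc : ContinuousAt (fun B => u (g B)) D₀ :=
      ContinuousAt.comp (g := u) huc.continuous.continuousAt hgc.continuousAt
    exact hc.norm.eventually (Iic_mem_nhds (by linarith))
  obtain ⟨δ, hδ, H⟩ := Metric.eventually_nhds_iff_ball.1 (hgr.and (hunit.and (hb1.and hb2)))
  refine ⟨g, fun B => v (g B), fun B => u (g B), ‖v (g D₀)‖ + 1, ‖u (g D₀)‖ + 1, δ, hgc, hδ, fun B hB => ?_⟩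
  obtain ⟨h1, h2, h3, h4⟩ := H B (by rwa [Metric.mem_ball, dist_eq_norm])
  exact ⟨Ring.inverse_mul_cancel _ h2, Ring.mul_inverse_cancel _ h2, h1.symm, h3, h4⟩

end EigTD

end

section
open Filter Topology Asymptotics Matrix

namespace EigTD

variable {ι : Type} [Fintype ι] [DecidableEq ι]

theorem exists_block (B₀ : Matrix ι ι ℂ) (a : ℂ)
    (hcod : ∀ v : ι → ℂ, ∃ u w, v = u + (B₀ - a • (1 : Matrix ι ι ℂ)) *ᵥ w ∧ B₀ *ᵥ u = a • u)
    (heig : ∃ v, v ≠ 0 ∧ B₀ *ᵥ v = a • v) (hne : B₀ ≠ a • (1 : Matrix ι ι ℂ)) :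
    ∃ k₁ k₂ : ℕ, 0 < k₁ ∧ 0 < k₂ ∧ k₁ + k₂ = Fintype.card ι ∧
      ∃ (S : Matrix ι (Fin k₁ ⊕ Fin k₂) ℂ) (S' : Matrix (Fin k₁ ⊕ Fin k₂) ι ℂ)
        (D : Matrix (Fin k₂) (Fin k₂) ℂ), S * S' = 1 ∧ S' * S = 1 ∧ IsUnit D ∧
        S' * (B₀ - a • (1 : Matrix ι ι ℂ)) * S = fromBlocks 0 0 0 D := by
  let T := toLin' (B₀ - a • (1 : Matrix ι ι ℂ))
  have hT : ∀ v, T v = B₀ *ᵥ v - a • v := by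
    intro v
    simp [T, sub_mulVec, smul_mulVec]
  have hker : ∀ v, v ∈ T.ker ↔ B₀ *ᵥ v = a • v := by
    intro v
    rw [LinearMap.mem_ker, hT, sub_eq_zero]
  have hcodis : Codisjoint T.ker T.range := by
    rw [Submodule.codisjoint_iff_exists_add_eq]
    intro v
    obtain ⟨u, w, h1, h2⟩ := hcod v
    exact ⟨u, T w, (hker u).2 h2, ⟨w, rfl⟩, by rw [h1]; rfl⟩
  have hfr := T.finrank_range_add_finrank_ker
  rw [Module.finrank_fintype_fun_eq_card] at hfr
  have hcompl : IsCompl T.ker T.range := by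
    refine ⟨?_, hcodis⟩
    have h1 := Submodule.finrank_sup_add_finrank_inf_eq T.ker T.range
    rw [codisjoint_iff.1 hcodis, finrank_top, Module.finrank_fintype_fun_eq_card] at h1
    rw [disjoint_iff, ← Submodule.finrank_eq_zero (R := ℂ)]
    omega
  let b₁ := Module.finBasis ℂ T.ker
  let b₂ := Module.finBasis ℂ T.range
  let e := Submodule.prodEquivOfIsCompl _ _ hcompl
  let b := (b₁.prod b₂).map e
  have hbl : ∀ i, b (Sum.inl i) ∈ T.ker := by
    intro i
    simp [b, e]
  have hbr : ∀ i, b (Sum.inr i) ∈ T.range := by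
    intro i
    simp [b, e]
  have hrepr : ∀ x ∈ T.range, ∀ i, b.repr x (Sum.inl i) = 0 := by
    intro x hx i
    have : (e.symm x).1 = 0 := (Submodule.prodEquivOfIsCompl_symm_apply_fst_eq_zero _ _ hcompl).2 hx
    simp [b, this]
  refine ⟨Module.finrank ℂ T.ker, Module.finrank ℂ T.range, ?_, ?_, by omega,
    (Pi.basisFun ℂ ι).toMatrix b, b.toMatrix (Pi.basisFun ℂ ι),
    (LinearMap.toMatrix b b T).toBlocks₂₂,
    Module.Basis.toMatrix_mul_toMatrix_flip _ _, Module.Basis.toMatrix_mul_toMatrix_flip _ _, ?_, ?_⟩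
  · obtain ⟨v, hv0, hv⟩ := heig
    have : Nontrivial T.ker := ⟨⟨⟨v, (hker v).2 hv⟩, 0, fun h => hv0 (congrArg Subtype.val h)⟩⟩
    exact Module.finrank_pos
  · rw [Module.finrank_pos_iff, Submodule.nontrivial_iff_ne_bot]
    intro h
    rw [LinearMap.range_eq_bot] at h
    apply hne
    have h' : B₀ - a • (1 : Matrix ι ι ℂ) = 0 := (toLin').map_eq_zero_iff.1 h
    exact sub_eq_zero.1 h'
  · rw [← mulVec_injective_iff_isUnit]
    change Function.Injective (mulVecLin _)
    rw [injective_iff_map_eq_zero]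
    intro w hw
    rw [mulVecLin_apply] at hw
    set x := b.equivFun.symm (Sum.elim (0 : Fin (Module.finrank ℂ T.ker) → ℂ) w) with hx
    have hxr : ⇑(b.repr x) = Sum.elim (0 : Fin (Module.finrank ℂ T.ker) → ℂ) w := by
      rw [hx]; exact b.equivFun.apply_symm_apply _
    have hxm : x ∈ T.range := by
      rw [hx, Module.Basis.equivFun_symm_apply, Fintype.sum_sum_type]
      simp only [Sum.elim_inl, Sum.elim_inr, Pi.zero_apply, zero_smul, Finset.sum_const_zero,
        zero_add]
      exact Submodule.sum_mem _ fun i _ => Submodule.smul_mem _ _ (hbr i)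
    have hTx : T x = 0 := by
      have h1 := LinearMap.toMatrix_mulVec_repr b b T x
      apply b.repr.map_eq_zero_iff.1
      ext (i | i)
      · exact hrepr _ ⟨x, rfl⟩ i
      · rw [← h1, hxr]
        have h2 := congrFun hw i
        simp only [mulVec, dotProduct, toBlocks₂₂, of_apply, Pi.zero_apply] at h2
        simp only [mulVec, dotProduct, Fintype.sum_sum_type, Sum.elim_inl, Sum.elim_inr,
          Pi.zero_apply, mul_zero, Finset.sum_const_zero, zero_add, h2]
        rfl
    have hx0 : x = 0 := Submodule.disjoint_def.1 hcompl.disjoint x hTx hxm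
    rw [hx0] at hxr
    ext i
    have := congrFun hxr (Sum.inr i)
    simpa using this.symm
  · have h1 := basis_toMatrix_mul_linearMap_toMatrix_mul_basis_toMatrix b (Pi.basisFun ℂ ι) b
      (Pi.basisFun ℂ ι) T
    rw [LinearMap.toMatrix_eq_toMatrix', LinearMap.toMatrix'_toLin'] at h1
    rw [h1]
    ext (i | i) (j | j)
    · simp [LinearMap.toMatrix_apply, LinearMap.mem_ker.1 (hbl j)]
    · simp [LinearMap.toMatrix_apply, hrepr]
    · simp [LinearMap.toMatrix_apply, LinearMap.mem_ker.1 (hbl j)]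
    · rfl

section
open scoped Matrix.Norms.Operator

theorem contDiff_of_lin {E F : Type*} [NormedAddCommGroup E] [NormedSpace ℝ E]
  [NormedAddCommGroup F] [NormedSpace ℝ F] [FiniteDimensional ℝ E] (L : E →ₗ[ℝ] F) :
    ContDiff ℝ 2 L := (LinearMap.toContinuousLinearMap L).contDiff

/-- block-diagonal part -/
def dgl (k₁ k₂ : Type) : Matrix (k₁ ⊕ k₂) (k₁ ⊕ k₂) ℂ →ₗ[ℝ] Matrix (k₁ ⊕ k₂) (k₁ ⊕ k₂) ℂ where
  toFun X := fromBlocks X.toBlocks₁₁ 0 0 X.toBlocks₂₂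
  map_add' X Y := by
    ext (i | i) (j | j) <;> simp [toBlocks₁₁, toBlocks₂₂]
  map_smul' r X := by
    ext (i | i) (j | j) <;> simp [toBlocks₁₁, toBlocks₂₂]

def bl₁ (k₁ k₂ : Type) : Matrix (k₁ ⊕ k₂) (k₁ ⊕ k₂) ℂ →ₗ[ℝ] Matrix k₁ k₁ ℂ where
  toFun X := X.toBlocks₁₁
  map_add' X Y := rfl
  map_smul' r X := rfl

def bl₂ (k₁ k₂ : Type) : Matrix (k₁ ⊕ k₂) (k₁ ⊕ k₂) ℂ →ₗ[ℝ] Matrix k₂ k₂ ℂ where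
  toFun X := X.toBlocks₂₂
  map_add' X Y := rfl
  map_smul' r X := rfl

/-- conjugation as a linear map -/
def cjl {κ : Type} [Fintype κ] (S' : Matrix κ ι ℂ) (S : Matrix ι κ ℂ) :
    Matrix ι ι ℂ →ₗ[ℝ] Matrix κ κ ℂ where
  toFun B := S' * B * S
  map_add' X Y := by rw [Matrix.mul_add, Matrix.add_mul]
  map_smul' r X := by simp

theorem inj_aux {k₁ k₂ : Type} [Fintype k₁] [Fintype k₂] [DecidableEq k₁] [DecidableEq k₂]
    (a : ℂ) (D : Matrix k₂ k₂ ℂ) (hD : IsUnit D) (H : Matrix (k₁ ⊕ k₂) (k₁ ⊕ k₂) ℂ)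
    (h : dgl k₁ k₂ H + ((H - dgl k₁ k₂ H) * (fromBlocks 0 0 0 D + a • 1)
      - (fromBlocks 0 0 0 D + a • 1) * (H - dgl k₁ k₂ H)) = 0) : H = 0 := by
  have hdg : dgl k₁ k₂ H = fromBlocks H.toBlocks₁₁ 0 0 H.toBlocks₂₂ := rfl
  have hoff : H - dgl k₁ k₂ H = fromBlocks 0 H.toBlocks₁₂ H.toBlocks₂₁ 0 := by
    rw [hdg]
    ext (i | i) (j | j) <;> simp [toBlocks₁₁, toBlocks₂₂, toBlocks₁₂, toBlocks₂₁]
  rw [hoff, hdg, Matrix.mul_add, Matrix.add_mul, Matrix.mul_smul, Matrix.smul_mul, Matrix.mul_one,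
    Matrix.one_mul, add_sub_add_right_eq_sub, fromBlocks_multiply, fromBlocks_multiply,
    sub_eq_add_neg, fromBlocks_neg, fromBlocks_add, fromBlocks_add, ← fromBlocks_zero,
    fromBlocks_inj] at h
  obtain ⟨h1, h2, h3, h4⟩ := h
  simp only [Matrix.mul_zero, Matrix.zero_mul, add_zero, zero_add, neg_zero, neg_eq_zero] at h1 h2 h3 h4
  rw [← fromBlocks_toBlocks H, ← fromBlocks_zero, fromBlocks_inj]
  obtain ⟨u, rfl⟩ := hD
  refine ⟨h1, ?_, ?_, h4⟩
  · have := congrArg (· * (↑u⁻¹ : Matrix k₂ k₂ ℂ)) h2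
    simpa [Matrix.mul_assoc] using this
  · have := congrArg ((↑u⁻¹ : Matrix k₂ k₂ ℂ) * ·) h3
    simpa [← Matrix.mul_assoc] using this

theorem split_mat (B₀ : Matrix ι ι ℂ) (a : ℂ)
    (hcod : ∀ v : ι → ℂ, ∃ u w, v = u + (B₀ - a • (1 : Matrix ι ι ℂ)) *ᵥ w ∧ B₀ *ᵥ u = a • u)
    (heig : ∃ v, v ≠ 0 ∧ B₀ *ᵥ v = a • v) (hne : B₀ ≠ a • (1 : Matrix ι ι ℂ)) :
    ∃ k₁ k₂ : ℕ, 0 < k₁ ∧ 0 < k₂ ∧ k₁ + k₂ = Fintype.card ι ∧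
      ∃ (D₁ : Matrix ι ι ℂ → Matrix (Fin k₁) (Fin k₁) ℂ)
        (D₂ : Matrix ι ι ℂ → Matrix (Fin k₂) (Fin k₂) ℂ)
        (Q : Matrix ι ι ℂ → Matrix (Fin k₁ ⊕ Fin k₂) ι ℂ)
        (Q' : Matrix ι ι ℂ → Matrix ι (Fin k₁ ⊕ Fin k₂) ℂ) (q q' δ : ℝ),
        ContDiffAt ℝ 2 D₁ B₀ ∧ ContDiffAt ℝ 2 D₂ B₀ ∧ 0 < δ ∧
        ∀ B, ‖B - B₀‖ < δ → Q B * Q' B = 1 ∧ Q' B * Q B = 1 ∧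
          B = Q' B * fromBlocks (D₁ B) 0 0 (D₂ B) * Q B ∧ ‖Q B‖ ≤ q ∧ ‖Q' B‖ ≤ q' := by
  obtain ⟨k₁, k₂, hk₁, hk₂, hk, S, S', D, hS, hS', hD, hB⟩ := exists_block B₀ a hcod heig hne
  refine ⟨k₁, k₂, hk₁, hk₂, hk, ?_⟩
  have hD₀ : S' * B₀ * S = fromBlocks 0 0 0 D + a • 1 := by
    rw [← hB, Matrix.mul_sub, Matrix.sub_mul]
    simp [hS']
  obtain ⟨X, P, P', q, q', δ, hX, hδ, H⟩ := split_abs (dgl (Fin k₁) (Fin k₂)) (S' * B₀ * S) (by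
    rw [hD₀, ← fromBlocks_one, fromBlocks_smul, fromBlocks_add]
    simp [dgl]) (by rw [hD₀]; exact inj_aux a D hD)
  have hX' : ContDiffAt ℝ 2 (fun B => X (cjl S' S B)) B₀ :=
    ContDiffAt.comp (g := X) B₀ hX (contDiff_of_lin (cjl S' S)).contDiffAt
  refine ⟨fun B => bl₁ _ _ (X (cjl S' S B)), fun B => bl₂ _ _ (X (cjl S' S B)),
    fun B => P (cjl S' S B) * S', fun B => S * P' (cjl S' S B), q * ‖S'‖, ‖S‖ * q',
    δ / (‖S'‖ * ‖S‖ + 1), (contDiff_of_lin (bl₁ (Fin k₁) (Fin k₂))).contDiffAt.comp B₀ hX',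
    (contDiff_of_lin (bl₂ (Fin k₁) (Fin k₂))).contDiffAt.comp B₀ hX', by positivity, ?_⟩
  intro B hBB
  have hlt : ‖cjl S' S B - S' * B₀ * S‖ < δ := by
    change ‖S' * B * S - S' * B₀ * S‖ < δ
    rw [← Matrix.sub_mul, ← Matrix.mul_sub]
    rw [lt_div_iff₀ (by positivity)] at hBB
    have h1 := (linfty_opNorm_mul (S' * (B - B₀)) S).trans
      (mul_le_mul_of_nonneg_right (linfty_opNorm_mul S' (B - B₀)) (norm_nonneg S))
    nlinarith [norm_nonneg (B - B₀)]
  obtain ⟨h1, h2, h3, h4, h5⟩ := H _ hlt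
  refine ⟨?_, ?_, ?_, ?_, ?_⟩
  · calc P (cjl S' S B) * S' * (S * P' (cjl S' S B))
        = P (cjl S' S B) * (S' * S) * P' (cjl S' S B) := by simp only [Matrix.mul_assoc]
      _ = 1 := by rw [hS', Matrix.mul_one, h1]
  · calc S * P' (cjl S' S B) * (P (cjl S' S B) * S')
        = S * (P' (cjl S' S B) * P (cjl S' S B)) * S' := by simp only [Matrix.mul_assoc]
      _ = 1 := by rw [h2, Matrix.mul_one, hS]
  · have h6 : S * cjl S' S B * S' = B := by
      calc S * (S' * B * S) * S' = (S * S') * B * (S * S') := by simp only [Matrix.mul_assoc]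
        _ = B := by rw [hS, Matrix.one_mul, Matrix.mul_one]
    calc B = S * cjl S' S B * S' := h6.symm
      _ = S * (P' (cjl S' S B) * dgl (Fin k₁) (Fin k₂) (X (cjl S' S B)) * P (cjl S' S B)) * S' := by
          rw [← h3]
      _ = S * P' (cjl S' S B) * dgl (Fin k₁) (Fin k₂) (X (cjl S' S B)) * (P (cjl S' S B) * S') := by
          simp only [Matrix.mul_assoc]
  · exact (linfty_opNorm_mul _ _).trans (mul_le_mul_of_nonneg_right h4 (norm_nonneg _))
  · exact (linfty_opNorm_mul _ _).trans (mul_le_mul_of_nonneg_left h5 (norm_nonneg _))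

end

end EigTD

end

section
open Filter Topology Asymptotics Matrix
open scoped Matrix.Norms.Operator

namespace EigTD

section generic
variable {E : Type*} [NormedAddCommGroup E] [NormedSpace ℝ E]

theorem lip_pick {l : ℝ → ℂ} {A : ℝ → E} {s C : ℝ} (S : Finset ℂ)
    (hl : ContinuousAt l s) (hA : ContinuousAt A s)
    (h : ∀ᶠ r in 𝓝 s, ∃ μ ∈ S, ‖l r - μ‖ ≤ C * ‖A r - A s‖) :
    ∀ᶠ r in 𝓝 s, ‖l r - l s‖ ≤ C * ‖A r - A s‖ := by
  have hfin : IsClosed ((S.erase (l s) : Finset ℂ) : Set ℂ) := (Finset.finite_toSet _).isClosed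
  have hU : ((S.erase (l s) : Finset ℂ) : Set ℂ)ᶜ ∈ 𝓝 (l s) :=
    hfin.isOpen_compl.mem_nhds (by simp)
  obtain ⟨ε, hε, H⟩ := Metric.mem_nhds_iff.1 hU
  have h1 : ∀ᶠ r in 𝓝 s, ‖l r - l s‖ < ε / 2 := by
    have := Metric.continuousAt_iff'.1 hl (ε / 2) (by positivity)
    simpa [dist_eq_norm] using this
  have h2 : ∀ᶠ r in 𝓝 s, C * ‖A r - A s‖ < ε / 2 := by
    have hc : ContinuousAt (fun r => C * ‖A r - A s‖) s :=
      continuousAt_const.mul (hA.sub continuousAt_const).norm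
    exact hc.eventually (Iio_mem_nhds (by simpa using hε))
  filter_upwards [h, h1, h2] with r hr h1r h2r
  obtain ⟨μ, hμ, hle⟩ := hr
  have hμε : μ ∈ Metric.ball (l s) ε := by
    rw [Metric.mem_ball, dist_eq_norm]
    calc ‖μ - l s‖ = ‖(l r - l s) - (l r - μ)‖ := by congr 1; ring
      _ ≤ ‖l r - l s‖ + ‖l r - μ‖ := norm_sub_le _ _
      _ < ε := by linarith
  have := H hμε
  have hμl : μ = l s := by
    by_contra hne
    exact this (Finset.mem_coe.2 (Finset.mem_erase.2 ⟨hne, hμ⟩))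
  rwa [hμl] at hle

theorem deriv_le_of_lip {l : ℝ → ℂ} {A : ℝ → E} {s C : ℝ}
    (hl : DifferentiableAt ℝ l s) (hA : DifferentiableAt ℝ A s)
    (h : ∀ᶠ r in 𝓝 s, ‖l r - l s‖ ≤ C * ‖A r - A s‖) : ‖deriv l s‖ ≤ C * ‖deriv A s‖ := by
  have h1 := (hasDerivAt_iff_tendsto_slope.1 hl.hasDerivAt).norm
  have h2 := ((hasDerivAt_iff_tendsto_slope.1 hA.hasDerivAt).norm).const_mul C
  refine le_of_tendsto_of_tendsto h1 h2 ?_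
  filter_upwards [nhdsWithin_le_nhds h] with r hr
  simp only [slope, vsub_eq_sub, norm_smul]
  calc ‖(r - s)⁻¹‖ * ‖l r - l s‖ ≤ ‖(r - s)⁻¹‖ * (C * ‖A r - A s‖) := by gcongr
    _ = _ := by ring

theorem hasDeriv_zero {l : ℝ → ℂ} {A : ℝ → E} {s : ℝ} (hA : DifferentiableAt ℝ A s)
    (h0 : A s = 0) (h1 : deriv A s = 0) (h : ∀ᶠ r in 𝓝 s, ‖l r‖ ≤ ‖A r‖) :
    HasDerivAt l 0 s := by
  have hls : l s = 0 := by
    have := h.self_of_nhds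
    rw [h0, norm_zero] at this
    exact norm_le_zero_iff.1 this
  have hd := hA.hasDerivAt
  rw [h1, hasDerivAt_iff_isLittleO] at hd
  rw [hasDerivAt_iff_isLittleO]
  simp only [h0, hls, sub_zero, smul_zero] at hd ⊢
  exact IsBigO.trans_isLittleO (IsBigO.of_bound 1 (by simpa using h)) hd

theorem td_zero {l : ℝ → ℂ} {A : ℝ → E} {t C : ℝ} (hA : TD A t)
    (h1 : deriv A t = 0) (h2 : deriv (deriv A) t = 0)
    (h : ∀ᶠ s in 𝓝 t, DifferentiableAt ℝ l s ∧ ‖deriv l s‖ ≤ C * ‖deriv A s‖) : TD l t := by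
  refine ⟨h.mono fun s hs => hs.1, ?_⟩
  have hls : deriv l t = 0 := by
    have := h.self_of_nhds.2
    rw [h1, norm_zero, mul_zero] at this
    exact norm_le_zero_iff.1 this
  have hd := hA.2.hasDerivAt
  rw [h2, hasDerivAt_iff_isLittleO] at hd
  suffices HasDerivAt (deriv l) 0 t from this.differentiableAt
  rw [hasDerivAt_iff_isLittleO]
  simp only [h1, hls, sub_zero, smul_zero] at hd ⊢
  exact IsBigO.trans_isLittleO (IsBigO.of_bound C (h.mono fun s hs => hs.2)) hd

end generic

variable {ι : Type} [Fintype ι] [DecidableEq ι]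

theorem charpoly_block {k₁ k₂ : Type} [Fintype k₁] [Fintype k₂] [DecidableEq k₁] [DecidableEq k₂]
    (hcard : Fintype.card k₁ + Fintype.card k₂ = Fintype.card ι) {A : Matrix ι ι ℂ}
    {F₁ : Matrix k₁ k₁ ℂ} {F₂ : Matrix k₂ k₂ ℂ} {Q : Matrix (k₁ ⊕ k₂) ι ℂ}
    {Q' : Matrix ι (k₁ ⊕ k₂) ℂ} (hQ : Q * Q' = 1)
    (hA : A = Q' * fromBlocks F₁ 0 0 F₂ * Q) :
    A.charpoly.roots = F₁.charpoly.roots + F₂.charpoly.roots := by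
  have h := charpoly_mul_comm_of_le Q' (fromBlocks F₁ 0 0 F₂ * Q) (by simp [hcard])
  rw [← Matrix.mul_assoc, ← hA, Matrix.mul_assoc, hQ, Matrix.mul_one] at h
  have h0 : Fintype.card ι - Fintype.card (k₁ ⊕ k₂) = 0 := by simp [hcard]
  rw [h0, pow_zero, one_mul, charpoly_fromBlocks_zero₁₂] at h
  rw [h, Polynomial.roots_mul]
  exact mul_ne_zero (charpoly_monic _).ne_zero (charpoly_monic _).ne_zero

theorem roots_shift (A : Matrix ι ι ℂ) (μ : ℂ) :
    A.charpoly.roots = (A - μ • (1 : Matrix ι ι ℂ)).charpoly.roots.map (· + μ) := by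
  have h := charpoly_sub_scalar A μ
  have h1 : scalar ι μ = μ • (1 : Matrix ι ι ℂ) := by
    ext i j
    simp [Matrix.one_apply, diagonal_apply]
  rw [h1] at h
  rw [h]
  have := Polynomial.map_roots_comp_C_mul_X_add_C A.charpoly 1 μ isUnit_one
  simp only [map_one, one_mul] at this
  exact this.symm

theorem roots_zero : (0 : Matrix ι ι ℂ).charpoly.roots = Finset.univ.val.map fun _ : ι => (0 : ℂ) := by
  rw [charpoly_zero, Polynomial.roots_X_pow, Multiset.nsmul_singleton]
  simp [Multiset.map_const']

theorem sum_matching {k₁ k₂ : Type} [Fintype k₁] [Fintype k₂] (e : ι ≃ k₁ ⊕ k₂)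
    (f : k₁ → ℂ) (g : k₂ → ℂ) :
    (Finset.univ : Finset ι).val.map (fun i => Sum.elim f g (e i)) =
      Finset.univ.val.map f + Finset.univ.val.map g := by
  have h := Multiset.map_univ_val_equiv e
  have h2 : (Finset.univ : Finset ι).val.map (fun i => Sum.elim f g (e i)) =
     ((Finset.univ : Finset ι).val.map e).map (Sum.elim f g) := by
    rw [Multiset.map_map]; rfl
  rw [h2, h, ← Finset.univ_disjSum_univ, Finset.val_disjSum, Multiset.disjSum, Multiset.map_add,
    Multiset.map_map, Multiset.map_map]
  rfl

end EigTD

end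

section
open Filter Topology Asymptotics Matrix
open scoped Matrix.Norms.Operator

namespace EigTD

/-- the induction statement -/
def Claim (m : ℕ) : Prop :=
  ∀ (ι : Type) [Fintype ι] [DecidableEq ι], Fintype.card ι = m →
    ∀ (I : Set ℝ), IsOpen I → ∀ (A : ℝ → Matrix ι ι ℂ) (N : ℕ) (K : ℝ), 0 ≤ K →
      (∀ t ∈ I, TD A t) → (∀ t ∈ I, R N K (A t)) →
        ∃ l : ι → ℝ → ℂ, ∀ t ∈ I, Good (fun t => (A t).charpoly.roots) l t

variable {ι : Type} [Fintype ι] [DecidableEq ι]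

theorem local_exists (IH : ∀ m < Fintype.card ι, Claim m) {A : ℝ → Matrix ι ι ℂ} {N : ℕ} {K : ℝ}
    (hK : 0 ≤ K) {t : ℝ} (hA : ∀ᶠ s in 𝓝 t, TD A s) (hR : ∀ᶠ s in 𝓝 t, R N K (A s))
    (htr : ∀ s, (A s).trace = 0)
    (hne : ¬ (A t = 0 ∧ deriv A t = 0 ∧ deriv (deriv A) t = 0)) :
    ∃ l : ι → ℝ → ℂ, ∀ᶠ s in 𝓝 t, Good (fun t => (A t).charpoly.roots) l s := by
  obtain ⟨k, B, hBc, hB0, hAB, hcase⟩ := case_lemma hA hne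
  have hBA : ∀ s, s ≠ t → B s = ((s - t) ^ k)⁻¹ • A s := by
    intro s hs
    rw [hAB s, inv_smul_smul₀ (pow_ne_zero _ (sub_ne_zero.2 hs))]
  have hRB : R N K (B t) := by
    refine R.limit (l := 𝓝[≠] t) (B := B) (hBc.tendsto.mono_left nhdsWithin_le_nhds) ?_
    filter_upwards [nhdsWithin_le_nhds hR, self_mem_nhdsWithin] with s h1 h2
    rw [hBA s h2]
    exact h1.smul _
  have htrB : (B t).trace = 0 := by
    have hc : Tendsto (fun s => (B s).trace) (𝓝[≠] t) (𝓝 (B t).trace) := by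
      have h1 : Tendsto B (𝓝[≠] t) (𝓝 (B t)) := hBc.tendsto.mono_left nhdsWithin_le_nhds
      exact ((continuous_id.matrix_trace).tendsto (B t)).comp h1
    refine tendsto_nhds_unique hc (tendsto_const_nhds.congr' ?_)
    filter_upwards [self_mem_nhdsWithin] with s hs
    rw [hBA s hs, trace_smul, htr, smul_zero]
  have hnonempty : Nonempty ι := by
    by_contra hemp
    rw [not_nonempty_iff] at hemp
    exact hB0 (Subsingleton.elim _ _)
  obtain ⟨a, ha⟩ : ∃ a, (B t).charpoly.IsRoot a := by
    refine Complex.exists_root ?_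
    rw [charpoly_degree_eq_dim]
    exact_mod_cast Fintype.card_pos
  have ha' : a ∈ (B t).charpoly.roots :=
    (Polynomial.mem_roots (charpoly_monic _).ne_zero).2 ha
  have hBne : B t ≠ a • (1 : Matrix ι ι ℂ) := by
    intro h
    rw [h, trace_smul, trace_one, smul_eq_mul, mul_eq_zero] at htrB
    rcases htrB with h0 | h0
    · exact hB0 (by rw [h, h0, zero_smul])
    · exact Fintype.card_ne_zero (Nat.cast_eq_zero.1 h0)
  obtain ⟨k₁, k₂, hk₁, hk₂, hk, D₁, D₂, Q, Q', q, q', δ, hD₁, hD₂, hδ, H⟩ :=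
    split_mat (B t) a (hRB.codisjoint a) (mem_roots_charpoly.1 ha') hBne
  let F₁ : ℝ → Matrix (Fin k₁) (Fin k₁) ℂ := fun s => (s - t) ^ k • D₁ (B s)
  let F₂ : ℝ → Matrix (Fin k₂) (Fin k₂) ℂ := fun s => (s - t) ^ k • D₂ (B s)
  have hF₁ : ∀ᶠ s in 𝓝 t, TD F₁ s := hcase _ D₁ hD₁
  have hF₂ : ∀ᶠ s in 𝓝 t, TD F₂ s := hcase _ D₂ hD₂
  have hBδ : ∀ᶠ s in 𝓝 t, ‖B s - B t‖ < δ := by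
    have := Metric.continuousAt_iff'.1 hBc δ hδ
    simpa only [dist_eq_norm] using this
  have hAF : ∀ s, ‖B s - B t‖ < δ → A s = Q' (B s) * fromBlocks (F₁ s) 0 0 (F₂ s) * Q (B s) := by
    intro s hs
    have h1 : fromBlocks (F₁ s) 0 0 (F₂ s) =
        (s - t) ^ k • fromBlocks (D₁ (B s)) 0 0 (D₂ (B s)) := by
      rw [fromBlocks_smul, smul_zero, smul_zero]
    rw [h1, Matrix.mul_smul, Matrix.smul_mul, ← (H _ hs).2.2.1]
    exact hAB s
  obtain ⟨I, hI, hIo, hIt⟩ := eventually_nhds_iff.1 (hF₁.and (hF₂.and (hBδ.and hR)))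
  have hq : 0 ≤ q := (norm_nonneg _).trans (H (B t) (by simpa using hδ)).2.2.2.1
  have hq' : 0 ≤ q' := (norm_nonneg _).trans (H (B t) (by simpa using hδ)).2.2.2.2
  have hRF : ∀ s ∈ I, R N (q * (K * q')) (F₁ s) ∧ R N (q * (K * q')) (F₂ s) := by
    intro s hs
    obtain ⟨-, -, h3, h4⟩ := hI s hs
    obtain ⟨g1, g2, g3, g4, g5⟩ := H (B s) h3
    exact R.conj hK g1 (hAF s h3) g4 g5 h4
  obtain ⟨l₁, hl₁⟩ := IH k₁ (by omega) (Fin k₁) (by simp) I hIo F₁ N (q * (K * q'))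
    (by positivity) (fun s hs => (hI s hs).1) (fun s hs => (hRF s hs).1)
  obtain ⟨l₂, hl₂⟩ := IH k₂ (by omega) (Fin k₂) (by simp) I hIo F₂ N (q * (K * q'))
    (by positivity) (fun s hs => (hI s hs).2.1) (fun s hs => (hRF s hs).2)
  let e : ι ≃ Fin k₁ ⊕ Fin k₂ := Fintype.equivOfCardEq (by simp [hk])
  refine ⟨fun i s => Sum.elim (fun j => l₁ j s) (fun j => l₂ j s) (e i), ?_⟩
  filter_upwards [hIo.mem_nhds hIt] with s hs
  refine ⟨?_, fun i => ?_⟩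
  · filter_upwards [hIo.mem_nhds hs, (hl₁ s hs).1, (hl₂ s hs).1] with r hr e1 e2
    have h3 := (hI r hr).2.2.1
    rw [sum_matching, ← e1, ← e2]
    exact charpoly_block (by simp [hk]) (H (B r) h3).1 (hAF r h3)
  · rcases h : e i with j | j
    · simpa only [h, Sum.elim_inl] using (hl₁ s hs).2 j
    · simpa only [h, Sum.elim_inr] using (hl₂ s hs).2 j

theorem main_tracefree (IH : ∀ m < Fintype.card ι, Claim m) {A : ℝ → Matrix ι ι ℂ} {N : ℕ} {K : ℝ}
    (hK : 0 ≤ K) {I : Set ℝ} (hI : IsOpen I) (hA : ∀ t ∈ I, TD A t) (hR : ∀ t ∈ I, R N K (A t))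
    (htr : ∀ s, (A s).trace = 0) :
    ∃ l : ι → ℝ → ℂ, ∀ t ∈ I, Good (fun t => (A t).charpoly.roots) l t := by
  classical
  set M : ℝ → Multiset ℂ := fun t => (A t).charpoly.roots with hM
  let O : Set ℝ := {t | t ∈ I ∧ ∃ l : ι → ℝ → ℂ, ∀ᶠ s in 𝓝 t, Good M l s}
  have hO : IsOpen O := by
    rw [isOpen_iff_mem_nhds]
    rintro t ⟨h1, l, h2⟩
    filter_upwards [hI.mem_nhds h1, h2.eventually_nhds] with s hs1 hs2
    exact ⟨hs1, l, hs2⟩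
  obtain ⟨l₀, hl₀⟩ := good_open (ι := ι) (M := M) hO (fun t ht => ht.2)
  let l : ι → ℝ → ℂ := fun j t => if t ∈ O then l₀ j t else 0
  have hlO : ∀ t ∈ O, Good M l t := by
    intro t ht
    refine (hl₀ t ht).congr ?_
    filter_upwards [hO.mem_nhds ht] with s hs j
    simp [l, hs]
  have hjet : ∀ t ∈ I, t ∉ O → A t = 0 ∧ deriv A t = 0 ∧ deriv (deriv A) t = 0 := by
    intro t ht htO
    by_contra hne
    refine htO ⟨ht, local_exists (N := N) IH hK ?_ ?_ htr hne⟩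
    · filter_upwards [hI.mem_nhds ht] with s hs using hA s hs
    · filter_upwards [hI.mem_nhds ht] with s hs using hR s hs
  have hmatch : ∀ t ∈ I, M t = Finset.univ.val.map fun j => l j t := by
    intro t ht
    by_cases htO : t ∈ O
    · exact (hlO t htO).1.self_of_nhds
    · simp only [hM, (hjet t ht htO).1, l, htO, if_false, roots_zero]
  have hroot : ∀ t ∈ I, ∀ j, l j t ∈ (A t).charpoly.roots := by
    intro t ht j
    have h : l j t ∈ M t := by
      rw [hmatch t ht]
      exact Multiset.mem_map.2 ⟨j, Finset.mem_univ_val j, rfl⟩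
    exact h
  have hle : ∀ t ∈ I, ∀ j, ‖l j t‖ ≤ ‖A t‖ := by
    intro t ht j
    obtain ⟨v, hv0, hv⟩ := mem_roots_charpoly.1 (hroot t ht j)
    exact norm_eig_le hv0 hv
  have hder : ∀ j, ∀ s ∈ I, DifferentiableAt ℝ (l j) s ∧
      ‖deriv (l j) s‖ ≤ (N * K) * ‖deriv A s‖ := by
    intro j s hs
    by_cases hsO : s ∈ O
    · have hd := ((hlO s hsO).2 j).differentiableAt
      refine ⟨hd, deriv_le_of_lip hd (hA s hs).differentiableAt ?_⟩
      refine lip_pick (A s).charpoly.roots.toFinset hd.continuousAt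
        (hA s hs).differentiableAt.continuousAt ?_
      filter_upwards [hI.mem_nhds hs] with r hr
      obtain ⟨μ, h1, h2⟩ := (hR s hs).lip hK (A r) (hroot r hr j)
      exact ⟨μ, Multiset.mem_toFinset.2 h1, h2⟩
    · obtain ⟨h0, h1, -⟩ := hjet s hs hsO
      have := hasDeriv_zero (l := l j) (hA s hs).differentiableAt h0 h1 (by
        filter_upwards [hI.mem_nhds hs] with r hr using hle r hr j)
      refine ⟨this.differentiableAt, ?_⟩
      rw [this.deriv, norm_zero]
      positivity
  refine ⟨l, fun t ht => ?_⟩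
  by_cases htO : t ∈ O
  · exact hlO t htO
  obtain ⟨-, h1, h2⟩ := hjet t ht htO
  refine ⟨?_, fun j => ?_⟩
  · filter_upwards [hI.mem_nhds ht] with s hs using hmatch s hs
  · refine td_zero (C := N * K) (hA t ht) h1 h2 ?_
    filter_upwards [hI.mem_nhds ht] with s hs using hder j s hs

/-- averaged trace as a real-linear map -/
noncomputable def trl (ι : Type) [Fintype ι] : Matrix ι ι ℂ →ₗ[ℝ] ℂ where
  toFun A := A.trace / Fintype.card ι
  map_add' A B := by rw [trace_add, add_div]
  map_smul' r A := by
    rw [trace_smul, RingHom.id_apply, Complex.real_smul, Complex.real_smul, mul_div_assoc]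

/-- trace-free part as a real-linear map -/
noncomputable def tfl (ι : Type) [Fintype ι] [DecidableEq ι] : Matrix ι ι ℂ →ₗ[ℝ] Matrix ι ι ℂ where
  toFun A := A - trl ι A • (1 : Matrix ι ι ℂ)
  map_add' A B := by rw [map_add, add_smul]; abel
  map_smul' r A := by
    rw [map_smul, RingHom.id_apply, smul_sub, smul_assoc]

theorem claim_all (m : ℕ) : Claim m := by
  induction m using Nat.strong_induction_on with
  | _ m ih =>
  intro ι _ _ hm I hI A N K hK hA hR
  subst hm
  obtain ⟨l, hl⟩ := main_tracefree (ι := ι) ih (A := fun t => tfl ι (A t)) (N := N) hK hI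
    (fun t ht => (hA t ht).comp (contDiff_of_lin (tfl ι)).contDiffAt)
    (fun t ht => (hR t ht).sub_scalar _) (by
      intro s
      change (A s - trl ι (A s) • (1 : Matrix ι ι ℂ)).trace = 0
      rw [trace_sub, trace_smul, trace_one, smul_eq_mul]
      change _ - (A s).trace / Fintype.card ι * _ = 0
      by_cases h : (Fintype.card ι : ℂ) = 0
      · have : IsEmpty ι := Fintype.card_eq_zero_iff.1 (by exact_mod_cast h)
        simp [trace]
      · rw [div_mul_cancel₀ _ h, sub_self])
  refine ⟨fun j t => l j t + trl ι (A t), fun t ht => ⟨?_, fun j => ?_⟩⟩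
  · filter_upwards [(hl t ht).1] with s hs
    rw [roots_shift (A s) (trl ι (A s))]
    change Multiset.map _ ((tfl ι (A s)).charpoly.roots) = _
    rw [hs, Multiset.map_map]
    rfl
  · exact ((hl t ht).2 j).add ((hA t ht).comp (contDiff_of_lin (trl ι)).contDiffAt)

theorem final (n : ℕ) (A : ℝ → Matrix (Fin n) (Fin n) ℂ)
    (hA : ∀ i j, ContDiff ℝ 2 (fun t => A t i j))
    (hnormal : ∀ t, A t * (A t)ᴴ = (A t)ᴴ * A t) :
    ∃ l : Fin n → ℝ → ℂ,
      (∀ j, Differentiable ℝ (l j) ∧ ∀ t, DifferentiableAt ℝ (deriv (l j)) t) ∧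
      ∀ t, ((A t).charpoly).roots = Finset.univ.val.map (fun j => l j t) := by
  have hAc : ContDiff ℝ 2 A := by
    have h1 : ContDiff ℝ 2 (fun t => (fun i j => A t i j : Fin n → Fin n → ℂ)) :=
      contDiff_pi.2 fun i => contDiff_pi.2 fun j => hA i j
    let L : (Fin n → Fin n → ℂ) →ₗ[ℝ] Matrix (Fin n) (Fin n) ℂ :=
      { toFun := Matrix.of, map_add' := fun _ _ => rfl, map_smul' := fun _ _ => rfl }
    exact (contDiff_of_lin L).comp h1
  obtain ⟨l, hl⟩ := claim_all n (Fin n) (by simp) Set.univ isOpen_univ A n (Real.sqrt n)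
    (Real.sqrt_nonneg _) (fun t _ => TD.of_contDiffAt hAc.contDiffAt)
    (fun t _ => R_of_normal (A t) (hnormal t))
  exact ⟨l, fun j => ⟨fun t => ((hl t trivial).2 j).differentiableAt,
    fun t => ((hl t trivial).2 j).2⟩, fun t => (hl t trivial).1.self_of_nhds⟩

end EigTD

end

open Matrix

/-- Twice differentiable eigenvalues of C² curves of normal matrices: if `A : ℝ → M_n(ℂ)` has
`C²` entries and `A t` is normal for every `t`, then the eigenvalues of `A` admit a
parameterization by functions which are everywhere differentiable with everywhere
differentiable derivative (i.e. twice differentiable at every point). -/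
theorem twice_differentiable_eigenvalues_of_C2_normal_curve (n : ℕ)
    (A : ℝ → Matrix (Fin n) (Fin n) ℂ)
    (hA : ∀ i j : Fin n, ContDiff ℝ 2 (fun t => A t i j))
    (hnormal : ∀ t : ℝ, A t * (A t)ᴴ = (A t)ᴴ * A t) :
    ∃ l : Fin n → ℝ → ℂ,
      (∀ j, Differentiable ℝ (l j) ∧ ∀ t : ℝ, DifferentiableAt ℝ (deriv (l j)) t) ∧
      ∀ t : ℝ, ((A t).charpoly).roots = Finset.univ.val.map (fun j => l j t) := by
  exact EigTD.final n A hA hnormal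
end
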